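/- arXiv:math/0602165 — 4 statements merged into one kernel-verified Lean document; each statement's English description precedes it below -/
import Mathlib

section
/- Let (W,S) be a Coxeter system with W infinite whose odd Coxeter graph is connected (equivalently, any two elements of S are conjugate in W). Then W is reflection independent: for every Coxeter system (W',S') and every group isomorphism f : W → W', one has f(S^W) = S'^{W'}. -/
namespace RI

noncomputable section

variable {B : Type*} {W : Type*} [Group W] {M : CoxeterMatrix B}

/-- entries of the canonical bilinear form -/
def cf (M : CoxeterMatrix B) (i j : B) : ℝ := -Real.cos (Real.pi / (M i j : ℝ))

/-- simple root -/
def al (i : B) : B →₀ ℝ := Finsupp.single i 1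

/-- The canonical bilinear form -/
def bf (M : CoxeterMatrix B) : (B →₀ ℝ) →ₗ[ℝ] (B →₀ ℝ) →ₗ[ℝ] ℝ :=
  Finsupp.linearCombination ℝ (fun i => Finsupp.linearCombination ℝ (fun j => cf M i j))

lemma bf_al (i j : B) : bf M (al i) (al j) = cf M i j := by
  simp [bf, al]

lemma cf_symm (i j : B) : cf M i j = cf M j i := by
  unfold cf; rw [M.symmetric]

lemma cf_self (i : B) : cf M i i = 1 := by
  unfold cf; simp

lemma bf_symm (u v : B →₀ ℝ) : bf M u v = bf M v u := by
  have : bf M = (bf M).flip := by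
    ext i j
    have := bf_al (M := M) i j
    have h2 := bf_al (M := M) j i
    rw [cf_symm, ← h2] at this
    simpa [al] using this
  conv_lhs => rw [this]
  rfl

lemma M_ge_two {i j : B} (h : i ≠ j) (h0 : M i j ≠ 0) : 2 ≤ M i j := by
  have := M.off_diagonal i j h
  change M i j ≠ 1 at this
  omega

lemma cf_nonpos {i j : B} (h : i ≠ j) : cf M i j ≤ 0 := by
  unfold cf
  by_cases h0 : M i j = 0
  · simp [h0]
  · have h2 := M_ge_two h h0
    have : (2 : ℝ) ≤ M i j := by exact_mod_cast h2
    rw [neg_nonpos]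
    apply Real.cos_nonneg_of_mem_Icc
    constructor
    · have : 0 ≤ Real.pi / (M i j : ℝ) := by positivity
      linarith [Real.pi_pos]
    · apply div_le_div_of_nonneg_left Real.pi_pos.le (by norm_num) this

lemma cf_eq_zero {i j : B} (h : M i j = 2) : cf M i j = 0 := by
  unfold cf; simp [h]

lemma cf_le_neg_half {i j : B} (h : i ≠ j) (h2 : M i j ≠ 2) : cf M i j ≤ -1/2 := by
  unfold cf
  by_cases h0 : M i j = 0
  · simp [h0]; norm_num
  · have h3 := M_ge_two h h0
    have : (3 : ℝ) ≤ M i j := by exact_mod_cast (by omega : 3 ≤ M i j)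
    have h4 : Real.cos (Real.pi / 3) ≤ Real.cos (Real.pi / (M i j : ℝ)) := by
      apply Real.cos_le_cos_of_nonneg_of_le_pi
      · positivity
      · linarith [Real.pi_pos]
      · apply div_le_div_of_nonneg_left Real.pi_pos.le (by norm_num) this
    rw [Real.cos_pi_div_three] at h4
    linarith

lemma cf_le_neg_half' {i j : B} (h : i ≠ j) (h2 : cf M i j ≠ 0) : cf M i j ≤ -1/2 :=
  cf_le_neg_half h (fun h' => h2 (cf_eq_zero h'))

/-- simple reflection functional -/
def co (M : CoxeterMatrix B) (i : B) : Module.Dual ℝ (B →₀ ℝ) := (2 : ℝ) • bf M (al i)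

lemma co_al (i j : B) : co M i (al j) = 2 * cf M i j := by
  simp [co, bf_al]

lemma co_self (i : B) : co M i (al i) = 2 := by
  simp [co_al, cf_self]

/-- simple reflection -/
def sg (M : CoxeterMatrix B) (i : B) : (B →₀ ℝ) ≃ₗ[ℝ] (B →₀ ℝ) := Module.reflection (co_self (M := M) i)

lemma sg_apply (i : B) (v : B →₀ ℝ) : sg M i v = v - (2 * bf M (al i) v) • al i := by
  simp [sg, Module.reflection_apply, co]

lemma sg_mul_self (i : B) : sg M i * sg M i = 1 := by
  ext1 v
  exact Module.involutive_reflection (co_self (M := M) i) v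

lemma cheb_even (k : ℕ) (hk : 2 ≤ k) :
    (Polynomial.Chebyshev.S ℝ ((k : ℤ) - 1)).eval (2 * Real.cos (2 * (Real.pi / (2 * k)))) = 0 := by
  have hk0 : (0 : ℝ) < k := by positivity
  have hk2 : (2 : ℝ) ≤ k := by exact_mod_cast hk
  have h1 := Polynomial.Chebyshev.S_two_mul_real_cos (2 * (Real.pi / (2 * k))) ((k : ℤ) - 1)
  have hs : Real.sin (2 * (Real.pi / (2 * k))) ≠ 0 := by
    apply ne_of_gt
    apply Real.sin_pos_of_pos_of_lt_pi
    · positivity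
    · have : 2 * (Real.pi / (2 * (k : ℝ))) = Real.pi / k := by field_simp
      rw [this, div_lt_iff₀ hk0]
      nlinarith [Real.pi_pos]
  have h2 : Real.sin (((((k : ℤ) - 1 : ℤ) : ℝ) + 1) * (2 * (Real.pi / (2 * k)))) = 0 := by
    have : ((((k : ℤ) - 1 : ℤ) : ℝ) + 1) * (2 * (Real.pi / (2 * k))) = Real.pi := by
      push_cast
      field_simp
      ring
    rw [this, Real.sin_pi]
  rw [h2] at h1
  exact (mul_eq_zero.mp h1).resolve_right hs

lemma cheb_odd (k : ℕ) (hk : 1 ≤ k) :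
    (Polynomial.Chebyshev.S ℝ (k : ℤ)).eval (2 * Real.cos (2 * (Real.pi / (2 * k + 1)))) +
    (Polynomial.Chebyshev.S ℝ ((k : ℤ) - 1)).eval (2 * Real.cos (2 * (Real.pi / (2 * k + 1)))) = 0 := by
  have hk2 : (1 : ℝ) ≤ k := by exact_mod_cast hk
  set θ := 2 * (Real.pi / (2 * (k:ℝ) + 1)) with hθ
  have h1 := Polynomial.Chebyshev.S_two_mul_real_cos θ ((k : ℤ) - 1)
  have h2 := Polynomial.Chebyshev.S_two_mul_real_cos θ (k : ℤ)
  have hs : Real.sin θ ≠ 0 := by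
    apply ne_of_gt
    apply Real.sin_pos_of_pos_of_lt_pi
    · positivity
    · have : θ = (2 * Real.pi) / (2 * k + 1) := by rw [hθ]; ring
      rw [this, div_lt_iff₀ (by positivity)]
      nlinarith [Real.pi_pos]
  have h3 : Real.sin (((((k : ℤ) - 1 : ℤ) : ℝ) + 1) * θ) = - Real.sin ((((k : ℤ) : ℝ) + 1) * θ) := by
    have : (((k : ℤ) : ℝ) + 1) * θ = 2 * Real.pi - ((((k : ℤ) - 1 : ℤ) : ℝ) + 1) * θ := by
      rw [hθ]
      push_cast
      field_simp
      ring
    rw [this, Real.sin_two_pi_sub, neg_neg]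
  rw [h3] at h1
  have : ((Polynomial.Chebyshev.S ℝ (k : ℤ)).eval (2 * Real.cos θ) +
    (Polynomial.Chebyshev.S ℝ ((k : ℤ) - 1)).eval (2 * Real.cos θ)) * Real.sin θ = 0 := by
    rw [add_mul, h1, h2]; ring
  exact (mul_eq_zero.mp this).resolve_right hs

lemma sg_rel (i j : B) : (sg M i * sg M j) ^ (M i j) = 1 := by
  by_cases hij : i = j
  · subst hij
    rw [sg_mul_self, one_pow]
  by_cases h0 : M i j = 0
  · rw [h0, pow_zero]
  have h2 := M_ge_two hij h0
  ext1 z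
  have ht : (2 * Real.cos (2 * (Real.pi / (M i j : ℝ)))) = co M i (al j) * co M j (al i) - 2 := by
    rw [co_al, co_al, cf_symm j i, Real.cos_two_mul]
    unfold cf; ring
  have key := Module.reflection_mul_reflection_pow_apply (co_self (M := M) i) (co_self (M := M) j) (M i j) z
    _ ht
  change ((sg M i * sg M j) ^ (M i j)) z = _ at key
  rw [key]
  change _ = z
  by_cases h2' : M i j = 2
  · have a1 : co M i (al j) = 0 := by rw [co_al, cf_eq_zero h2', mul_zero]
    have a2 : co M j (al i) = 0 := by rw [co_al, cf_symm, cf_eq_zero h2', mul_zero]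
    have : (2 * Real.cos (2 * (Real.pi / (M i j : ℝ)))) = -2 := by
      rw [ht, a1, a2]; norm_num
    rw [this, h2']
    norm_num [Polynomial.Chebyshev.S_neg_one]
    rw [a1, a2]
    module
  rcases Nat.even_or_odd' (M i j) with ⟨k, hk | hk⟩
  · rw [hk]
    have e1 : (((2 * k : ℕ) : ℤ) - 2) / 2 = (k : ℤ) - 1 := by push_cast; omega
    have e2 : (((2 * k : ℕ) : ℤ) - 1) / 2 = (k : ℤ) - 1 := by push_cast; omega
    rw [e1, e2]
    have := cheb_even k (by omega)
    push_cast
    rw [this]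
    simp
  · rw [hk]
    have e1 : (((2 * k + 1: ℕ) : ℤ) - 1) / 2 = (k : ℤ) := by push_cast; omega
    have e2 : (((2 * k + 1: ℕ) : ℤ) - 3) / 2 = (k : ℤ) - 1 := by push_cast; omega
    have e3 : (((2 * k + 1: ℕ) : ℤ)) / 2 = (k : ℤ) := by push_cast; omega
    have e4 : (((2 * k + 1: ℕ) : ℤ) - 2) / 2 = (k : ℤ) - 1 := by push_cast; omega
    rw [e1, e2, e3, e4]
    have := cheb_odd k (by omega)
    push_cast
    rw [this]
    simp

/-- The geometric representation -/
def rho (cs : CoxeterSystem M W) : W →* ((B →₀ ℝ) ≃ₗ[ℝ] (B →₀ ℝ)) :=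
  cs.lift ⟨sg M, sg_rel⟩

variable (cs : CoxeterSystem M W)

lemma rho_simple (i : B) : rho cs (cs.simple i) = sg M i :=
  cs.lift_apply_simple sg_rel i

lemma rho_simple_apply (i : B) (v : B →₀ ℝ) :
    rho cs (cs.simple i) v = v - (2 * bf M (al i) v) • al i := by
  rw [rho_simple, sg_apply]

lemma rho_mul (w w' : W) (v : B →₀ ℝ) : rho cs (w * w') v = rho cs w (rho cs w' v) := by
  rw [map_mul]; rfl

lemma rho_one (v : B →₀ ℝ) : rho cs 1 v = v := by
  rw [map_one]; rfl

lemma rho_inv_self (w : W) (v : B →₀ ℝ) : rho cs w⁻¹ (rho cs w v) = v := by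
  rw [← rho_mul, inv_mul_cancel, rho_one]

lemma rho_self_inv (w : W) (v : B →₀ ℝ) : rho cs w (rho cs w⁻¹ v) = v := by
  rw [← rho_mul, mul_inv_cancel, rho_one]

lemma bf_inv (w : W) (u v : B →₀ ℝ) : bf M (rho cs w u) (rho cs w v) = bf M u v := by
  induction w using cs.simple_induction_left generalizing u v with
  | one => simp
  | mul_simple_left w i ih =>
    rw [rho_mul, rho_mul, rho_simple_apply, rho_simple_apply]
    rw [← ih u v]
    generalize rho cs w u = u'
    generalize rho cs w v = v'
    simp only [map_sub, map_smul, LinearMap.sub_apply, LinearMap.smul_apply, smul_eq_mul, bf_al, cf_self]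
    rw [bf_symm u' (al i)]
    ring

/-- Chebyshev-type recursion -/
def uu (c : ℝ) : ℕ → ℝ
  | 0 => 0
  | 1 => 1
  | (k+2) => 2 * c * uu c (k+1) - uu c k

lemma uu_sin (θ : ℝ) (k : ℕ) : uu (Real.cos θ) k * Real.sin θ = Real.sin (k * θ) ∧
    uu (Real.cos θ) (k+1) * Real.sin θ = Real.sin ((k+1 : ℕ) * θ) := by
  induction k with
  | zero => simp [uu]
  | succ k ih =>
    refine ⟨ih.2, ?_⟩
    rw [uu, sub_mul, ih.1, mul_assoc, ih.2]
    push_cast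
    have e1 : ((k:ℝ) + 1 + 1) * θ = (k+1) * θ + θ := by ring
    have e2 : (k:ℝ) * θ = (k+1) * θ - θ := by ring
    rw [e1, e2, Real.sin_add, Real.sin_sub]
    ring

lemma uu_one (k : ℕ) : uu 1 k = k ∧ uu 1 (k+1) = k + 1 := by
  induction k with
  | zero => simp [uu]
  | succ k ih =>
    refine ⟨by rw [ih.2]; push_cast; ring, ?_⟩
    rw [uu, ih.1, ih.2]
    push_cast; ring

lemma uu_nonneg {i j : B} (h : i ≠ j) (k : ℕ) (hk : M i j ≠ 0 → k ≤ M i j) :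
    0 ≤ uu (- cf M i j) k := by
  unfold cf
  rw [neg_neg]
  by_cases h0 : M i j = 0
  · simp [h0, (uu_one k).1]
  · have h2 := M_ge_two h h0
    have h2' : (2 : ℝ) ≤ M i j := by exact_mod_cast h2
    have hk' : (k : ℝ) ≤ M i j := by exact_mod_cast hk h0
    have h3 := (uu_sin (Real.pi / (M i j : ℝ)) k).1
    have hs : 0 < Real.sin (Real.pi / (M i j : ℝ)) := by
      apply Real.sin_pos_of_pos_of_lt_pi
      · positivity
      · rw [div_lt_iff₀ (by linarith)]
        nlinarith [Real.pi_pos]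
    have h4 : 0 ≤ Real.sin (k * (Real.pi / (M i j : ℝ))) := by
      apply Real.sin_nonneg_of_nonneg_of_le_pi
      · positivity
      · rw [← mul_div_assoc, div_le_iff₀ (by linarith)]
        nlinarith [Real.pi_pos]
    rw [← h3] at h4
    exact nonneg_of_mul_nonneg_left h4 hs

open CoxeterSystem in
lemma rho_alt (s t : B) (k : ℕ) :
    rho cs (cs.wordProd (alternatingWord s t k)) (al s) =
      if Even k then uu (-cf M s t) (k+1) • al s + uu (-cf M s t) k • al t
      else uu (-cf M s t) k • al s + uu (-cf M s t) (k+1) • al t := by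
  induction k with
  | zero => simp [alternatingWord, uu]
  | succ k ih =>
    rw [alternatingWord_succ', wordProd_cons, rho_mul, ih]
    by_cases hk : Even k
    · have h' : ¬ Even (k+1) := by simpa [Nat.even_add_one] using hk
      simp only [hk, h', if_true, if_false]
      rw [rho_simple_apply]
      simp only [map_add, map_smul, bf_al, cf_self, uu, smul_eq_mul, cf_symm t s]
      module
    · have h' : Even (k+1) := by simpa [Nat.even_add_one] using hk
      simp only [hk, h', if_true, if_false]
      rw [rho_simple_apply]
      simp only [map_add, map_smul, bf_al, cf_self, uu, smul_eq_mul]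
      module

open CoxeterSystem in
lemma strip (n : ℕ) : ∀ (s t : B) (w : W), cs.length w = n → cs.length w < cs.length (w * cs.simple s) →
    ∃ k v, w = v * cs.wordProd (alternatingWord s t k) ∧ cs.length w = cs.length v + k ∧
      cs.length v < cs.length (v * cs.simple s) ∧ cs.length v < cs.length (v * cs.simple t) := by
  induction n with
  | zero =>
    intro s t w hw hs
    refine ⟨0, w, by simp [alternatingWord], by simp, hs, ?_⟩
    rw [cs.length_eq_zero_iff] at hw
    subst hw
    simp
  | succ n ih =>
    intro s t w hw hs
    rcases cs.length_mul_simple w t with h | h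
    · exact ⟨0, w, by simp [alternatingWord], by simp, hs, by omega⟩
    · obtain ⟨k, v, h1, h2, h3, h4⟩ := ih t s (w * cs.simple t) (by omega) (by simp; omega)
      refine ⟨k+1, v, ?_, by omega, h4, h3⟩
      rw [alternatingWord_succ, wordProd_concat, ← mul_assoc, ← h1]
      simp

open CoxeterSystem in
lemma alt_split (s t : B) (m d : ℕ) : ∃ x : List B, x.length = d ∧
    alternatingWord s t (m + d) = x ++ alternatingWord s t m := by
  induction d with
  | zero => exact ⟨[], rfl, rfl⟩
  | succ d ih =>
    obtain ⟨x, hx, h⟩ := ih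
    refine ⟨(if Even (m+d) then t else s) :: x, by simp [hx], ?_⟩
    rw [← add_assoc, alternatingWord_succ', h]
    rfl

open CoxeterSystem in
lemma alt_bound (s t : B) (v w : W) (k : ℕ) (h0 : M s t ≠ 0)
    (h1 : w = v * cs.wordProd (alternatingWord s t k)) (h2 : cs.length w = cs.length v + k)
    (h3 : cs.length w < cs.length (w * cs.simple s)) : k < M s t := by
  by_contra hk
  push Not at hk
  obtain ⟨d, rfl⟩ := Nat.exists_eq_add_of_le hk
  obtain ⟨x, hx, hxe⟩ := alt_split s t (M s t) d
  have hb := cs.wordProd_braidWord_eq s t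
  unfold braidWord at hb
  rw [hxe, wordProd_append, hb] at h1
  obtain ⟨m, hm⟩ := Nat.exists_eq_succ_of_ne_zero h0
  rw [M.symmetric t s, hm, Nat.succ_eq_add_one, alternatingWord_succ, wordProd_concat] at h1
  have h4 : w * cs.simple s = v * (cs.wordProd (x ++ alternatingWord s t m)) := by
    rw [h1, wordProd_append]; simp [mul_assoc]
  have h5 := cs.length_mul_le v (cs.wordProd (x ++ alternatingWord s t m))
  have h6 := cs.length_wordProd_le (x ++ alternatingWord s t m)
  rw [← h4] at h5
  simp only [List.length_append, length_alternatingWord] at h6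
  omega

lemma al_nonneg (i : B) : (0 : B →₀ ℝ) ≤ al i := by
  unfold al
  rw [Finsupp.single_nonneg]; norm_num

lemma smul_nn {c : ℝ} {v : B →₀ ℝ} (hc : 0 ≤ c) (hv : 0 ≤ v) : 0 ≤ c • v := by
  intro i
  have := hv i
  simp only [Finsupp.smul_apply, smul_eq_mul, Finsupp.coe_zero, Pi.zero_apply] at *
  positivity

lemma pos_of_length (n : ℕ) : ∀ (w : W) (s : B), cs.length w = n →
    cs.length w < cs.length (w * cs.simple s) → 0 ≤ rho cs w (al s) := by
  induction n using Nat.strong_induction_on with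
  | _ n ih =>
  intro w s hn hs
  by_cases hw : w = 1
  · subst hw; rw [rho_one]; exact al_nonneg s
  obtain ⟨t, ht⟩ := cs.exists_rightDescent_of_ne_one hw
  have hst : s ≠ t := by
    rintro rfl
    unfold CoxeterSystem.IsRightDescent at ht
    omega
  obtain ⟨k, v, h1, h2, h3, h4⟩ := strip cs n s t w hn hs
  have hk : k ≠ 0 := by
    rintro rfl
    simp [CoxeterSystem.alternatingWord] at h1
    subst h1
    unfold CoxeterSystem.IsRightDescent at ht
    omega
  have hb : M s t ≠ 0 → k < M s t := fun h0 => alt_bound cs s t v w k h0 h1 h2 hs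
  have p1 := ih (cs.length v) (by omega) v s rfl h3
  have p2 := ih (cs.length v) (by omega) v t rfl h4
  have u1 := uu_nonneg (M := M) hst k (fun h => (hb h).le)
  have u2 := uu_nonneg (M := M) hst (k+1) (fun h => (hb h))
  rw [h1, rho_mul, rho_alt]
  split_ifs
  · rw [map_add, map_smul, map_smul]
    exact add_nonneg (smul_nn u2 p1) (smul_nn u1 p2)
  · rw [map_add, map_smul, map_smul]
    exact add_nonneg (smul_nn u1 p1) (smul_nn u2 p2)

lemma root_pos {w : W} {s : B} (h : cs.length w < cs.length (w * cs.simple s)) :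
    0 ≤ rho cs w (al s) := pos_of_length cs _ w s rfl h

lemma simple_al (s : B) : rho cs (cs.simple s) (al s) = - al s := by
  rw [rho_simple_apply, bf_al, cf_self]; module

lemma root_neg {w : W} {s : B} (h : cs.length (w * cs.simple s) < cs.length w) :
    rho cs w (al s) ≤ 0 := by
  have := root_pos cs (w := w * cs.simple s) (s := s) (by simpa using h)
  rw [rho_mul, simple_al, map_neg] at this
  exact neg_nonneg.mp this

lemma al_ne_zero (i : B) : (al i : B →₀ ℝ) ≠ 0 := by
  unfold al; simp

lemma rho_al_ne_zero (w : W) (i : B) : rho cs w (al i) ≠ 0 := by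
  simpa using al_ne_zero i

lemma root_pos_or_neg (w : W) (s : B) : 0 ≤ rho cs w (al s) ∨ rho cs w (al s) ≤ 0 := by
  rcases lt_or_gt_of_ne (cs.length_mul_simple_ne w s) with h | h
  · exact Or.inr (root_neg cs h)
  · exact Or.inl (root_pos cs h)

lemma length_of_root_pos {w : W} {s : B} (h : 0 ≤ rho cs w (al s)) :
    cs.length w < cs.length (w * cs.simple s) := by
  rcases lt_or_gt_of_ne (cs.length_mul_simple_ne w s) with h' | h'
  · exact absurd (le_antisymm (root_neg cs h') h) (rho_al_ne_zero cs w s)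
  · exact h'

lemma eq_one_of_pos {w : W} (h : ∀ s, 0 ≤ rho cs w (al s)) : w = 1 := by
  by_contra hw
  obtain ⟨t, ht⟩ := cs.exists_rightDescent_of_ne_one hw
  have := length_of_root_pos cs (h t)
  unfold CoxeterSystem.IsRightDescent at ht
  omega

lemma rho_inj : Function.Injective (rho cs) := by
  rw [injective_iff_map_eq_one]
  intro w hw
  apply eq_one_of_pos cs
  intro s
  rw [hw]
  exact al_nonneg s

end

end RI

namespace RI

noncomputable section

variable {B : Type*} {W : Type*} [Group W] {M : CoxeterMatrix B}

variable (cs : CoxeterSystem M W)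

/-- `x` is a reflection with root `β`. -/
def IsRefl (x : W) (β : B →₀ ℝ) : Prop := ∃ w i, β = rho cs w (al i) ∧ x = w * cs.simple i * w⁻¹

lemma isRefl_simple (i : B) : IsRefl cs (cs.simple i) (al i) := ⟨1, i, by rw [rho_one], by simp⟩

variable {cs}

lemma IsRefl.exists_of_isReflection {x : W} (h : cs.IsReflection x) : ∃ β, IsRefl cs x β := by
  obtain ⟨w, i, rfl⟩ := h
  exact ⟨_, w, i, rfl, rfl⟩

lemma IsRefl.isReflection {x : W} {β : B →₀ ℝ} (h : IsRefl cs x β) : cs.IsReflection x := by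
  obtain ⟨w, i, _, rfl⟩ := h
  exact ⟨w, i, rfl⟩

lemma IsRefl.conj {x : W} {β : B →₀ ℝ} (h : IsRefl cs x β) (g : W) :
    IsRefl cs (g * x * g⁻¹) (rho cs g β) := by
  obtain ⟨w, i, rfl, rfl⟩ := h
  exact ⟨g * w, i, by rw [rho_mul], by group⟩

lemma IsRefl.apply {x : W} {β : B →₀ ℝ} (h : IsRefl cs x β) (v : B →₀ ℝ) :
    rho cs x v = v - (2 * bf M β v) • β := by
  obtain ⟨w, i, rfl, rfl⟩ := h
  rw [rho_mul, rho_mul, rho_simple_apply, map_sub, map_smul, rho_self_inv]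
  congr 3
  rw [← bf_inv cs w, rho_self_inv]

lemma IsRefl.self {x : W} {β : B →₀ ℝ} (h : IsRefl cs x β) : bf M β β = 1 := by
  obtain ⟨w, i, rfl, rfl⟩ := h
  rw [bf_inv, bf_al, cf_self]

lemma IsRefl.ne_zero {x : W} {β : B →₀ ℝ} (h : IsRefl cs x β) : β ≠ 0 := by
  rintro rfl
  simpa using h.self

lemma IsRefl.apply_self {x : W} {β : B →₀ ℝ} (h : IsRefl cs x β) : rho cs x β = -β := by
  rw [h.apply, h.self]; module

lemma IsRefl.unique {x y : W} {β : B →₀ ℝ} (h : IsRefl cs x β) (h' : IsRefl cs y β) : x = y := by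
  apply rho_inj cs
  ext1 v
  rw [h.apply, h'.apply]

lemma IsRefl.mul_self {x : W} {β : B →₀ ℝ} (h : IsRefl cs x β) : x * x = 1 := by
  obtain ⟨w, i, rfl, rfl⟩ := h
  simp

lemma IsRefl.commute {x y : W} {β γ : B →₀ ℝ} (h : IsRefl cs x β) (h' : IsRefl cs y γ)
    (h0 : bf M β γ = 0) : x * y = y * x := by
  apply rho_inj cs
  ext1 v
  have h0' : bf M γ β = 0 := by rw [bf_symm, h0]
  rw [rho_mul, rho_mul, h.apply, h.apply, h'.apply, h'.apply]
  simp only [map_sub, map_smul, h0, h0']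
  module

lemma IsRefl.pos_or_neg {x : W} {β : B →₀ ℝ} (h : IsRefl cs x β) : 0 ≤ β ∨ β ≤ 0 := by
  obtain ⟨w, i, rfl, rfl⟩ := h
  exact root_pos_or_neg cs w i

lemma IsRefl.neg {x : W} {β : B →₀ ℝ} (h : IsRefl cs x β) : IsRefl cs x (-β) := by
  have := h.conj x
  rw [h.apply_self] at this
  simpa using this

variable (cs)

/-- positive roots -/
def pr : Set (B →₀ ℝ) := {β | (∃ x, IsRefl cs x β) ∧ 0 ≤ β}

variable {cs}

lemma al_mem_pr (i : B) : al i ∈ pr cs := ⟨⟨_, isRefl_simple cs i⟩, al_nonneg i⟩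

lemma pr_ne_zero {β : B →₀ ℝ} (h : β ∈ pr cs) : β ≠ 0 := by
  obtain ⟨⟨x, hx⟩, _⟩ := h
  exact hx.ne_zero

lemma pr_rho {β : B →₀ ℝ} (h : β ∈ pr cs) (w : W) :
    rho cs w β ∈ pr cs ∨ rho cs w β ≤ 0 := by
  obtain ⟨⟨x, hx⟩, _⟩ := h
  have := hx.conj w
  rcases this.pos_or_neg with h | h
  · exact Or.inl ⟨⟨_, this⟩, h⟩
  · exact Or.inr h

lemma pr_not_neg {β : B →₀ ℝ} (h : β ∈ pr cs) : ¬ β ≤ 0 := fun h' =>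
  pr_ne_zero h (le_antisymm h' h.2)

lemma pr_simple {β : B →₀ ℝ} (h : β ∈ pr cs) {i : B} (hi : β ≠ al i) :
    rho cs (cs.simple i) β ∈ pr cs := by
  rcases pr_rho h (cs.simple i) with h' | h'
  · exact h'
  · exfalso
    apply hi
    have hb : β = (β i) • al i := by
      ext j
      by_cases hj : j = i
      · subst hj; simp [al]
      · have h1 := h' j
        have h2 := h.2 j
        rw [rho_simple_apply] at h1
        have h3 : (al i : B →₀ ℝ) j = 0 := Finsupp.single_eq_of_ne hj
        simp only [Finsupp.sub_apply, Finsupp.smul_apply, h3,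
          smul_eq_mul, mul_zero, sub_zero, Finsupp.coe_zero, Pi.zero_apply] at h1 h2 ⊢
        exact le_antisymm h1 h2
    obtain ⟨⟨x, hx⟩, h0⟩ := h
    have h1 := hx.self
    have h2 := h0 i
    simp only [Finsupp.coe_zero, Pi.zero_apply] at h2
    rw [hb] at h1
    simp only [map_smul, LinearMap.smul_apply, smul_eq_mul, bf_al, cf_self] at h1
    have h3 : β i = 1 := by nlinarith
    rw [hb, h3, one_smul]

variable (cs)

/-- inversion set -/
def nn (w : W) : Set (B →₀ ℝ) := {β | β ∈ pr cs ∧ rho cs w β ≤ 0}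

lemma nn_finite (w : W) : (nn cs w).Finite := by
  induction w using cs.simple_induction_right with
  | one =>
    convert Set.finite_empty
    ext β
    simp only [nn, Set.mem_ofPred_eq, Set.mem_empty_iff_false, iff_false, rho_one]
    rintro ⟨h1, h2⟩
    exact pr_not_neg h1 h2
  | mul_simple_right w i ih =>
    apply ((ih.image (rho cs (cs.simple i))).union (Set.finite_singleton (al i))).subset
    rintro β ⟨h1, h2⟩
    by_cases hi : β = al i
    · right; exact hi
    · left
      refine ⟨rho cs (cs.simple i) β, ⟨pr_simple h1 hi, ?_⟩, ?_⟩
      · rwa [← rho_mul]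
      · rw [← rho_mul]; simp

variable {cs}

lemma eq_one_of_nn {w : W} (h : nn cs w = ∅) : w = 1 := by
  apply eq_one_of_pos cs
  intro s
  rcases root_pos_or_neg cs w s with h' | h'
  · exact h'
  · have : al s ∈ nn cs w := ⟨al_mem_pr s, h'⟩
    rw [h] at this
    exact this.elim

variable (cs)

/-- good functional -/
def good (ξ : (B →₀ ℝ) →ₗ[ℝ] ℝ) : Prop := {β | β ∈ pr cs ∧ ξ β ≤ 0}.Finite

variable {cs}

lemma good_comp {ξ : (B →₀ ℝ) →ₗ[ℝ] ℝ} (h : good cs ξ) (w : W) :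
    good cs (ξ ∘ₗ (rho cs w).toLinearMap) := by
  apply ((h.image (rho cs w⁻¹)).union (nn_finite cs w)).subset
  rintro β ⟨h1, h2⟩
  rcases pr_rho h1 w with h3 | h3
  · left
    exact ⟨rho cs w β, ⟨h3, h2⟩, rho_inv_self cs w β⟩
  · right
    exact ⟨h1, h3⟩

lemma dominant {ξ : (B →₀ ℝ) →ₗ[ℝ] ℝ} (h : good cs ξ) : ∃ w, ∀ i, 0 ≤ ξ (rho cs w (al i)) := by
  let F : W → Set (B →₀ ℝ) := fun w => {β | β ∈ pr cs ∧ ξ (rho cs w β) < 0}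
  have hF : ∀ w, (F w).Finite := fun w => (good_comp h w).subset (fun β hβ => ⟨hβ.1, hβ.2.le⟩)
  obtain ⟨w, hw⟩ : ∃ w, ∀ w', (F w).ncard ≤ (F w').ncard := by
    have : ∃ n, ∃ w, (F w).ncard = n := ⟨_, 1, rfl⟩
    classical
    obtain ⟨w, hw⟩ := Nat.find_spec this
    refine ⟨w, fun w' => ?_⟩
    rw [hw]
    exact Nat.find_min' this ⟨w', rfl⟩
  refine ⟨w, fun i => ?_⟩
  by_contra hi
  push Not at hi
  have h1 := hw (w * cs.simple i)
  have h2 : (rho cs (cs.simple i)) '' (F (w * cs.simple i)) ⊆ F w \ {al i} := by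
    rintro _ ⟨β, ⟨hβ1, hβ2⟩, rfl⟩
    have hne : β ≠ al i := by
      rintro rfl
      rw [rho_mul, simple_al, map_neg, map_neg] at hβ2
      linarith
    refine ⟨⟨pr_simple hβ1 hne, by rwa [← rho_mul]⟩, ?_⟩
    intro h'
    have h' : rho cs (cs.simple i) β = al i := h'
    have : β = - al i := by
      rw [← simple_al cs, ← h', ← rho_mul]; simp
    rw [this] at hβ1
    apply pr_not_neg hβ1
    simpa using al_nonneg i
  have h3 := Set.ncard_le_ncard h2 ((hF w).sdiff)
  rw [Set.ncard_image_of_injective _ (rho cs (cs.simple i)).injective] at h3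
  have h4 : (F w \ {al i}).ncard < (F w).ncard :=
    Set.ncard_sdiff_singleton_lt_of_mem (show al i ∈ F w from ⟨al_mem_pr i, hi⟩) (hF w)
  omega

lemma dom_nonneg {η : (B →₀ ℝ) →ₗ[ℝ] ℝ} (h : ∀ i, 0 ≤ η (al i)) {v : B →₀ ℝ} (hv : 0 ≤ v) :
    0 ≤ η v := by
  have : v = v.sum (fun i c => c • al i) := by
    conv_lhs => rw [← Finsupp.sum_single v]
    simp [al]
  rw [this, Finsupp.sum, map_sum]
  apply Finset.sum_nonneg
  intro i _
  rw [map_smul]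
  exact mul_nonneg (hv i) (h i)

lemma stab_dom {η : (B →₀ ℝ) →ₗ[ℝ] ℝ} (hη : ∀ i, 0 ≤ η (al i)) (n : ℕ) : ∀ (g : W), cs.length g = n →
    (∀ v, η (rho cs g v) = η v) → g ∈ Subgroup.closure (cs.simple '' {i | η (al i) = 0}) := by
  induction n with
  | zero =>
    intro g hg _
    rw [cs.length_eq_zero_iff] at hg
    rw [hg]; exact one_mem _
  | succ n ih =>
    intro g hg hst
    have h1 : g ≠ 1 := by
      rintro rfl; simp at hg
    obtain ⟨i, hi⟩ := cs.exists_rightDescent_of_ne_one h1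
    have hi' : cs.length (g * cs.simple i) < cs.length g := hi
    have h2 := root_neg cs hi
    have h3 := dom_nonneg hη (neg_nonneg.mpr h2)
    rw [map_neg, hst] at h3
    have h4 : η (al i) = 0 := le_antisymm (by linarith) (hη i)
    have h5 : cs.simple i ∈ Subgroup.closure (cs.simple '' {i | η (al i) = 0}) :=
      Subgroup.subset_closure ⟨i, h4, rfl⟩
    have h6 := ih (g * cs.simple i) (by rcases cs.length_mul_simple g i with h | h <;> omega) (by
      intro v
      rw [rho_mul, hst, rho_simple_apply, map_sub, map_smul, h4, smul_zero, sub_zero])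
    have := mul_mem h6 h5
    simpa using this

lemma stab_finite {η : (B →₀ ℝ) →ₗ[ℝ] ℝ} (hη : ∀ i, 0 ≤ η (al i)) (hg : good cs η) :
    {g : W | ∀ v, η (rho cs g v) = η v}.Finite := by
  let R : Set (B →₀ ℝ) := {β | β ∈ pr cs ∧ η β = 0}
  have hR : R.Finite := hg.subset (fun β h => ⟨h.1, h.2.le⟩)
  let R' : Set (B →₀ ℝ) := R ∪ (fun v => -v) '' R
  have hR' : R'.Finite := hR.union (hR.image _)
  have : Finite R := hR
  have : Finite R' := hR'
  let φ : {g : W | ∀ v, η (rho cs g v) = η v} → (R → R') := fun g β => ⟨rho cs g.1 β.1, by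
    rcases pr_rho β.2.1 g.1 with h | h
    · left
      exact ⟨h, by rw [g.2]; exact β.2.2⟩
    · right
      obtain ⟨⟨x, hx⟩, _⟩ := β.2.1
      exact ⟨- rho cs g.1 β.1, ⟨⟨⟨_, (hx.conj g.1).neg⟩, neg_nonneg.mpr h⟩, by
        rw [map_neg, g.2, β.2.2, neg_zero]⟩, by simp⟩⟩
  refine @Set.toFinite _ _ (Finite.of_injective φ ?_)
  rintro ⟨g, hg⟩ ⟨h, hh⟩ he
  have key : g⁻¹ * h = 1 := by
    apply eq_one_of_nn (cs := cs)
    by_contra hne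
    obtain ⟨β, hβ1, hβ2⟩ := Set.nonempty_iff_ne_empty.mpr hne
    have hgi : ∀ v, η (rho cs g⁻¹ v) = η v := fun v => by rw [← hg, rho_self_inv]
    have h1 : η (rho cs (g⁻¹ * h) β) = η β := by rw [rho_mul, hgi, hh]
    have h2 := dom_nonneg hη (neg_nonneg.mpr hβ2)
    have h3 := dom_nonneg hη hβ1.2
    rw [map_neg, h1] at h2
    have h4 : β ∈ R := ⟨hβ1, by linarith⟩
    have h5 := congrArg Subtype.val (congrFun he ⟨β, h4⟩)
    have h5 : rho cs g β = rho cs h β := h5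
    rw [rho_mul, ← h5, rho_inv_self] at hβ2
    exact pr_not_neg hβ1 hβ2
  apply Subtype.ext
  exact (inv_mul_eq_one.mp key)

end

end RI

namespace RI

noncomputable section

variable {B : Type*} {W : Type*} [Group W] {M : CoxeterMatrix B}

variable (cs : CoxeterSystem M W)

/-- conjugate subgroup -/
def cj (w : W) (H : Subgroup W) : Subgroup W := H.map (MulAut.conj w).toMonoidHom

lemma mem_cj {w : W} {H : Subgroup W} {g : W} : g ∈ cj w H ↔ w⁻¹ * g * w ∈ H := by
  unfold cj
  constructor
  · rintro ⟨h, hh, rfl⟩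
    simpa [mul_assoc] using hh
  · intro h
    exact ⟨_, h, by simp [mul_assoc]⟩

lemma conj_mem_cj {w : W} {H : Subgroup W} {g : W} : w * g * w⁻¹ ∈ cj w H ↔ g ∈ H := by
  rw [mem_cj]; simp [mul_assoc]

/-- displacement space -/
def E (H : Subgroup W) : Submodule ℝ (B →₀ ℝ) :=
  Submodule.span ℝ {u | ∃ h ∈ H, ∃ v, u = rho cs h v - v}

/-- reflection closure -/
def cl (H : Subgroup W) : Subgroup W := Subgroup.closure {x | ∃ β, IsRefl cs x β ∧ β ∈ E cs H}

lemma E_mono {H K : Subgroup W} (h : H ≤ K) : E cs H ≤ E cs K := by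
  apply Submodule.span_mono
  rintro u ⟨g, hg, v, rfl⟩
  exact ⟨g, h hg, v, rfl⟩

lemma cl_mono {H K : Subgroup W} (h : H ≤ K) : cl cs H ≤ cl cs K := by
  apply Subgroup.closure_mono
  rintro x ⟨β, h1, h2⟩
  exact ⟨β, h1, E_mono cs h h2⟩

lemma E_cj_le (w : W) (H : Subgroup W) :
    E cs (cj w H) ≤ (E cs H).map (rho cs w).toLinearMap := by
  unfold E
  rw [Submodule.span_le]
  rintro u ⟨g, hg, v, rfl⟩
  rw [mem_cj] at hg
  refine ⟨rho cs (w⁻¹ * g * w) (rho cs w⁻¹ v) - rho cs w⁻¹ v, Submodule.subset_span ⟨_, hg, _, rfl⟩, ?_⟩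
  simp only [LinearEquiv.coe_coe, map_sub, ← rho_mul]
  simp [mul_assoc]

lemma cj_inv (w : W) (H : Subgroup W) : cj w⁻¹ (cj w H) = H := by
  ext g
  rw [mem_cj, mem_cj]
  simp [mul_assoc]

lemma E_cj (w : W) (H : Subgroup W) :
    E cs (cj w H) = (E cs H).map (rho cs w).toLinearMap := by
  apply le_antisymm (E_cj_le cs w H)
  have := E_cj_le cs w⁻¹ (cj w H)
  rw [cj_inv] at this
  rintro _ ⟨v, hv, rfl⟩
  obtain ⟨u, hu, rfl⟩ := this hv
  simpa [rho_self_inv] using hu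

lemma mem_E_cj {w : W} {H : Subgroup W} {v : B →₀ ℝ} : rho cs w v ∈ E cs (cj w H) ↔ v ∈ E cs H := by
  rw [E_cj]
  constructor
  · rintro ⟨u, hu, h⟩
    rwa [← (rho cs w).injective h]
  · intro h
    exact ⟨v, h, rfl⟩

lemma cl_cj_le (w : W) (H : Subgroup W) : cl cs (cj w H) ≤ cj w (cl cs H) := by
  unfold cl
  rw [Subgroup.closure_le]
  rintro x ⟨β, h1, h2⟩
  change x ∈ cj w _
  rw [mem_cj]
  apply Subgroup.subset_closure
  refine ⟨rho cs w⁻¹ β, ?_, ?_⟩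
  · simpa using h1.conj w⁻¹
  · rw [← mem_E_cj cs (w := w), rho_self_inv]
    exact h2

lemma cl_cj (w : W) (H : Subgroup W) : cl cs (cj w H) = cj w (cl cs H) := by
  apply le_antisymm (cl_cj_le cs w H)
  have := cl_cj_le cs w⁻¹ (cj w H)
  rw [cj_inv] at this
  intro g hg
  rw [mem_cj] at hg
  have := this hg
  rw [mem_cj] at this
  simpa [mul_assoc] using this

lemma refl_mem_E {x : W} {β : B →₀ ℝ} (h : IsRefl cs x β) {H : Subgroup W} (hx : x ∈ H) :
    β ∈ E cs H := by
  have h1 : rho cs x β - β ∈ E cs H := Submodule.subset_span ⟨x, hx, β, rfl⟩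
  rw [h.apply_self] at h1
  have h2 := Submodule.smul_mem _ (-1/2 : ℝ) h1
  have h3 : (-1/2 : ℝ) • (-β - β) = β := by module
  rwa [h3] at h2

lemma refl_mem_cl {x : W} {β : B →₀ ℝ} (h : IsRefl cs x β) {H : Subgroup W} (hx : β ∈ E cs H) :
    x ∈ cl cs H := Subgroup.subset_closure ⟨β, h, hx⟩

lemma generic (X : Set (B →₀ ℝ)) (hX : X.Finite) (h0 : ∀ u ∈ X, u ≠ 0) :
    ∃ lam : (B →₀ ℝ) →ₗ[ℝ] ℝ, (∀ i, 0 < lam (al i)) ∧ ∀ u ∈ X, lam u ≠ 0 := by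
  induction X, hX using Set.Finite.induction_on with
  | empty => exact ⟨Finsupp.linearCombination ℝ (fun _ => (1 : ℝ)), by simp [al], by simp⟩
  | @insert u X hu hX ih =>
    obtain ⟨lam, h1, h2⟩ := ih (fun v hv => h0 v (Set.mem_insert_of_mem _ hv))
    by_cases hz : lam u = 0
    · have hu0 := h0 u (Set.mem_insert _ _)
      obtain ⟨b, hb⟩ := Finsupp.ne_iff.mp hu0
      have hb : u b ≠ 0 := hb
      have hfin : ((fun x : B →₀ ℝ => -lam x / x b) '' X).Finite := hX.image _
      obtain ⟨c, hc, hc'⟩ := ((Set.Ioi_infinite (0:ℝ)).sdiff hfin).nonempty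
      refine ⟨lam + c • Finsupp.lapply b, ?_, ?_⟩
      · intro i
        have := h1 i
        have h3 := al_nonneg i b
        have hc : 0 < c := hc
        simp only [Finsupp.coe_zero, Pi.zero_apply] at h3
        simp only [LinearMap.add_apply, LinearMap.smul_apply, Finsupp.lapply_apply, smul_eq_mul]
        have := mul_nonneg hc.le h3
        linarith
      · have hc : 0 < c := hc
        intro x hx
        simp only [LinearMap.add_apply, LinearMap.smul_apply, Finsupp.lapply_apply, smul_eq_mul]
        rcases Set.mem_insert_iff.mp hx with rfl | hx
        · rw [hz, zero_add]
          exact mul_ne_zero hc.ne' hb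
        · intro h
          by_cases hxb : x b = 0
          · rw [hxb, mul_zero, add_zero] at h
            exact h2 x hx h
          · apply hc'
            refine ⟨x, hx, ?_⟩
            change -lam x / x b = c
            rw [div_eq_iff hxb]
            linarith
    · refine ⟨lam, h1, ?_⟩
      intro x hx
      rcases Set.mem_insert_iff.mp hx with rfl | hx
      · exact hz
      · exact h2 x hx

/-- The sum over a finite subgroup. -/
def avg (H : Subgroup W) [Fintype H] : (B →₀ ℝ) →ₗ[ℝ] (B →₀ ℝ) :=
  ∑ h : H, (rho cs h.1).toLinearMap

lemma avg_apply (H : Subgroup W) [Fintype H] (v : B →₀ ℝ) :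
    avg cs H v = ∑ h : H, rho cs h.1 v := by
  simp [avg]

lemma avg_rho_right (H : Subgroup W) [Fintype H] (v : B →₀ ℝ) {h : W} (hh : h ∈ H) :
    avg cs H (rho cs h v) = avg cs H v := by
  rw [avg_apply, avg_apply]
  simp only [← rho_mul]
  exact Fintype.sum_equiv (Equiv.mulRight (⟨h, hh⟩ : H)) _ _ (fun x => rfl)

lemma avg_E (H : Subgroup W) [Fintype H] {v : B →₀ ℝ} (hv : v ∈ E cs H) : avg cs H v = 0 := by
  have : E cs H ≤ LinearMap.ker (avg cs H) := by
    unfold E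
    rw [Submodule.span_le]
    rintro u ⟨h, hh, v, rfl⟩
    change avg cs H _ = 0
    rw [map_sub, avg_rho_right cs H v hh, sub_self]
  exact this hv

lemma E_of_avg (H : Subgroup W) [Fintype H] {v : B →₀ ℝ} (hv : avg cs H v = 0) : v ∈ E cs H := by
  have h1 : ∑ h : H, (rho cs h.1 v - v) ∈ E cs H :=
    Submodule.sum_mem _ (fun h _ => Submodule.subset_span ⟨h.1, h.2, v, rfl⟩)
  rw [Finset.sum_sub_distrib, ← avg_apply, hv, zero_sub, Finset.sum_const, Finset.card_univ,
    Submodule.neg_mem_iff] at h1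
  have hc : (Fintype.card H : ℝ) ≠ 0 := by
    exact_mod_cast Fintype.card_ne_zero
  have h2 := Submodule.smul_mem _ ((Fintype.card H : ℝ)⁻¹) h1
  rwa [← Nat.cast_smul_eq_nsmul ℝ, smul_smul, inv_mul_cancel₀ hc, one_smul] at h2

lemma exists_xi (H : Subgroup W) [Finite H] : ∃ ξ : (B →₀ ℝ) →ₗ[ℝ] ℝ, good cs ξ ∧
    (∀ h ∈ H, ∀ v, ξ (rho cs h v) = ξ v) ∧
    (∀ x β, IsRefl cs x β → (β ∈ E cs H ↔ ξ β = 0)) := by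
  have : Fintype H := Fintype.ofFinite H
  let F : Set (B →₀ ℝ) := ⋃ h : H, nn cs h.1
  have hF : F.Finite := Set.finite_iUnion (fun h => nn_finite cs h.1)
  have hout : ∀ β ∈ pr cs, β ∉ F → 0 ≤ avg cs H β - β := by
    intro β hβ hn
    have hn' : ∀ h : H, 0 ≤ rho cs h.1 β := by
      intro h
      rcases pr_rho hβ h.1 with h' | h'
      · exact h'.2
      · exact (hn (Set.mem_iUnion.mpr ⟨h, hβ, h'⟩)).elim
    rw [avg_apply, sub_nonneg]
    have := Finset.single_le_sum (f := fun h : H => rho cs h.1 β) (fun h _ => hn' h)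
      (Finset.mem_univ (1 : H))
    simpa [rho_one] using this
  obtain ⟨lam, h1, h2⟩ := generic ((avg cs H '' F) \ {0}) ((hF.image _).subset Set.sdiff_subset)
    (fun u hu => hu.2)
  have hlpos : ∀ v : B →₀ ℝ, 0 ≤ v → v ≠ 0 → 0 < lam v := by
    intro v hv hv0
    have e : v = v.sum (fun i c => c • al i) := by
      conv_lhs => rw [← Finsupp.sum_single v]
      simp [al]
    rw [e, Finsupp.sum, map_sum]
    apply Finset.sum_pos
    · intro i hi
      rw [map_smul]
      exact mul_pos (lt_of_le_of_ne (hv i) (Ne.symm (Finsupp.mem_support_iff.mp hi))) (h1 i)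
    · exact Finsupp.support_nonempty_iff.mpr hv0
  have hout' : ∀ β ∈ pr cs, β ∉ F → 0 < lam (avg cs H β) := by
    intro β hβ hn
    have a := dom_nonneg (fun i => (h1 i).le) (hout β hβ hn)
    have b := hlpos β hβ.2 (pr_ne_zero hβ)
    rw [map_sub] at a
    linarith
  have hz : ∀ β ∈ pr cs, lam (avg cs H β) = 0 → avg cs H β = 0 := by
    intro β hβ h0
    by_contra hne
    by_cases hf : β ∈ F
    · exact h2 _ ⟨⟨β, hf, rfl⟩, hne⟩ h0
    · exact (hout' β hβ hf).ne' h0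
  refine ⟨lam ∘ₗ avg cs H, ?_, ?_, ?_⟩
  · apply hF.subset
    rintro β ⟨hβ, hle⟩
    by_contra hn
    have := hout' β hβ hn
    have hle : lam (avg cs H β) ≤ 0 := hle
    linarith
  · intro h hh v
    simp [avg_rho_right cs H v hh]
  · intro x β hx
    constructor
    · intro h
      simp [avg_E cs H h]
    · intro h
      have h : lam (avg cs H β) = 0 := h
      apply E_of_avg
      rcases hx.pos_or_neg with hp | hp
      · exact hz β ⟨⟨x, hx⟩, hp⟩ h
      · have := hz (-β) ⟨⟨x, hx.neg⟩, neg_nonneg.mpr hp⟩ (by rw [map_neg, map_neg, h, neg_zero])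
        rwa [map_neg, neg_eq_zero] at this

lemma cl_spec (H : Subgroup W) [Finite H] : Finite (cl cs H) ∧ H ≤ cl cs H ∧
    ∃ (w : W) (J : Set B), cl cs H = cj w (Subgroup.closure (cs.simple '' J)) := by
  obtain ⟨ξ, hg, hf, hr⟩ := exists_xi cs H
  obtain ⟨w, hw⟩ := dominant hg
  let η := ξ ∘ₗ (rho cs w).toLinearMap
  have hη : ∀ i, 0 ≤ η (al i) := hw
  have hfin := stab_finite hη (good_comp hg w)
  have c1 : ∀ g ∈ cl cs H, ∀ v, ξ (rho cs g v) = ξ v := by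
    intro g hg
    unfold cl at hg
    induction hg using Subgroup.closure_induction with
    | mem x hx =>
      obtain ⟨β, h1, h2⟩ := hx
      intro v
      rw [h1.apply, map_sub, map_smul, (hr x β h1).mp h2, smul_zero, sub_zero]
    | one => intro v; rw [rho_one]
    | mul x y _ _ hx hy => intro v; rw [rho_mul, hx, hy]
    | inv x _ hx => intro v; rw [← hx, rho_self_inv]
  have c2 : ∀ g, (∀ v, ξ (rho cs g v) = ξ v) →
      g ∈ cj w (Subgroup.closure (cs.simple '' {i | η (al i) = 0})) := by
    intro g hg
    rw [mem_cj]
    apply stab_dom hη _ _ rfl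
    intro v
    change ξ (rho cs w (rho cs (w⁻¹ * g * w) v)) = ξ (rho cs w v)
    rw [← hg (rho cs w v), ← rho_mul, ← rho_mul]
    simp [mul_assoc]
  have c3 : cj w (Subgroup.closure (cs.simple '' {i | η (al i) = 0})) ≤ cl cs H := by
    unfold cj
    rw [MonoidHom.map_closure, Subgroup.closure_le]
    rintro _ ⟨_, ⟨i, hi, rfl⟩, rfl⟩
    have h1 : IsRefl cs (w * cs.simple i * w⁻¹) (rho cs w (al i)) := ⟨w, i, rfl, rfl⟩
    exact refl_mem_cl cs h1 ((hr _ _ h1).mpr hi)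
  refine ⟨?_, ?_, w, {i | η (al i) = 0}, ?_⟩
  · have : ((cl cs H : Subgroup W) : Set W).Finite := by
      apply (hfin.image (fun g => w * g * w⁻¹)).subset
      intro g hg
      refine ⟨w⁻¹ * g * w, ?_, by simp [mul_assoc]⟩
      intro v
      change ξ (rho cs w (rho cs (w⁻¹ * g * w) v)) = ξ (rho cs w v)
      rw [← c1 g hg (rho cs w v), ← rho_mul, ← rho_mul]
      simp [mul_assoc]
    exact this
  · intro h hh
    exact c3 (c2 h (hf h hh))
  · exact le_antisymm (fun g hg => c2 g (c1 g hg)) c3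

/-! ### finite contradiction -/

lemma expand {v : B →₀ ℝ} (hv : 0 ≤ v) (hb : ∀ i, bf M (al i) v ≤ 0) (n : ℕ) : ∀ w : W,
    cs.length w = n → v ≤ rho cs w v := by
  induction n with
  | zero =>
    intro w hw
    rw [cs.length_eq_zero_iff] at hw
    rw [hw, rho_one]
  | succ n ih =>
    intro w hw
    have h1 : w ≠ 1 := by
      rintro rfl; simp at hw
    obtain ⟨i, hi⟩ := cs.exists_rightDescent_of_ne_one h1
    have hi' : cs.length (w * cs.simple i) < cs.length w := hi
    have h2 := ih (w * cs.simple i) (by rcases cs.length_mul_simple w i with h | h <;> omega)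
    have h3 := root_pos cs (w := w * cs.simple i) (s := i) (by simpa using hi')
    have h4 : rho cs w v = rho cs (w * cs.simple i) v +
        (-(2 * bf M (al i) v)) • rho cs (w * cs.simple i) (al i) := by
      rw [rho_mul, rho_mul, simple_al, rho_simple_apply, map_sub, map_smul, map_neg]
      module
    rw [h4]
    have h5 := smul_nn (c := -(2 * bf M (al i) v)) (by linarith [hb i]) h3
    exact le_add_of_le_of_nonneg h2 h5

lemma fin_contra (G : Subgroup W) [Finite G] {v : B →₀ ℝ} (hv : 0 ≤ v) (hv0 : v ≠ 0)
    (hb : ∀ i, bf M (al i) v ≤ 0) (hE : v ∈ E cs G) : False := by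
  have : Fintype G := Fintype.ofFinite G
  have h1 := avg_E cs G hE
  rw [avg_apply] at h1
  have h2 : v ≤ ∑ h : G, rho cs h.1 v := by
    have := Finset.single_le_sum (f := fun h : G => rho cs h.1 v)
      (fun h _ => hv.trans (expand cs hv hb _ h.1 rfl)) (Finset.mem_univ (1 : G))
    simpa [rho_one] using this
  rw [h1] at h2
  exact hv0 (le_antisymm h2 hv)

lemma cf_le' (i j : B) (h : i ≠ j) (h' : cf M i j ≠ 0) : 1 + 2 * cf M i j ≤ 0 := by
  have := cf_le_neg_half' h h'
  linarith

lemma triangle (G : Subgroup W) [Finite G] {a b c : B} (hab : a ≠ b) (hac : a ≠ c) (hbc : b ≠ c)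
    (h1 : cf M a b ≠ 0) (h2 : cf M a c ≠ 0) (h3 : cf M b c ≠ 0)
    (ha : cs.simple a ∈ G) (hb : cs.simple b ∈ G) (hc : cs.simple c ∈ G) : False := by
  have ea := refl_mem_E cs (isRefl_simple cs a) ha
  have eb := refl_mem_E cs (isRefl_simple cs b) hb
  have ec := refl_mem_E cs (isRefl_simple cs c) hc
  have k1 := cf_le' a b hab h1
  have k2 := cf_le' a c hac h2
  have k3 := cf_le' b c hbc h3
  refine fin_contra cs G (v := al a + al b + al c)
    (add_nonneg (add_nonneg (al_nonneg _) (al_nonneg _)) (al_nonneg _)) ?_ ?_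
    (add_mem (add_mem ea eb) ec)
  · intro h
    have h' := DFunLike.congr_fun h a
    have p1 := al_nonneg b a
    have p2 := al_nonneg c a
    have p3 : (al a : B →₀ ℝ) a = 1 := by simp [al]
    simp only [Finsupp.add_apply, Finsupp.coe_zero, Pi.zero_apply] at *
    linarith
  · intro i
    simp only [map_add, bf_al]
    by_cases ia : i = a
    · subst ia; rw [cf_self]; linarith
    by_cases ib : i = b
    · subst ib; rw [cf_self, cf_symm i a]; linarith
    by_cases ic : i = c
    · subst ic; rw [cf_self, cf_symm i a, cf_symm i b]; linarith
    have := cf_nonpos (M := M) ia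
    have := cf_nonpos (M := M) ib
    have := cf_nonpos (M := M) ic
    linarith

lemma star (G : Subgroup W) [Finite G] {d a b c e : B}
    (hda : d ≠ a) (hdb : d ≠ b) (hdc : d ≠ c) (hde : d ≠ e)
    (hab : a ≠ b) (hac : a ≠ c) (hae : a ≠ e) (hbc : b ≠ c) (hbe : b ≠ e) (hce : c ≠ e)
    (h1 : cf M d a ≠ 0) (h2 : cf M d b ≠ 0) (h3 : cf M d c ≠ 0) (h4 : cf M d e ≠ 0)
    (hd : cs.simple d ∈ G) (ha : cs.simple a ∈ G) (hb : cs.simple b ∈ G) (hc : cs.simple c ∈ G)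
    (he : cs.simple e ∈ G) : False := by
  have ed := refl_mem_E cs (isRefl_simple cs d) hd
  have ea := refl_mem_E cs (isRefl_simple cs a) ha
  have eb := refl_mem_E cs (isRefl_simple cs b) hb
  have ec := refl_mem_E cs (isRefl_simple cs c) hc
  have ee := refl_mem_E cs (isRefl_simple cs e) he
  have k1 := cf_le' d a hda h1
  have k2 := cf_le' d b hdb h2
  have k3 := cf_le' d c hdc h3
  have k4 := cf_le' d e hde h4
  have l1 := cf_nonpos (M := M) hab
  have l2 := cf_nonpos (M := M) hac
  have l3 := cf_nonpos (M := M) hae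
  have l4 := cf_nonpos (M := M) hbc
  have l5 := cf_nonpos (M := M) hbe
  have l6 := cf_nonpos (M := M) hce
  refine fin_contra cs G (v := (al d + al d) + (al a + al b + al c + al e))
    ?_ ?_ ?_ (add_mem (add_mem ed ed) (add_mem (add_mem (add_mem ea eb) ec) ee))
  · have := al_nonneg d
    have := al_nonneg a
    have := al_nonneg b
    have := al_nonneg c
    have := al_nonneg e
    positivity
  · intro h
    have h' := DFunLike.congr_fun h d
    have p1 := al_nonneg a d
    have p2 := al_nonneg b d
    have p4 := al_nonneg c d
    have p5 := al_nonneg e d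
    have p3 : (al d : B →₀ ℝ) d = 1 := by simp [al]
    simp only [Finsupp.add_apply, Finsupp.coe_zero, Pi.zero_apply] at *
    linarith
  · intro i
    simp only [map_add, bf_al]
    by_cases id : i = d
    · subst id; rw [cf_self]; linarith
    by_cases ia : i = a
    · subst ia; rw [cf_self, cf_symm i d]; linarith
    by_cases ib : i = b
    · subst ib; rw [cf_self, cf_symm i d, cf_symm i a]; linarith
    by_cases ic : i = c
    · subst ic; rw [cf_self, cf_symm i d, cf_symm i a, cf_symm i b]; linarith
    by_cases ie : i = e
    · subst ie; rw [cf_self, cf_symm i d, cf_symm i a, cf_symm i b, cf_symm i c]; linarith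
    have := cf_nonpos (M := M) id
    have := cf_nonpos (M := M) ia
    have := cf_nonpos (M := M) ib
    have := cf_nonpos (M := M) ic
    have := cf_nonpos (M := M) ie
    linarith

end

end RI

namespace RI

noncomputable section

variable {B : Type*} {W : Type*} [Group W] {M : CoxeterMatrix B}
variable {B' : Type*} {M' : CoxeterMatrix B'}

/-! ### linear algebra -/

lemma exists_fin (cs : CoxeterSystem M W) (w : W) : ∃ F : Submodule ℝ (B →₀ ℝ), FiniteDimensional ℝ F ∧
    ∀ v, rho cs w v - v ∈ F := by
  induction w using cs.simple_induction_right with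
  | one => exact ⟨⊥, inferInstance, fun v => by simp⟩
  | mul_simple_right w i ih =>
    obtain ⟨F, h1, h2⟩ := ih
    refine ⟨F ⊔ Submodule.span ℝ {al i}, inferInstance, fun v => ?_⟩
    have e : rho cs (w * cs.simple i) v - v =
      (rho cs w (rho cs (cs.simple i) v) - rho cs (cs.simple i) v) +
        (rho cs (cs.simple i) v - v) := by rw [rho_mul]; abel
    rw [e]
    apply add_mem
    · exact Submodule.mem_sup_left (h2 _)
    · apply Submodule.mem_sup_right
      rw [rho_simple_apply, sub_sub_cancel_left, Submodule.neg_mem_iff]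
      exact Submodule.smul_mem _ _ (Submodule.mem_span_singleton_self _)

lemma map_eq_of_le (cs : CoxeterSystem M W) (w : W) (U : Submodule ℝ (B →₀ ℝ))
    (h : U.map (rho cs w).toLinearMap ≤ U) : U.map (rho cs w).toLinearMap = U := by
  apply le_antisymm h
  obtain ⟨F, hF, hw⟩ := exists_fin cs w
  have hle : (U ⊓ F).map (rho cs w).toLinearMap ≤ U ⊓ F := by
    rintro _ ⟨v, ⟨hv1, hv2⟩, rfl⟩
    refine ⟨h ⟨v, hv1, rfl⟩, ?_⟩
    have := add_mem (hw v) hv2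
    simpa using this
  have : FiniteDimensional ℝ (U ⊓ F : Submodule ℝ (B →₀ ℝ)) :=
    Submodule.finiteDimensional_of_le (inf_le_right (a := U) (b := F))
  have heq : (U ⊓ F).map (rho cs w).toLinearMap = U ⊓ F :=
    Submodule.eq_of_le_of_finrank_eq hle (LinearEquiv.finrank_map_eq (rho cs w) (U ⊓ F))
  intro v hv
  have h1 : rho cs w v - v ∈ U ⊓ F := ⟨sub_mem (h ⟨v, hv, rfl⟩) hv, hw v⟩
  rw [← heq] at h1
  obtain ⟨f, hf, he⟩ := h1
  refine ⟨v - f, sub_mem hv hf.1, ?_⟩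
  have he : rho cs w f = rho cs w v - v := he
  change rho cs w (v - f) = v
  rw [map_sub, he]
  abel

lemma all_or_none {cs : CoxeterSystem M W} {z : W} {γ : B →₀ ℝ} (hz : IsRefl cs z γ)
    {U : Submodule ℝ (B →₀ ℝ)} (h : U.map (rho cs z).toLinearMap ≤ U) :
    γ ∈ U ∨ ∀ u ∈ U, bf M γ u = 0 := by
  by_contra hc
  push Not at hc
  obtain ⟨h1, u, hu, hne⟩ := hc
  apply h1
  have h2 : u - rho cs z u ∈ U := sub_mem hu (h ⟨u, hu, rfl⟩)
  rw [hz.apply, sub_sub_cancel] at h2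
  have h3 := Submodule.smul_mem _ (2 * bf M γ u)⁻¹ h2
  rwa [smul_smul, inv_mul_cancel₀ (by simpa using hne), one_smul] at h3

/-! ### group theory of odd edges -/

lemma semi {x y : W} (hx : x * x = 1) (hy : y * y = 1) (n : ℤ) : x * (x * y) ^ n = (x * y) ^ (-n) * x := by
  have hxi : x⁻¹ = x := inv_eq_of_mul_eq_one_left hx
  have hyi : y⁻¹ = y := inv_eq_of_mul_eq_one_left hy
  have : SemiconjBy x (x * y) (x * y)⁻¹ := by
    unfold SemiconjBy
    rw [mul_inv_rev, hxi, hyi, ← mul_assoc, hx, mul_assoc, hx, one_mul, mul_one]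
  have := this.zpow_right n
  rw [inv_zpow'] at this
  exact this

lemma odd_conj (cs : CoxeterSystem M W) {i j : B} (h : Odd (M i j)) :
    ∃ g ∈ Subgroup.closure {cs.simple i, cs.simple j}, cs.simple j = g * cs.simple i * g⁻¹ := by
  obtain ⟨k, hk⟩ := h
  have hr := cs.simple_mul_simple_pow i j
  have hx := cs.simple_mul_simple_self i
  have hy := cs.simple_mul_simple_self j
  rw [hk] at hr
  generalize cs.simple i = x at *
  generalize cs.simple j = y at *
  refine ⟨(x * y) ^ k, ?_, ?_⟩
  · apply Subgroup.pow_mem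
    exact mul_mem (Subgroup.subset_closure (by simp)) (Subgroup.subset_closure (by simp))
  · have h1 := semi hx hy (-(k : ℤ))
    rw [neg_neg, zpow_neg, zpow_natCast] at h1
    rw [mul_assoc, h1, ← mul_assoc, ← pow_add]
    have h2 : (x * y) ^ (k + k) * (x * y) = 1 := by
      rw [← pow_succ, ← hr]; congr 1; ring
    have h3 : (x * y) ^ (k + k) * x = y⁻¹ := by
      rw [eq_inv_iff_mul_eq_one, mul_assoc, h2]
    rw [h3]
    exact (inv_eq_of_mul_eq_one_left hy).symm

lemma dihedral_finite (cs : CoxeterSystem M W) {i j : B} (h : M i j ≠ 0) :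
    Finite (Subgroup.closure {cs.simple i, cs.simple j}) := by
  have hr := cs.simple_mul_simple_pow i j
  have hx := cs.simple_mul_simple_self i
  have hy := cs.simple_mul_simple_self j
  generalize cs.simple i = x at *
  generalize cs.simple j = y at *
  have hxi : x⁻¹ = x := inv_eq_of_mul_eq_one_left hx
  have hyi : y⁻¹ = y := inv_eq_of_mul_eq_one_left hy
  have hfo : IsOfFinOrder (x * y) := isOfFinOrder_iff_pow_eq_one.mpr ⟨_, Nat.pos_of_ne_zero h, hr⟩
  have hz : ((Subgroup.zpowers (x * y) : Subgroup W) : Set W).Finite :=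
    hfo.finite_zpowers
  have key : ∀ g ∈ Subgroup.closure {x, y}, ∃ n : ℤ, g = (x * y) ^ n ∨ g = (x * y) ^ n * x := by
    have hxm : ∀ g : W, (∃ n : ℤ, g = (x * y) ^ n ∨ g = (x * y) ^ n * x) →
        ∃ n : ℤ, x * g = (x * y) ^ n ∨ x * g = (x * y) ^ n * x := by
      rintro g ⟨n, rfl | rfl⟩
      · exact ⟨-n, Or.inr (semi hx hy n)⟩
      · exact ⟨-n, Or.inl (by rw [← mul_assoc, semi hx hy n, mul_assoc, hx, mul_one])⟩
    have hym : ∀ g : W, (∃ n : ℤ, g = (x * y) ^ n ∨ g = (x * y) ^ n * x) →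
        ∃ n : ℤ, y * g = (x * y) ^ n ∨ y * g = (x * y) ^ n * x := by
      rintro g ⟨n, hn⟩
      have e : y * g = x * ((x * y) * g) := by
        rw [← mul_assoc, ← mul_assoc, hx, one_mul]
      rw [e]
      apply hxm
      refine ⟨1 + n, ?_⟩
      rcases hn with rfl | rfl
      · left; rw [zpow_add, zpow_one]
      · right; rw [zpow_add, zpow_one, ← mul_assoc]
    intro g hg
    induction hg using Subgroup.closure_induction_left with
    | one => exact ⟨0, by simp⟩
    | mul_left a ha b hb ih =>
      rcases ha with rfl | ha
      · exact hxm _ ih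
      · rw [Set.mem_singleton_iff.mp ha]; exact hym _ ih
    | inv_mul_cancel a ha b hb ih =>
      rcases ha with rfl | ha
      · rw [hxi]; exact hxm _ ih
      · rw [Set.mem_singleton_iff.mp ha, hyi]; exact hym _ ih
  have : ((Subgroup.closure {x, y} : Subgroup W) : Set W).Finite := by
    apply (hz.union (hz.image (· * x))).subset
    intro g hg
    obtain ⟨n, hn | hn⟩ := key g hg
    · left; rw [hn]; exact ⟨n, rfl⟩
    · right; exact ⟨_, ⟨n, rfl⟩, hn.symm⟩
  exact this

/-- all simple reflections are conjugate -/
def AllConj (cs : CoxeterSystem M W) : Prop := ∀ i j, ∃ g, cs.simple j = g * cs.simple i * g⁻¹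

lemma allConj_of_connected (cs : CoxeterSystem M W)
    (hodd : (SimpleGraph.fromRel fun b b' : B => Odd (M b b')).Connected) : AllConj cs := by
  intro i j
  obtain ⟨p⟩ := hodd.preconnected i j
  induction p with
  | nil => exact ⟨1, by simp⟩
  | @cons u v w h p ih =>
    obtain ⟨g, hg⟩ := ih
    have ho : Odd (M u v) := by
      rcases h with ⟨_, h | h⟩
      · exact h
      · rw [M.symmetric]; exact h
    obtain ⟨g', _, hg'⟩ := odd_conj cs ho
    exact ⟨g * g', by rw [hg, hg']; group⟩

lemma boundary (hodd : (SimpleGraph.fromRel fun b b' : B => Odd (M b b')).Connected) (P : B → Prop)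
    {i j : B} (hi : P i) (hj : ¬ P j) : ∃ a d, P a ∧ ¬ P d ∧ a ≠ d ∧ Odd (M a d) := by
  obtain ⟨p⟩ := hodd.preconnected i j
  obtain ⟨d, _, h1, h2⟩ := p.exists_boundary_dart {i | P i} hi hj
  refine ⟨d.fst, d.snd, h1, h2, d.adj.ne, ?_⟩
  rcases d.adj with ⟨_, h | h⟩
  · exact h
  · rw [M.symmetric]; exact h

lemma cf_ne_of_odd {i j : B} (hij : i ≠ j) (h : Odd (M i j)) : cf M i j ≠ 0 := by
  have : M i j ≠ 2 := by
    intro h'; rw [h'] at h; revert h; decide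
  have := cf_le_neg_half hij this
  intro h0
  rw [h0] at this
  norm_num at this

lemma AllConj.refl {cs : CoxeterSystem M W} (h : AllConj cs) {x y : W}
    (hx : cs.IsReflection x) (hy : cs.IsReflection y) : ∃ g, y = g * x * g⁻¹ := by
  obtain ⟨w, i, rfl⟩ := hx
  obtain ⟨u, j, rfl⟩ := hy
  obtain ⟨g, hg⟩ := h i j
  exact ⟨u * g * w⁻¹, by rw [hg]; group⟩

/-! ### iterated closure -/

variable (cs : CoxeterSystem M W) (cs' : CoxeterSystem M' W)

/-- two-sided closure -/
def tc (H : Subgroup W) : Subgroup W := cl cs (cl cs' H)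

/-- iterated closure -/
def tt (k : ℕ) (H : Subgroup W) : Subgroup W := (tc cs cs')^[k] H

lemma tt_succ (k : ℕ) (H : Subgroup W) : tt cs cs' (k+1) H = tc cs cs' (tt cs cs' k H) :=
  Function.iterate_succ_apply' _ _ _

lemma tt_zero (H : Subgroup W) : tt cs cs' 0 H = H := rfl

lemma tt_one (H : Subgroup W) : tt cs cs' 1 H = cl cs (cl cs' H) := rfl

lemma tt_add (j k : ℕ) (H : Subgroup W) : tt cs cs' (j+k) H = tt cs cs' j (tt cs cs' k H) :=
  Function.iterate_add_apply _ _ _ _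

lemma tc_finite (H : Subgroup W) [Finite H] : Finite (tc cs cs' H) := by
  have := (cl_spec cs' H).1
  exact (cl_spec cs (cl cs' H)).1

lemma le_tc (H : Subgroup W) [Finite H] : H ≤ tc cs cs' H := by
  have := (cl_spec cs' H).1
  exact (cl_spec cs' H).2.1.trans (cl_spec cs (cl cs' H)).2.1

lemma tt_finite (k : ℕ) (H : Subgroup W) [Finite H] : Finite (tt cs cs' k H) := by
  induction k with
  | zero => rw [tt_zero]; infer_instance
  | succ k ih => rw [tt_succ]; exact tc_finite cs cs' _

lemma tt_mono_k {k l : ℕ} (h : k ≤ l) (H : Subgroup W) [Finite H] :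
    tt cs cs' k H ≤ tt cs cs' l H := by
  induction h with
  | refl => exact le_rfl
  | step h ih =>
    have := tt_finite cs cs' (by assumption) H
    exact ih.trans (by rw [Nat.succ_eq_add_one, tt_succ]; exact le_tc cs cs' _)

lemma tt_mono (k : ℕ) {H K : Subgroup W} (h : H ≤ K) : tt cs cs' k H ≤ tt cs cs' k K := by
  induction k with
  | zero => exact h
  | succ k ih => rw [tt_succ, tt_succ]; exact cl_mono cs (cl_mono cs' ih)

lemma tt_cj (k : ℕ) (w : W) (H : Subgroup W) : tt cs cs' k (cj w H) = cj w (tt cs cs' k H) := by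
  induction k with
  | zero => rfl
  | succ k ih => rw [tt_succ, tt_succ, ih, tc, cl_cj, cl_cj]; rfl

/-- limit space -/
def vv (H : Subgroup W) : Submodule ℝ (B →₀ ℝ) := ⨆ k, E cs (tt cs cs' k H)

lemma mem_vv (H : Subgroup W) [Finite H] {v : B →₀ ℝ} :
    v ∈ vv cs cs' H ↔ ∃ k, v ∈ E cs (tt cs cs' k H) := by
  unfold vv
  apply Submodule.mem_iSup_of_directed
  intro a b
  exact ⟨max a b, E_mono cs (tt_mono_k cs cs' (le_max_left _ _) H),
    E_mono cs (tt_mono_k cs cs' (le_max_right _ _) H)⟩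

variable {cs}

lemma mem_vv_refl (H : Subgroup W) [Finite H] {x : W} {β : B →₀ ℝ} (h : IsRefl cs x β) :
    β ∈ vv cs cs' H ↔ ∃ k, x ∈ tt cs cs' k H := by
  rw [mem_vv]
  constructor
  · rintro ⟨k, hk⟩
    have := tt_finite cs cs' k H
    refine ⟨k+1, ?_⟩
    rw [tt_succ]
    exact cl_mono cs (cl_spec cs' _).2.1 (refl_mem_cl cs h hk)
  · rintro ⟨k, hk⟩
    exact ⟨k, refl_mem_E cs h hk⟩

variable (cs)

lemma cj_finite (w : W) (H : Subgroup W) [Finite H] : Finite (cj w H) := by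
  have : ((H : Set W)).Finite := Set.toFinite _
  have h2 : ((cj w H : Subgroup W) : Set W).Finite := by
    unfold cj
    rw [Subgroup.coe_map]
    exact this.image _
  exact h2

lemma vv_cj (w : W) (H : Subgroup W) : vv cs cs' (cj w H) = (vv cs cs' H).map (rho cs w).toLinearMap := by
  unfold vv
  rw [Submodule.map_iSup]
  congr 1
  ext1 k
  rw [tt_cj, E_cj]

lemma vv_le {H K : Subgroup W} {k : ℕ} [Finite H] (h : K ≤ tt cs cs' k H) :
    vv cs cs' K ≤ vv cs cs' H := by
  unfold vv
  apply iSup_le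
  intro j
  refine le_trans (E_mono cs ?_) (le_iSup (fun k => E cs (tt cs cs' k H)) (j + k))
  rw [tt_add]
  exact tt_mono cs cs' j h

lemma vv_cj_eq {H : Subgroup W} {w : W} {k : ℕ} [Finite H] (h : cj w H ≤ tt cs cs' k H) :
    vv cs cs' (cj w H) = vv cs cs' H := by
  have h1 := vv_le cs cs' h
  rw [vv_cj] at h1 ⊢
  exact map_eq_of_le cs w _ h1

lemma cj_zpowers (w x : W) : cj w (Subgroup.zpowers x) = Subgroup.zpowers (w * x * w⁻¹) := by
  unfold cj
  rw [MonoidHom.map_zpowers]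
  rfl

variable {cs}

lemma zp_finite {x : W} {β : B →₀ ℝ} (h : IsRefl cs x β) : Finite (Subgroup.zpowers x) := by
  have : IsOfFinOrder x := isOfFinOrder_iff_pow_eq_one.mpr ⟨2, by norm_num, by rw [pow_two, h.mul_self]⟩
  exact this.finite_zpowers

lemma vv_eq (hc : AllConj cs) {x y : W} {β γ : B →₀ ℝ} (hx : IsRefl cs x β) (hy : IsRefl cs y γ)
    (h : γ ∈ vv cs cs' (Subgroup.zpowers x)) :
    vv cs cs' (Subgroup.zpowers y) = vv cs cs' (Subgroup.zpowers x) := by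
  have := zp_finite hx
  obtain ⟨g, rfl⟩ := hc.refl hx.isReflection hy.isReflection
  obtain ⟨k, hk⟩ := (mem_vv_refl cs' _ hy).mp h
  rw [← cj_zpowers]
  apply vv_cj_eq (k := k)
  rw [cj_zpowers, Subgroup.zpowers_le]
  exact hk

lemma vv_comm (hc : AllConj cs) {x y z : W} {β γ δ : B →₀ ℝ} (hx : IsRefl cs x β) (hy : IsRefl cs y γ)
    (hz : IsRefl cs z δ) (h : γ ∈ vv cs cs' (Subgroup.zpowers x)) (h0 : bf M δ γ = 0) :
    (vv cs cs' (Subgroup.zpowers x)).map (rho cs z).toLinearMap ≤ vv cs cs' (Subgroup.zpowers x) := by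
  rw [← vv_eq cs' hc hx hy h, ← vv_cj, cj_zpowers, hz.commute hy h0, mul_inv_cancel_right]

variable (cs)

lemma not_all_mem [Infinite W] (G : Subgroup W) [Finite G] : ∃ i, cs.simple i ∉ G := by
  by_contra h
  push Not at h
  have h1 : (⊤ : Subgroup W) ≤ G := by
    rw [← cs.subgroup_closure_range_simple, Subgroup.closure_le]
    rintro _ ⟨i, rfl⟩
    exact h i
  have h2 : G = ⊤ := top_le_iff.mp h1
  have h3 : (Set.univ : Set W).Finite := by
    rw [← Subgroup.coe_top, ← h2]; exact Set.toFinite _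
  exact Set.infinite_univ h3

/-- Step 1 -/
lemma vv_ne_top [Infinite W] (hodd : (SimpleGraph.fromRel fun b b' : B => Odd (M b b')).Connected)
    (b : B) : vv cs cs' (Subgroup.zpowers (cs.simple b)) ≠ ⊤ := by
  intro htop
  have hfz := zp_finite (isRefl_simple cs b)
  obtain ⟨j, hj⟩ := not_all_mem cs (Subgroup.zpowers (cs.simple b))
  obtain ⟨b', t, hb', hbt, _, hbt'⟩ := boundary hodd (fun i => i = b) (i := b) (j := j) rfl (by
    rintro rfl
    exact hj (Subgroup.mem_zpowers _))
  have hb2 : b' = b := hb'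
  rw [hb2] at hbt'
  have hbt : t ≠ b := hbt
  have htb : b ≠ t := fun h => hbt h.symm
  set Z := Subgroup.zpowers (cs.simple b) with hZ
  have hex : ∀ i, ∃ k, cs.simple i ∈ tt cs cs' k Z := by
    intro i
    rw [← mem_vv_refl cs' Z (isRefl_simple cs i), htop]
    exact Submodule.mem_top
  obtain ⟨k, hk⟩ := hex t
  set H := tt cs cs' k Z with hH
  have hHfin : Finite H := tt_finite cs cs' k Z
  have hbH : cs.simple b ∈ H := tt_mono_k cs cs' (Nat.zero_le k) Z (Subgroup.mem_zpowers _)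
  have hclfin : Finite (cl cs H) := (cl_spec cs H).1
  obtain ⟨j', hj'⟩ := not_all_mem cs (cl cs H)
  obtain ⟨i, d, hi, hd, hid, hodd'⟩ := boundary hodd (fun i => al i ∈ E cs H) (i := b) (j := j')
    (refl_mem_E cs (isRefl_simple cs b) hbH)
    (fun h => hj' (refl_mem_cl cs (isRefl_simple cs j') h))
  have hcd : cf M d i ≠ 0 := by rw [cf_symm]; exact cf_ne_of_odd hid hodd'
  -- key claim
  have key : ∀ g ∈ H, ∀ y, y = g * cs.simple b * g⁻¹ → y * cs.simple d = cs.simple d * y → False := by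
    intro g hg y hy hcomm
    -- conjugation by `d` preserves `H`
    have h1 : cj g H = H := by
      ext u
      rw [mem_cj]
      constructor
      · intro h
        have := mul_mem (mul_mem hg h) (inv_mem hg)
        simpa [mul_assoc] using this
      · intro h
        exact mul_mem (mul_mem (inv_mem hg) h) hg
    have h2 : H = tt cs cs' k (Subgroup.zpowers y) := by
      rw [← h1, hH, ← tt_cj, hZ, cj_zpowers, ← hy]
    have h3 : cj (cs.simple d) H = H := by
      rw [h2, ← tt_cj, cj_zpowers, ← hcomm, mul_inv_cancel_right]
    have h4 : (E cs H).map (rho cs (cs.simple d)).toLinearMap ≤ E cs H := by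
      rw [← E_cj, h3]
    rcases all_or_none (isRefl_simple cs d) h4 with h5 | h5
    · exact hd h5
    · have := h5 _ hi
      rw [bf_al] at this
      exact hcd this
  have hdb : d ≠ b := by
    rintro rfl; exact hd (refl_mem_E cs (isRefl_simple cs _) hbH)
  have hdt : d ≠ t := by
    rintro rfl; exact hd (refl_mem_E cs (isRefl_simple cs _) hk)
  have c1 : cf M b d ≠ 0 := by
    intro h
    apply key 1 (one_mem _) (cs.simple b) (by simp)
    exact (isRefl_simple cs b).commute (isRefl_simple cs d) (by rw [bf_al, h])
  have c2 : cf M t d ≠ 0 := by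
    intro h
    obtain ⟨g, hg, hgt⟩ := odd_conj cs hbt'
    apply key g ?_ (cs.simple t) hgt
    · exact (isRefl_simple cs t).commute (isRefl_simple cs d) (by rw [bf_al, h])
    · have : Subgroup.closure {cs.simple b, cs.simple t} ≤ H := by
        rw [Subgroup.closure_le]
        rintro x (rfl | hx)
        · exact hbH
        · rw [Set.mem_singleton_iff.mp hx]; exact hk
      exact this hg
  obtain ⟨l, hl⟩ := hex d
  have := tt_finite cs cs' (k + l) Z
  exact triangle cs (tt cs cs' (k+l) Z) htb hdb.symm hdt.symm (cf_ne_of_odd htb hbt') c1 c2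
    (tt_mono_k cs cs' (Nat.zero_le _) Z (Subgroup.mem_zpowers _))
    (tt_mono_k cs cs' (Nat.le_add_right k l) Z hk) (tt_mono_k cs cs' (Nat.le_add_left l k) Z hl)

lemma three_elems {J : Set B} (hne : J.Nonempty)
    (h : ∀ a ∈ J, ∀ b ∈ J, ∀ c ∈ J, ∀ e ∈ J, a ≠ b → a ≠ c → a ≠ e → b ≠ c → b ≠ e → c ≠ e → False) :
    ∃ a ∈ J, ∃ b ∈ J, ∃ c ∈ J, ∀ j ∈ J, j = a ∨ j = b ∨ j = c := by
  obtain ⟨a, ha⟩ := hne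
  by_cases h1 : ∀ j ∈ J, j = a
  · exact ⟨a, ha, a, ha, a, ha, fun j hj => Or.inl (h1 j hj)⟩
  push Not at h1
  obtain ⟨b, hb, hba⟩ := h1
  by_cases h2 : ∀ j ∈ J, j = a ∨ j = b
  · exact ⟨a, ha, b, hb, b, hb, fun j hj => by rcases h2 j hj with h | h <;> simp [h]⟩
  push Not at h2
  obtain ⟨c, hc, hca, hcb⟩ := h2
  refine ⟨a, ha, b, hb, c, hc, fun j hj => ?_⟩
  by_contra hn
  push Not at hn
  exact h a ha b hb c hc j hj hba.symm hca.symm hn.1.symm hcb.symm hn.2.1.symm hn.2.2.symm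

/-- Step 2 -/
lemma step2 [Infinite W] (hodd : (SimpleGraph.fromRel fun b b' : B => Odd (M b b')).Connected) :
    ∃ x, cs.IsReflection x ∧ ∃ a b c, cl cs (cl cs' (Subgroup.zpowers x)) ≤
      Subgroup.closure {cs.simple a, cs.simple b, cs.simple c} ∧
      cs.simple a * cs.simple b = cs.simple b * cs.simple a ∧
      cs.simple a * cs.simple c = cs.simple c * cs.simple a ∧
      cs.simple b * cs.simple c = cs.simple c * cs.simple b := by
  have hc := allConj_of_connected cs hodd
  obtain ⟨b0⟩ := hodd.nonempty
  have hfz := zp_finite (isRefl_simple cs b0)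
  have hfz' := (cl_spec cs' (Subgroup.zpowers (cs.simple b0))).1
  obtain ⟨w, J, hJ⟩ := (cl_spec cs (cl cs' (Subgroup.zpowers (cs.simple b0)))).2.2
  set x := w⁻¹ * cs.simple b0 * (w⁻¹)⁻¹ with hxdef
  have hx : IsRefl cs x (rho cs w⁻¹ (al b0)) := (isRefl_simple cs b0).conj w⁻¹
  have hfx := zp_finite hx
  have hTx : cl cs (cl cs' (Subgroup.zpowers x)) = Subgroup.closure (cs.simple '' J) := by
    rw [hxdef, ← cj_zpowers, cl_cj, cl_cj, hJ, cj_inv]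
  set U := vv cs cs' (Subgroup.zpowers x) with hU
  have hUtop : ∃ j, al j ∉ U := by
    by_contra h
    push Not at h
    have h1 : U = ⊤ := by
      rw [eq_top_iff]
      intro v _
      have e : v = v.sum (fun i c => c • al i) := by
        conv_lhs => rw [← Finsupp.sum_single v]
        simp [al]
      rw [e]
      exact Submodule.sum_mem _ (fun i _ => Submodule.smul_mem _ _ (h i))
    rw [hU, hxdef, ← cj_zpowers, vv_cj] at h1
    apply vv_ne_top cs cs' hodd b0
    rw [eq_top_iff]
    intro v _
    have h2 : rho cs w⁻¹ v ∈ (⊤ : Submodule ℝ (B →₀ ℝ)) := Submodule.mem_top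
    rw [← h1] at h2
    obtain ⟨u, hu, he⟩ := h2
    rwa [← (rho cs w⁻¹).injective he]
  obtain ⟨j0, hj0⟩ := hUtop
  have hJU : ∀ j ∈ J, al j ∈ U := by
    intro j hj
    rw [hU, mem_vv_refl cs' _ (isRefl_simple cs j)]
    refine ⟨1, ?_⟩
    rw [tt_one, hTx]
    exact Subgroup.subset_closure ⟨j, hj, rfl⟩
  have hx1 : x ≠ 1 := by
    intro h
    have h1 := hx.apply_self
    rw [h, rho_one, self_eq_neg] at h1
    exact hx.ne_zero h1
  have hJne : J.Nonempty := by
    by_contra h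
    rw [Set.not_nonempty_iff_eq_empty] at h
    have h1 : x ∈ tt cs cs' 1 (Subgroup.zpowers x) :=
      tt_mono_k cs cs' (Nat.zero_le 1) _ (Subgroup.mem_zpowers x)
    rw [tt_one, hTx, h, Set.image_empty, Subgroup.closure_empty] at h1
    exact hx1 (Subgroup.mem_bot.mp h1)
  obtain ⟨i0, hi0⟩ := hJne
  obtain ⟨i, d, hi, hd, hid, hio⟩ := boundary hodd (fun i => al i ∈ U) (hJU i0 hi0) hj0
  have hdi : cf M d i ≠ 0 := by rw [cf_symm]; exact cf_ne_of_odd hid hio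
  have hdj : ∀ j, al j ∈ U → cf M d j ≠ 0 := by
    intro j hj h0
    have h1 := vv_comm cs' hc hx (isRefl_simple cs j) (isRefl_simple cs d) hj (by rw [bf_al, h0])
    rcases all_or_none (isRefl_simple cs d) h1 with h | h
    · exact hd h
    · have := h _ hi
      rw [bf_al] at this
      exact hdi this
  have hne : ∀ j, al j ∈ U → d ≠ j := by
    rintro j hj rfl; exact hd hj
  set G := Subgroup.closure {cs.simple i, cs.simple d} with hG
  have hGfin : Finite G := dihedral_finite cs (by
    intro h; rw [h] at hio; revert hio; decide)
  have hdG : cs.simple d ∈ G := Subgroup.subset_closure (by simp)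
  have hmem : ∀ j, al j ∈ U → ∃ k, cs.simple j ∈ tt cs cs' k G := by
    intro j hj
    have hfi := zp_finite (isRefl_simple cs i)
    rw [hU, ← vv_eq cs' hc hx (isRefl_simple cs i) hi, mem_vv_refl cs' _ (isRefl_simple cs j)] at hj
    obtain ⟨k, hk⟩ := hj
    refine ⟨k, tt_mono cs cs' k ?_ hk⟩
    rw [Subgroup.zpowers_le]
    exact Subgroup.subset_closure (by simp)
  have hup : ∀ {k l : ℕ} {y : W}, k ≤ l → y ∈ tt cs cs' k G → y ∈ tt cs cs' l G :=
    fun h hy => tt_mono_k cs cs' h G hy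
  have horth : ∀ j, al j ∈ U → ∀ j', al j' ∈ U → j ≠ j' → cf M j j' = 0 := by
    intro j hj j' hj' hjj
    by_contra hcf
    obtain ⟨k, hk⟩ := hmem j hj
    obtain ⟨k', hk'⟩ := hmem j' hj'
    have := tt_finite cs cs' (k + k') G
    exact triangle cs (tt cs cs' (k+k') G) (hne j hj) (hne j' hj') hjj (hdj j hj) (hdj j' hj') hcf
      (hup (Nat.zero_le _) hdG) (hup (by omega) hk) (hup (by omega) hk')
  have hcomm : ∀ j, al j ∈ U → ∀ j', al j' ∈ U → cs.simple j * cs.simple j' = cs.simple j' * cs.simple j := by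
    intro j hj j' hj'
    by_cases h : j = j'
    · rw [h]
    · exact (isRefl_simple cs j).commute (isRefl_simple cs j') (by rw [bf_al, horth j hj j' hj' h])
  obtain ⟨a, ha, b, hb, c, hc', hall⟩ := three_elems (J := J) ⟨i0, hi0⟩ (by
    intro a ha b hb c hc e he hab hac hae hbc hbe hce
    obtain ⟨k1, hk1⟩ := hmem a (hJU a ha)
    obtain ⟨k2, hk2⟩ := hmem b (hJU b hb)
    obtain ⟨k3, hk3⟩ := hmem c (hJU c hc)
    obtain ⟨k4, hk4⟩ := hmem e (hJU e he)
    have := tt_finite cs cs' (k1 + k2 + k3 + k4) G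
    exact star cs (tt cs cs' (k1 + k2 + k3 + k4) G) (hne a (hJU a ha)) (hne b (hJU b hb))
      (hne c (hJU c hc)) (hne e (hJU e he)) hab hac hae hbc hbe hce
      (hdj a (hJU a ha)) (hdj b (hJU b hb)) (hdj c (hJU c hc)) (hdj e (hJU e he))
      (hup (Nat.zero_le _) hdG) (hup (by omega) hk1) (hup (by omega) hk2) (hup (by omega) hk3)
      (hup (by omega) hk4))
  refine ⟨x, hx.isReflection, a, b, c, ?_, hcomm _ (hJU a ha) _ (hJU b hb),
    hcomm _ (hJU a ha) _ (hJU c hc'), hcomm _ (hJU b hb) _ (hJU c hc')⟩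
  rw [hTx]
  apply Subgroup.closure_mono
  rintro _ ⟨j, hj, rfl⟩
  rcases hall j hj with rfl | rfl | rfl <;> simp

lemma cube {a b c : W} (ha : a * a = 1) (hb : b * b = 1) (hc : c * c = 1) (hab : a * b = b * a)
    (hac : a * c = c * a) (hbc : b * c = c * b) {g : W} (hg : g ∈ Subgroup.closure {a, b, c}) :
    g = 1 ∨ g = a ∨ g = b ∨ g = c ∨ g = a * b ∨ g = a * c ∨ g = b * c ∨ g = a * b * c := by
  have hai : a⁻¹ = a := inv_eq_of_mul_eq_one_left ha
  have hbi : b⁻¹ = b := inv_eq_of_mul_eq_one_left hb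
  have hci : c⁻¹ = c := inv_eq_of_mul_eq_one_left hc
  have hpow : ∀ y : W, y * y = 1 → ∀ n : ℕ, y ^ n = 1 ∨ y ^ n = y := by
    intro y hy n
    rcases Nat.even_or_odd' n with ⟨k, rfl | rfl⟩
    · left; rw [pow_mul, pow_two, hy, one_pow]
    · right; rw [pow_succ, pow_mul, pow_two, hy, one_pow, one_mul]
  have key : ∃ i j k : ℕ, g = a ^ i * b ^ j * c ^ k := by
    have hA : ∀ g : W, (∃ i j k : ℕ, g = a ^ i * b ^ j * c ^ k) →
        ∃ i j k : ℕ, a * g = a ^ i * b ^ j * c ^ k := by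
      rintro _ ⟨i, j, k, rfl⟩
      exact ⟨i+1, j, k, by rw [pow_succ']; group⟩
    have hB : ∀ g : W, (∃ i j k : ℕ, g = a ^ i * b ^ j * c ^ k) →
        ∃ i j k : ℕ, b * g = a ^ i * b ^ j * c ^ k := by
      rintro _ ⟨i, j, k, rfl⟩
      refine ⟨i, j+1, k, ?_⟩
      have h1 : b * a ^ i = a ^ i * b := (Commute.pow_right hab.symm i)
      rw [pow_succ', ← mul_assoc, ← mul_assoc, h1, ← mul_assoc]
    have hC : ∀ g : W, (∃ i j k : ℕ, g = a ^ i * b ^ j * c ^ k) →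
        ∃ i j k : ℕ, c * g = a ^ i * b ^ j * c ^ k := by
      rintro _ ⟨i, j, k, rfl⟩
      refine ⟨i, j, k+1, ?_⟩
      have h1 : c * a ^ i = a ^ i * c := (Commute.pow_right hac.symm i)
      have h2 : c * b ^ j = b ^ j * c := (Commute.pow_right hbc.symm j)
      rw [pow_succ', ← mul_assoc, ← mul_assoc, h1, mul_assoc (a ^ i) c, h2, ← mul_assoc, ← mul_assoc]
    induction hg using Subgroup.closure_induction_left with
    | one => exact ⟨0, 0, 0, by simp⟩
    | mul_left y hy z hz ih =>
      rcases hy with rfl | rfl | hy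
      · exact hA _ ih
      · exact hB _ ih
      · rw [Set.mem_singleton_iff.mp hy]; exact hC _ ih
    | inv_mul_cancel y hy z hz ih =>
      rcases hy with rfl | rfl | hy
      · rw [hai]; exact hA _ ih
      · rw [hbi]; exact hB _ ih
      · rw [Set.mem_singleton_iff.mp hy, hci]; exact hC _ ih
  obtain ⟨i, j, k, rfl⟩ := key
  rcases hpow a ha i with h1 | h1 <;> rcases hpow b hb j with h2 | h2 <;>
    rcases hpow c hc k with h3 | h3 <;> rw [h1, h2, h3] <;> simp

lemma parity_unique (hc : AllConj cs) (φ : W →* Multiplicative (ZMod 2)) (h : φ ≠ 1) :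
    φ = cs.lengthParity := by
  have hconst : ∀ i j, φ (cs.simple i) = φ (cs.simple j) := by
    intro i j
    obtain ⟨g, hg⟩ := hc i j
    rw [hg, map_mul, map_mul, map_inv, mul_comm (φ g), mul_inv_cancel_right]
  have hz : ∀ z : Multiplicative (ZMod 2), z = 1 ∨ z = Multiplicative.ofAdd 1 := by decide
  apply cs.ext_simple
  intro i
  rw [cs.lengthParity_simple]
  rcases hz (φ (cs.simple i)) with h1 | h1
  · exfalso
    apply h
    apply cs.ext_simple
    intro j
    rw [hconst j i, h1]; rfl
  · exact h1

lemma parity_eq (hc : AllConj cs) (j : B') : cs'.lengthParity = cs.lengthParity := by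
  apply parity_unique cs hc
  intro h
  have := cs'.lengthParity_simple j
  rw [h, MonoidHom.one_apply] at this
  exact absurd this (by decide)

lemma allConj' (hc : AllConj cs) : AllConj cs' := by
  classical
  intro j
  let f : B' → Multiplicative (ZMod 2) := fun k =>
    if ∃ g, cs'.simple k = g * cs'.simple j * g⁻¹ then Multiplicative.ofAdd 1 else 1
  have hz : ∀ z y : Multiplicative (ZMod 2), (z * y) * (z * y) = 1 := by decide
  have hz2 : ∀ z : Multiplicative (ZMod 2), z * z = 1 := by decide
  have hf : M'.IsLiftable f := by
    intro p q
    rcases Nat.even_or_odd' (M' p q) with ⟨k, hk | hk⟩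
    · rw [hk, pow_mul, pow_two, hz, one_pow]
    · obtain ⟨g, _, hg⟩ := odd_conj cs' (i := p) (j := q) ⟨k, hk⟩
      have : f p = f q := by
        have hiff : (∃ g, cs'.simple p = g * cs'.simple j * g⁻¹) ↔
            (∃ g, cs'.simple q = g * cs'.simple j * g⁻¹) := by
          constructor
          · rintro ⟨g', h'⟩
            exact ⟨g * g', by rw [hg, h']; group⟩
          · rintro ⟨g', h'⟩
            exact ⟨g⁻¹ * g', by rw [mul_inv_rev, inv_inv, ← mul_assoc, mul_assoc g⁻¹, mul_assoc g⁻¹, ← h', hg]; group⟩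
        simp only [f, hiff]
      rw [this, hz2, one_pow]
  have h1 : cs'.lift ⟨f, hf⟩ (cs'.simple j) = Multiplicative.ofAdd 1 := by
    rw [cs'.lift_apply_simple hf]
    exact if_pos ⟨1, by simp⟩
  have h2 : cs'.lift ⟨f, hf⟩ ≠ 1 := by
    intro h
    rw [h, MonoidHom.one_apply] at h1
    exact absurd h1 (by decide)
  have h3 := parity_unique cs hc _ h2
  rw [← parity_eq cs cs' hc j] at h3
  intro k
  have h4 := cs'.lengthParity_simple k
  rw [← h3, cs'.lift_apply_simple hf] at h4
  by_contra hn
  rw [show f k = 1 from if_neg hn] at h4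
  exact absurd h4 (by decide)

lemma parity_refl {x : W} (h : cs.IsReflection x) : cs.lengthParity x = Multiplicative.ofAdd 1 := by
  obtain ⟨w, i, rfl⟩ := h
  rw [map_mul, map_mul, map_inv, mul_comm (cs.lengthParity w), mul_inv_cancel_right,
    cs.lengthParity_simple]

/-- Step 3: the two sets of reflections meet -/
lemma common [Infinite W] (hodd : (SimpleGraph.fromRel fun b b' : B => Odd (M b b')).Connected) :
    ∃ x, cs.IsReflection x ∧ cs'.IsReflection x := by
  have hc := allConj_of_connected cs hodd
  by_contra hdis
  push Not at hdis
  obtain ⟨x, hx, a, b, c, hle, hab, hac, hbc⟩ := step2 cs cs' hodd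
  obtain ⟨β, hβ⟩ := IsRefl.exists_of_isReflection hx
  have hfx := zp_finite hβ
  have hspec := cl_spec cs' (Subgroup.zpowers x)
  have hfc := hspec.1
  have hle' : cl cs' (Subgroup.zpowers x) ≤
      Subgroup.closure {cs.simple a, cs.simple b, cs.simple c} := (cl_spec cs _).2.1.trans hle
  have hxm : x ∈ cl cs' (Subgroup.zpowers x) := hspec.2.1 (Subgroup.mem_zpowers x)
  have hx1 : x ≠ 1 := by
    intro h
    have h1 := parity_refl cs hx
    rw [h, map_one] at h1
    exact absurd h1 (by decide)
  have hsr : ∀ i, cs.IsReflection (cs.simple i) := fun i => (isRefl_simple cs i).isReflection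
  have hgen : ∀ y, cs'.IsReflection y → y ∈ cl cs' (Subgroup.zpowers x) →
      y = cs.simple a * cs.simple b * cs.simple c := by
    intro y hy hym
    have hp := parity_refl cs' hy
    rw [parity_eq cs cs' hc hy.choose_spec.choose] at hp
    have e2 : ∀ i j, cs.lengthParity (cs.simple i * cs.simple j) = 1 := by
      intro i j
      rw [map_mul, cs.lengthParity_simple, cs.lengthParity_simple]; decide
    have hno : ¬ (1 : Multiplicative (ZMod 2)) = Multiplicative.ofAdd 1 := by decide
    rcases cube (cs.simple_mul_simple_self a) (cs.simple_mul_simple_self b)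
      (cs.simple_mul_simple_self c) hab hac hbc (hle' hym) with h | h | h | h | h | h | h | h
    · rw [h, map_one] at hp; exact (hno hp).elim
    · rw [h] at hy; exact (hdis _ (hsr _) hy).elim
    · rw [h] at hy; exact (hdis _ (hsr _) hy).elim
    · rw [h] at hy; exact (hdis _ (hsr _) hy).elim
    · rw [h, e2] at hp; exact (hno hp).elim
    · rw [h, e2] at hp; exact (hno hp).elim
    · rw [h, e2] at hp; exact (hno hp).elim
    · exact h
  set S := {y | ∃ β, IsRefl cs' y β ∧ β ∈ E cs' (Subgroup.zpowers x)} with hS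
  have hcl : cl cs' (Subgroup.zpowers x) = Subgroup.closure S := rfl
  have hSne : S.Nonempty := by
    by_contra h
    rw [Set.not_nonempty_iff_eq_empty] at h
    rw [hcl, h, Subgroup.closure_empty] at hxm
    exact hx1 (Subgroup.mem_bot.mp hxm)
  obtain ⟨y, γ, hy, hyE⟩ := hSne
  have hSy : ∀ z ∈ S, z = y := by
    rintro z ⟨δ, hz, hzE⟩
    rw [hgen z hz.isReflection (refl_mem_cl cs' hz hzE), hgen y hy.isReflection (refl_mem_cl cs' hy hyE)]
  have hxy : x ∈ Subgroup.zpowers y := by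
    have : Subgroup.closure S ≤ Subgroup.zpowers y := by
      rw [Subgroup.closure_le]
      intro z hz
      rw [hSy z hz]
      exact Subgroup.mem_zpowers y
    exact this hxm
  obtain ⟨n, hn⟩ := hxy
  have hn : y ^ n = x := hn
  have hyy := hy.mul_self
  rcases Int.even_or_odd' n with ⟨k, rfl | rfl⟩
  · rw [zpow_mul, zpow_two, hyy, one_zpow] at hn
    exact hx1 hn.symm
  · rw [zpow_add, zpow_mul, zpow_two, hyy, one_zpow, one_mul, zpow_one] at hn
    rw [hn] at hy
    exact hdis x hx hy.isReflection

lemma main_eq [Infinite W] (hodd : (SimpleGraph.fromRel fun b b' : B => Odd (M b b')).Connected) (x : W) :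
    cs.IsReflection x ↔ cs'.IsReflection x := by
  have hc := allConj_of_connected cs hodd
  have hc' := allConj' cs cs' hc
  obtain ⟨y, h1, h2⟩ := common cs cs' hodd
  constructor
  · intro h
    obtain ⟨g, rfl⟩ := hc.refl h1 h
    obtain ⟨w, i, rfl⟩ := h2
    exact ⟨g * w, i, by group⟩
  · intro h
    obtain ⟨g, rfl⟩ := hc'.refl h2 h
    obtain ⟨w, i, rfl⟩ := h1
    exact ⟨g * w, i, by group⟩

end

end RI

theorem stmt_15 {B W : Type*} [Group W] {M : CoxeterMatrix B} (cs : CoxeterSystem M W)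
    (hodd : (SimpleGraph.fromRel fun b b' : B => Odd (M b b')).Connected)
    (hinf : Infinite W)
    {B' W' : Type*} [Group W'] {M' : CoxeterMatrix B'} (cs' : CoxeterSystem M' W')
    (f : W ≃* W') :
    ⇑f '' {w | cs.IsReflection w} = {w' | cs'.IsReflection w'} := by
  have key := RI.main_eq cs (cs'.map f.symm) hodd
  ext y
  constructor
  · rintro ⟨x, hx, rfl⟩
    obtain ⟨w, i, hw⟩ := (key x).mp hx
    refine ⟨f w, i, ?_⟩
    rw [hw]
    simp
  · rintro ⟨w, i, rfl⟩
    refine ⟨f.symm (w * cs'.simple i * w⁻¹), ?_, by simp⟩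
    refine (key _).mpr ⟨f.symm w, i, ?_⟩
    simp
end

section
/- Let (W,S) be a Coxeter system of type H₃: S = {x₁, x₂, x₃} with m(x₁,x₂) = 3, m(x₂,x₃) = 5 and m(x₁,x₃) = 2. Then for each i ∈ {1,2,3}, the subgroup W^{⊥x_i} of W generated by all reflections t with t ≠ x_i and t x_i = x_i t is isomorphic to the Klein four-group ℤ/2 × ℤ/2 (it is finite of order 4, generated by two distinct commuting reflections). -/
set_option linter.unusedSimpArgs false

/-- The fifteen candidate reflections of `H₃`, as words in the generators. -/
def H3.refl {G : Type*} [Group G] (a b c : G) : Fin 15 → G :=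
  ![a,
    b,
    c,
    a * b * a,
    c * b * c,
    b * c * b,
    a * c * b * a * c,
    b * c * b * c * b,
    a * b * c * b * a,
    b * a * c * b * a * c * b,
    a * b * c * b * c * b * a,
    a * b * a * c * b * a * c * b * a,
    c * b * a * c * b * a * c * b * c,
    a * c * b * a * c * b * a * c * b * a * c,
    b * a * c * b * a * c * b * a * c * b * a * c * b]

lemma H3.map_refl {G H : Type*} [Group G] [Group H] (f : G →* H) (a b c : G) (i : Fin 15) :
    f (H3.refl a b c i) = H3.refl (f a) (f b) (f c) i := by
  fin_cases i <;> simp [H3.refl]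

/-- The defining relations, oriented as rewriting rules. -/
structure H3.Rel {G : Type*} [Group G] (a b c : G) : Prop where
  r0 : a * a = 1
  r1 : b * b = 1
  r2 : c * c = 1
  r3 : b * (a * b) = a * (b * a)
  r4 : c * a = a * c
  r5 : c * (b * (c * (b * c))) = b * (c * (b * (c * b)))

section
variable {G : Type*} [Group G] {a b c : G}

lemma H3.Rel.e0 (h : H3.Rel a b c) (z : G) : a * (a * z) = z := by
  simpa only [mul_assoc, one_mul] using congrArg (· * z) h.r0

lemma H3.Rel.e1 (h : H3.Rel a b c) (z : G) : b * (b * z) = z := by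
  simpa only [mul_assoc, one_mul] using congrArg (· * z) h.r1

lemma H3.Rel.e2 (h : H3.Rel a b c) (z : G) : c * (c * z) = z := by
  simpa only [mul_assoc, one_mul] using congrArg (· * z) h.r2

lemma H3.Rel.e3 (h : H3.Rel a b c) (z : G) : b * (a * (b * z)) = a * (b * (a * z)) := by
  simpa only [mul_assoc, one_mul] using congrArg (· * z) h.r3

lemma H3.Rel.e4 (h : H3.Rel a b c) (z : G) : c * (a * z) = a * (c * z) := by
  simpa only [mul_assoc, one_mul] using congrArg (· * z) h.r4

lemma H3.Rel.e5 (h : H3.Rel a b c) (z : G) : c * (b * (c * (b * (c * z)))) = b * (c * (b * (c * (b * z)))) := by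
  simpa only [mul_assoc, one_mul] using congrArg (· * z) h.r5

lemma H3.Rel.r6 (h : H3.Rel a b c) : c * (b * (c * (b * (a * c)))) = b * (c * (b * (c * (b * a)))) := by
  have h1 : c * (b * (c * (b * (c * a)))) = b * (c * (b * (c * (b * a)))) := h.e5 _
  have h2 : c * (b * (c * (b * (c * a)))) = c * (b * (c * (b * (a * c)))) := by rw [h.r4]
  have h3 := h1.symm.trans h2
  try simp only [h.r0, h.e0, h.r1, h.e1, h.r2, h.e2, h.r3, h.e3, h.r4, h.e4, h.r5, h.e5, mul_one] at h3
  first | exact h3 | exact h3.symm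

lemma H3.Rel.e6 (h : H3.Rel a b c) (z : G) : c * (b * (c * (b * (a * (c * z))))) = b * (c * (b * (c * (b * (a * z))))) := by
  simpa only [mul_assoc, one_mul] using congrArg (· * z) h.r6

lemma H3.Rel.r7 (h : H3.Rel a b c) : c * (b * (a * (c * (b * (a * (c * (b * (c * b)))))))) = b * (c * (b * (a * (c * (b * (a * (c * (b * c)))))))) := by
  have h1 : c * (b * (c * (b * (a * (c * (b * (c * (b * c)))))))) = b * (c * (b * (c * (b * (a * (b * (c * (b * c)))))))) := h.e6 _
  have h2 : c * (b * (c * (b * (a * (c * (b * (c * (b * c)))))))) = c * (b * (c * (b * (a * (b * (c * (b * (c * b)))))))) := by rw [h.r5]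
  have h3 := h1.symm.trans h2
  try simp only [h.r0, h.e0, h.r1, h.e1, h.r2, h.e2, h.r3, h.e3, h.r4, h.e4, h.r5, h.e5, h.r6, h.e6, mul_one] at h3
  first | exact h3 | exact h3.symm

lemma H3.Rel.e7 (h : H3.Rel a b c) (z : G) : c * (b * (a * (c * (b * (a * (c * (b * (c * (b * z))))))))) = b * (c * (b * (a * (c * (b * (a * (c * (b * (c * z))))))))) := by
  simpa only [mul_assoc, one_mul] using congrArg (· * z) h.r7

lemma H3.Rel.r8 (h : H3.Rel a b c) : c * (b * (a * (c * (b * (a * (c * (b * (a * (c * (b * a)))))))))) = b * (c * (b * (a * (c * (b * (a * (c * (b * (a * (c * b)))))))))) := by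
  have h1 : c * (b * (a * (c * (b * (a * (c * (b * (c * (b * (a * b)))))))))) = b * (c * (b * (a * (c * (b * (a * (c * (b * (c * (a * b)))))))))) := h.e7 _
  have h2 : c * (b * (a * (c * (b * (a * (c * (b * (c * (b * (a * b)))))))))) = c * (b * (a * (c * (b * (a * (c * (b * (c * (a * (b * a)))))))))) := by rw [h.r3]
  have h3 := h1.symm.trans h2
  try simp only [h.r0, h.e0, h.r1, h.e1, h.r2, h.e2, h.r3, h.e3, h.r4, h.e4, h.r5, h.e5, h.r6, h.e6, h.r7, h.e7, mul_one] at h3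
  first | exact h3 | exact h3.symm

lemma H3.Rel.e8 (h : H3.Rel a b c) (z : G) : c * (b * (a * (c * (b * (a * (c * (b * (a * (c * (b * (a * z))))))))))) = b * (c * (b * (a * (c * (b * (a * (c * (b * (a * (c * (b * z))))))))))) := by
  simpa only [mul_assoc, one_mul] using congrArg (· * z) h.r8

lemma H3.Rel.conj_a (h : H3.Rel a b c) (i : Fin 15) :
    a * H3.refl a b c i * a = H3.refl a b c ((![0, 3, 2, 1, 6, 8, 4, 10, 5, 11, 7, 9, 13, 12, 14] : Fin 15 → Fin 15) i) := by
  fin_cases i <;> simp [H3.refl, mul_assoc, h.r0, h.e0, h.r1, h.e1, h.r2, h.e2, h.r3, h.e3, h.r4, h.e4, h.r5, h.e5, h.r6, h.e6, h.r7, h.e7, h.r8, h.e8]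

lemma H3.Rel.conj_b (h : H3.Rel a b c) (i : Fin 15) :
    b * H3.refl a b c i * b = H3.refl a b c ((![3, 1, 5, 0, 7, 2, 9, 4, 8, 6, 11, 10, 12, 14, 13] : Fin 15 → Fin 15) i) := by
  fin_cases i <;> simp [H3.refl, mul_assoc, h.r0, h.e0, h.r1, h.e1, h.r2, h.e2, h.r3, h.e3, h.r4, h.e4, h.r5, h.e5, h.r6, h.e6, h.r7, h.e7, h.r8, h.e8]

lemma H3.Rel.conj_c (h : H3.Rel a b c) (i : Fin 15) :
    c * H3.refl a b c i * c = H3.refl a b c ((![0, 4, 2, 6, 1, 7, 3, 5, 10, 12, 8, 13, 9, 11, 14] : Fin 15 → Fin 15) i) := by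
  fin_cases i <;> simp [H3.refl, mul_assoc, h.r0, h.e0, h.r1, h.e1, h.r2, h.e2, h.r3, h.e3, h.r4, h.e4, h.r5, h.e5, h.r6, h.e6, h.r7, h.e7, h.r8, h.e8]

lemma H3.Rel.comm_a1 (h : H3.Rel a b c) :
    H3.refl a b c 2 * H3.refl a b c 0 = H3.refl a b c 0 * H3.refl a b c 2 := by
  simp [H3.refl, mul_assoc, h.r0, h.e0, h.r1, h.e1, h.r2, h.e2, h.r3, h.e3, h.r4, h.e4, h.r5, h.e5, h.r6, h.e6, h.r7, h.e7, h.r8, h.e8]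

lemma H3.Rel.comm_a2 (h : H3.Rel a b c) :
    H3.refl a b c 14 * H3.refl a b c 0 = H3.refl a b c 0 * H3.refl a b c 14 := by
  simp [H3.refl, mul_assoc, h.r0, h.e0, h.r1, h.e1, h.r2, h.e2, h.r3, h.e3, h.r4, h.e4, h.r5, h.e5, h.r6, h.e6, h.r7, h.e7, h.r8, h.e8]

lemma H3.Rel.comm_a3 (h : H3.Rel a b c) :
    H3.refl a b c 14 * H3.refl a b c 2 = H3.refl a b c 2 * H3.refl a b c 14 := by
  simp [H3.refl, mul_assoc, h.r0, h.e0, h.r1, h.e1, h.r2, h.e2, h.r3, h.e3, h.r4, h.e4, h.r5, h.e5, h.r6, h.e6, h.r7, h.e7, h.r8, h.e8]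

lemma H3.Rel.comm_b1 (h : H3.Rel a b c) :
    H3.refl a b c 8 * H3.refl a b c 1 = H3.refl a b c 1 * H3.refl a b c 8 := by
  simp [H3.refl, mul_assoc, h.r0, h.e0, h.r1, h.e1, h.r2, h.e2, h.r3, h.e3, h.r4, h.e4, h.r5, h.e5, h.r6, h.e6, h.r7, h.e7, h.r8, h.e8]

lemma H3.Rel.comm_b2 (h : H3.Rel a b c) :
    H3.refl a b c 12 * H3.refl a b c 1 = H3.refl a b c 1 * H3.refl a b c 12 := by
  simp [H3.refl, mul_assoc, h.r0, h.e0, h.r1, h.e1, h.r2, h.e2, h.r3, h.e3, h.r4, h.e4, h.r5, h.e5, h.r6, h.e6, h.r7, h.e7, h.r8, h.e8]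

lemma H3.Rel.comm_b3 (h : H3.Rel a b c) :
    H3.refl a b c 12 * H3.refl a b c 8 = H3.refl a b c 8 * H3.refl a b c 12 := by
  simp [H3.refl, mul_assoc, h.r0, h.e0, h.r1, h.e1, h.r2, h.e2, h.r3, h.e3, h.r4, h.e4, h.r5, h.e5, h.r6, h.e6, h.r7, h.e7, h.r8, h.e8]

lemma H3.Rel.comm_c1 (h : H3.Rel a b c) :
    H3.refl a b c 0 * H3.refl a b c 2 = H3.refl a b c 2 * H3.refl a b c 0 := by
  simp [H3.refl, mul_assoc, h.r0, h.e0, h.r1, h.e1, h.r2, h.e2, h.r3, h.e3, h.r4, h.e4, h.r5, h.e5, h.r6, h.e6, h.r7, h.e7, h.r8, h.e8]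

lemma H3.Rel.comm_c2 (h : H3.Rel a b c) :
    H3.refl a b c 14 * H3.refl a b c 2 = H3.refl a b c 2 * H3.refl a b c 14 := by
  simp [H3.refl, mul_assoc, h.r0, h.e0, h.r1, h.e1, h.r2, h.e2, h.r3, h.e3, h.r4, h.e4, h.r5, h.e5, h.r6, h.e6, h.r7, h.e7, h.r8, h.e8]

lemma H3.Rel.comm_c3 (h : H3.Rel a b c) :
    H3.refl a b c 14 * H3.refl a b c 0 = H3.refl a b c 0 * H3.refl a b c 14 := by
  simp [H3.refl, mul_assoc, h.r0, h.e0, h.r1, h.e1, h.r2, h.e2, h.r3, h.e3, h.r4, h.e4, h.r5, h.e5, h.r6, h.e6, h.r7, h.e7, h.r8, h.e8]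

end

lemma H3.klein {G : Type*} [Group G] (t u : G) (ht : t * t = 1) (hu : u * u = 1)
    (htu : t * u = u * t) (h1 : t ≠ 1) (h2 : u ≠ 1) (h3 : t ≠ u) (T : Set G) (hT : T = {t, u}) :
    Nonempty (Subgroup.closure T ≃* Multiplicative (ZMod 2) × Multiplicative (ZMod 2)) := by
  subst hT
  have hti : t⁻¹ = t := inv_eq_of_mul_eq_one_left ht
  have hui : u⁻¹ = u := inv_eq_of_mul_eq_one_left hu
  have e1 : ∀ z, t * (t * z) = z := fun z => by rw [← mul_assoc, ht, one_mul]
  have e2 : ∀ z, u * (u * z) = z := fun z => by rw [← mul_assoc, hu, one_mul]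
  have e3 : ∀ z, u * (t * z) = t * (u * z) := fun z => by
    rw [← mul_assoc, ← htu, mul_assoc]
  have h4 : t * u ≠ 1 := fun h => h3 (by rw [← hui]; exact eq_inv_of_mul_eq_one_left h)
  let K : Subgroup G :=
    { carrier := {1, t, u, t * u}
      one_mem' := by simp
      mul_mem' := by
        rintro x y (rfl | rfl | rfl | rfl) (rfl | rfl | rfl | rfl) <;>
          simp [mul_assoc, ht, hu, e1, e2, e3, ← htu]
      inv_mem' := by
        rintro x (rfl | rfl | rfl | rfl) <;> simp [hti, hui, ← htu] }
  have hK : Subgroup.closure {t, u} = K := by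
    apply le_antisymm
    · rw [Subgroup.closure_le]
      rintro x (rfl | rfl)
      · exact Or.inr (Or.inl rfl)
      · exact Or.inr (Or.inr (Or.inl rfl))
    · have m1 : t ∈ Subgroup.closure {t, u} := Subgroup.subset_closure (by simp)
      have m2 : u ∈ Subgroup.closure {t, u} := Subgroup.subset_closure (by simp)
      rintro x (rfl | rfl | rfl | rfl)
      · exact one_mem _
      · exact m1
      · exact m2
      · exact mul_mem m1 m2
  rw [hK]
  have hcard : Nat.card K = 4 := by
    change Nat.card ({1, t, u, t * u} : Set G) = 4
    classical
    have : ({1, t, u, t * u} : Set G) = (({1, t, u, t * u} : Finset G) : Set G) := by simp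
    rw [this, Nat.card_coe_set_eq, Set.ncard_coe_finset]
    rw [Finset.card_eq_of_equiv_fin]
    have n1 : u ≠ t * u := fun h => h1 (by simpa using h)
    have n2 : t ≠ t * u := fun h => h2 (by simpa using h)
    exact (Finset.equivFinOfCardEq (by
      rw [Finset.card_insert_of_notMem, Finset.card_insert_of_notMem,
        Finset.card_insert_of_notMem, Finset.card_singleton] <;>
      simp [h1.symm, h2.symm, h3, h4.symm, h1, h2]))
  have hsq : ∀ x : K, x ^ 2 = 1 := by
    rintro ⟨x, (rfl | rfl | rfl | rfl)⟩ <;> apply Subtype.ext <;>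
      simp [pow_two, mul_assoc, ht, hu, e1, e2, e3]
  have hexp : Monoid.exponent K = 2 := by
    have hd : Monoid.exponent K ∣ 2 := Monoid.exponent_dvd_of_forall_pow_eq_one hsq
    rcases (Nat.dvd_prime Nat.prime_two).1 hd with h | h
    · exfalso
      have := Monoid.exp_eq_one_iff.1 h
      have := Nat.card_of_subsingleton (1 : K)
      omega
    · exact h
  have : IsKleinFour K := ⟨hcard, hexp⟩
  obtain ⟨e⟩ := IsKleinFour.nonempty_mulEquiv (G₁ := K) (G₂ := Multiplicative (ZMod 2 × ZMod 2))
  exact ⟨e.trans (MulEquiv.prodMultiplicative _ _)⟩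

/-- Images of the generators in `A₅`. -/
def H3.pa : Equiv.Perm (Fin 5) := Equiv.swap 1 2 * Equiv.swap 3 4
def H3.pb : Equiv.Perm (Fin 5) := Equiv.swap 0 1 * Equiv.swap 3 4
def H3.pc : Equiv.Perm (Fin 5) := Equiv.swap 1 3 * Equiv.swap 2 4

lemma H3.perm_ne : ∀ i : Fin 15, H3.refl H3.pa H3.pb H3.pc i ≠ 1 := by decide +kernel

lemma H3.perm_inj : ∀ i j : Fin 15, i ≠ j →
    H3.refl H3.pa H3.pb H3.pc i ≠ H3.refl H3.pa H3.pb H3.pc j := by decide +kernel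

lemma H3.perm_comm : ∀ i : Fin 15,
    (H3.refl H3.pa H3.pb H3.pc i * H3.pa = H3.pa * H3.refl H3.pa H3.pb H3.pc i →
      i = 0 ∨ i = 2 ∨ i = 14) ∧
    (H3.refl H3.pa H3.pb H3.pc i * H3.pb = H3.pb * H3.refl H3.pa H3.pb H3.pc i →
      i = 1 ∨ i = 8 ∨ i = 12) ∧
    (H3.refl H3.pa H3.pb H3.pc i * H3.pc = H3.pc * H3.refl H3.pa H3.pb H3.pc i →
      i = 2 ∨ i = 0 ∨ i = 14) := by decide +kernel

/-- Let `(W,S)` be a Coxeter system of type `H₃`: `S = {x₁, x₂, x₃}` with `m(x₁,x₂) = 3`,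
`m(x₂,x₃) = 5`, `m(x₁,x₃) = 2`.  Then for each generator `x`, the subgroup `W^{⊥x}` generated
by all reflections `t ≠ x` commuting with `x` is isomorphic to the Klein four-group
`ℤ/2 × ℤ/2`. -/
theorem stmt_16 {B W : Type*} [Group W] {M : CoxeterMatrix B} (cs : CoxeterSystem M W)
    (x₁ x₂ x₃ : B) (h12 : x₁ ≠ x₂) (h13 : x₁ ≠ x₃) (h23 : x₂ ≠ x₃)
    (hall : ∀ b : B, b = x₁ ∨ b = x₂ ∨ b = x₃)
    (hm12 : M x₁ x₂ = 3) (hm23 : M x₂ x₃ = 5) (hm13 : M x₁ x₃ = 2) :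
    ∀ x : B,
      Nonempty ((Subgroup.closure {t : W | cs.IsReflection t ∧ t ≠ cs.simple x ∧
          t * cs.simple x = cs.simple x * t}) ≃*
        Multiplicative (ZMod 2) × Multiplicative (ZMod 2)) := by
  classical
  have hrel : H3.Rel (cs.simple x₁) (cs.simple x₂) (cs.simple x₃) := by
    have q12 := cs.simple_mul_simple_pow' x₁ x₂
    have q23 := cs.simple_mul_simple_pow x₂ x₃
    have q13 := cs.simple_mul_simple_pow x₁ x₃
    rw [hm12] at q12
    rw [hm23] at q23
    rw [hm13] at q13
    have i1 := cs.inv_simple x₁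
    have i2 := cs.inv_simple x₂
    have i3 := cs.inv_simple x₃
    refine ⟨cs.simple_mul_simple_self _, cs.simple_mul_simple_self _,
      cs.simple_mul_simple_self _, ?_, ?_, ?_⟩
    · rw [← mul_inv_eq_one]
      simpa [pow_succ, mul_assoc, i1, i2, i3] using q12
    · symm
      rw [← mul_inv_eq_one]
      simpa [pow_succ, mul_assoc, i1, i2, i3] using q13
    · symm
      rw [← mul_inv_eq_one]
      simpa [pow_succ, mul_assoc, i1, i2, i3] using q23
  let f : B → Equiv.Perm (Fin 5) := fun b => if b = x₁ then H3.pa else if b = x₂ then H3.pb else H3.pc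
  have f1 : f x₁ = H3.pa := by simp [f]
  have f2 : f x₂ = H3.pb := by simp [f, h12.symm]
  have f3 : f x₃ = H3.pc := by simp [f, h13.symm, h23.symm]
  have hm21 : M x₂ x₁ = 3 := (M.symmetric _ _).trans hm12
  have hm32 : M x₃ x₂ = 5 := (M.symmetric _ _).trans hm23
  have hm31 : M x₃ x₁ = 2 := (M.symmetric _ _).trans hm13
  have hf : M.IsLiftable f := by
    intro i j
    rcases hall i with hi | hi | hi <;> rcases hall j with hj | hj | hj <;> rw [hi, hj] <;>
      simp only [f1, f2, f3, M.diagonal, hm12, hm13, hm23, hm21, hm31, hm32] <;> decide +kernel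
  let φ : W →* Equiv.Perm (Fin 5) := cs.lift ⟨f, hf⟩
  have φ1 : φ (cs.simple x₁) = H3.pa := (cs.lift_apply_simple hf x₁).trans f1
  have φ2 : φ (cs.simple x₂) = H3.pb := (cs.lift_apply_simple hf x₂).trans f2
  have φ3 : φ (cs.simple x₃) = H3.pc := (cs.lift_apply_simple hf x₃).trans f3
  set R : Fin 15 → W := H3.refl (cs.simple x₁) (cs.simple x₂) (cs.simple x₃) with hR
  have hφR : ∀ i, φ (R i) = H3.refl H3.pa H3.pb H3.pc i := fun i => by
    rw [hR, H3.map_refl, φ1, φ2, φ3]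
  have R0 : R 0 = cs.simple x₁ := rfl
  have R1 : R 1 = cs.simple x₂ := rfl
  have R2 : R 2 = cs.simple x₃ := rfl
  have hRne : ∀ i, R i ≠ 1 := fun i h => H3.perm_ne i (by rw [← hφR, h, map_one])
  have hRinj : ∀ i j, i ≠ j → R i ≠ R j := fun i j hij h =>
    H3.perm_inj i j hij (by rw [← hφR, ← hφR, h])
  -- every reflection is one of the fifteen
  have hrefl : ∀ t, cs.IsReflection t → ∃ i, t = R i := by
    rintro t ⟨w, b, rfl⟩
    induction w using cs.simple_induction_left with
    | one =>
      rcases hall b with rfl | rfl | rfl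
      · exact ⟨0, by simp [R0]⟩
      · exact ⟨1, by simp [R1]⟩
      · exact ⟨2, by simp [R2]⟩
    | mul_simple_left w k ih =>
      obtain ⟨i, hi⟩ := ih
      have e : cs.simple k * w * cs.simple b * (cs.simple k * w)⁻¹ =
          cs.simple k * R i * cs.simple k := by
        rw [← hi]; simp [mul_assoc]
      rw [e]
      rcases hall k with rfl | rfl | rfl
      · exact ⟨_, hrel.conj_a i⟩
      · exact ⟨_, hrel.conj_b i⟩
      · exact ⟨_, hrel.conj_c i⟩
  -- each of the relevant words is a reflection
  have isr : ∀ (w : W) (b : B) (t : W), t = w * cs.simple b * w⁻¹ → cs.IsReflection t :=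
    fun w b t h => ⟨w, b, h⟩
  have r0 : cs.IsReflection (R 0) := cs.isReflection_simple _
  have r2 : cs.IsReflection (R 2) := cs.isReflection_simple _
  have r8 : cs.IsReflection (R 8) :=
    isr (cs.simple x₁ * cs.simple x₂) x₃ _ (by simp [hR, H3.refl, mul_assoc])
  have step : ∀ (k : B) (i j : Fin 15), cs.simple k * R i * cs.simple k = R j →
      cs.IsReflection (R i) → cs.IsReflection (R j) := by
    intro k i j h hi
    have := hi.conj (cs.simple k)
    rwa [cs.inv_simple, h] at this
  have r3 : cs.IsReflection (R 3) := step _ 0 3 (hrel.conj_b 0) r0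
  have r6 : cs.IsReflection (R 6) := step _ 3 6 (hrel.conj_c 3) r3
  have r9 : cs.IsReflection (R 9) := step _ 6 9 (hrel.conj_b 6) r6
  have r11 : cs.IsReflection (R 11) := step _ 9 11 (hrel.conj_a 9) r9
  have r12 : cs.IsReflection (R 12) := step _ 9 12 (hrel.conj_c 9) r9
  have r13 : cs.IsReflection (R 13) := step _ 11 13 (hrel.conj_c 11) r11
  have r14 : cs.IsReflection (R 14) := step _ 13 14 (hrel.conj_b 13) r13
  have main : ∀ (x : B) (p q s : Fin 15), R p = cs.simple x → p ≠ q → p ≠ s → q ≠ s →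
      R q * R p = R p * R q → R s * R p = R p * R s → R s * R q = R q * R s →
      cs.IsReflection (R q) → cs.IsReflection (R s) →
      (∀ i, R i * R p = R p * R i → i = p ∨ i = q ∨ i = s) →
      Nonempty ((Subgroup.closure {t : W | cs.IsReflection t ∧ t ≠ cs.simple x ∧
          t * cs.simple x = cs.simple x * t}) ≃*
        Multiplicative (ZMod 2) × Multiplicative (ZMod 2)) := by
    intro x p q s hp hpq hps hqs c1 c2 c3 rq rs hc
    refine H3.klein (R q) (R s) rq.mul_self rs.mul_self c3.symm (hRne q) (hRne s) (hRinj q s hqs)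
      _ ?_
    rw [← hp]
    ext t
    constructor
    · rintro ⟨ht, hne, hcm⟩
      obtain ⟨i, rfl⟩ := hrefl t ht
      rcases hc i hcm with rfl | rfl | rfl
      · exact absurd rfl hne
      · exact Or.inl rfl
      · exact Or.inr rfl
    · rintro (rfl | rfl)
      · exact ⟨rq, hRinj _ _ hpq.symm, c1⟩
      · exact ⟨rs, hRinj _ _ hps.symm, c2⟩
  have hφc : ∀ i j, R i * R j = R j * R i → H3.refl H3.pa H3.pb H3.pc i *
      H3.refl H3.pa H3.pb H3.pc j = H3.refl H3.pa H3.pb H3.pc j * H3.refl H3.pa H3.pb H3.pc i := by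
    intro i j h
    rw [← hφR, ← hφR, ← map_mul, ← map_mul, h]
  intro x
  rcases hall x with rfl | rfl | rfl
  · exact main _ 0 2 14 R0 (by decide) (by decide) (by decide) hrel.comm_a1 hrel.comm_a2
      hrel.comm_a3 r2 r14 (fun i h => (H3.perm_comm i).1 (hφc i 0 h))
  · exact main _ 1 8 12 R1 (by decide) (by decide) (by decide) hrel.comm_b1 hrel.comm_b2
      hrel.comm_b3 r8 r12 (fun i h => (H3.perm_comm i).2.1 (hφc i 1 h))
  · exact main _ 2 0 14 R2 (by decide) (by decide) (by decide) hrel.comm_c1 hrel.comm_c2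
      hrel.comm_c3 r0 r14 (fun i h => (H3.perm_comm i).2.2 (hφc i 2 h))
end

section
/- Let m ≥ 3 be odd and let (W,S) be a Coxeter system of type P(m): S = {x₁, x₂, x₃, x₄} with m(x₁,x₂) = m, m(x₂,x₃) = m(x₃,x₄) = 3, m(x₁,x₃) = ∞, and m(x₁,x₄) = m(x₂,x₄) = 2. Then for each i ∈ {1,2,3,4}, the subgroup W^{⊥x_i} of W generated by all reflections t with t ≠ x_i and t x_i = x_i t is finite: it is a Coxeter group of type I₂(m), i.e., isomorphic to the dihedral group of order 2m. -/
namespace PM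

/-- Products of nonempty alternating words in the letters `G i \ C`, with first letter of type `i`
and last letter of type `k`. -/
inductive Alt {W : Type*} [Group W] (G : Bool → Subgroup W) (C : Subgroup W) :
    Bool → Bool → W → Prop
  | single (i : Bool) (y : W) (hy : y ∈ G i) (hC : y ∉ C) : Alt G C i i y
  | cons (i k : Bool) (y w : W) (hy : y ∈ G i) (hC : y ∉ C) (hw : Alt G C (!i) k w) :
      Alt G C i k (y * w)

variable {W : Type*} [Group W] {G : Bool → Subgroup W} {C : Subgroup W}

theorem Alt.snoc {i k : Bool} {w : W} (h : Alt G C i k w) {z : W} (hz : z ∈ G (!k))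
    (hC : z ∉ C) : Alt G C i (!k) (w * z) := by
  induction h with
  | single i y hy hyC =>
    exact Alt.cons _ _ _ _ hy hyC (Alt.single _ _ hz hC)
  | cons i k y w hy hyC hw ih =>
    rw [mul_assoc]
    exact Alt.cons _ _ _ _ hy hyC (ih hz)

theorem Alt.conj {i : Bool} {t : W} (h : Alt G C (!i) (!i) t) {y : W} (hy : y ∈ G i)
    (hC : y ∉ C) : Alt G C i i (y * t * y⁻¹) := by
  have := (Alt.cons _ _ _ _ hy hC h).snoc (z := y⁻¹) (by simpa using hy) (by simpa using hC)
  simpa using this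

theorem Alt.mul_left_C (hle : ∀ i, C ≤ G i) {i k : Bool} {w : W} (h : Alt G C i k w) {c : W}
    (hc : c ∈ C) : Alt G C i k (c * w) := by
  cases h with
  | single i y hy hyC =>
    exact Alt.single _ _ (mul_mem (hle _ hc) hy) (by rwa [Subgroup.mul_mem_cancel_left _ hc])
  | cons i k y w hy hyC hw =>
    rw [← mul_assoc]
    exact Alt.cons _ _ _ _ (mul_mem (hle _ hc) hy)
      (by rwa [Subgroup.mul_mem_cancel_left _ hc]) hw

theorem Alt.mul_left (hle : ∀ i, C ≤ G i) {w : W} (h : w ∈ C ∨ ∃ i k, Alt G C i k w)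
    {j : Bool} {y : W} (hy : y ∈ G j) : y * w ∈ C ∨ ∃ i k, Alt G C i k (y * w) := by
  by_cases hyC : y ∈ C
  · rcases h with h | ⟨i, k, h⟩
    · exact Or.inl (mul_mem hyC h)
    · exact Or.inr ⟨i, k, h.mul_left_C hle hyC⟩
  rcases h with h | ⟨i, k, h⟩
  · refine Or.inr ⟨j, j, Alt.single _ _ (mul_mem hy (hle _ h)) ?_⟩
    rwa [Subgroup.mul_mem_cancel_right _ h]
  by_cases hij : i = !j
  · subst hij
    exact Or.inr ⟨j, k, Alt.cons _ _ _ _ hy hyC h⟩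
  have hij : i = j := by revert hij; cases i <;> cases j <;> simp
  subst hij
  cases h with
  | single i z hz hzC =>
    by_cases hm : y * w ∈ C
    · exact Or.inl hm
    · exact Or.inr ⟨i, i, Alt.single _ _ (mul_mem hy hz) hm⟩
  | cons i k z w hz hzC hw =>
    rw [← mul_assoc]
    by_cases hm : y * z ∈ C
    · exact Or.inr ⟨_, k, hw.mul_left_C hle hm⟩
    · exact Or.inr ⟨i, k, Alt.cons _ _ _ _ (mul_mem hy hz) hm hw⟩

open Monoid in
theorem Alt.exists_word (hle : ∀ i, C ≤ G i)
    (f : W →* PushoutI (fun i => Subgroup.inclusion (hle i)))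
    (hf : ∀ i (y : W) (hy : y ∈ G i), f y = PushoutI.of i ⟨y, hy⟩)
    {i k : Bool} {w : W} (h : Alt G C i k w) :
    ∃ v : CoprodI.Word (fun i => G i), PushoutI.Reduced (fun i => Subgroup.inclusion (hle i)) v ∧
      PushoutI.ofCoprodI v.prod = f w ∧ v.fstIdx = some i := by
  have key : ∀ (i : Bool) (y : W) (hy : y ∈ G i), y ∉ C →
      (⟨y, hy⟩ : G i) ∉ (Subgroup.inclusion (hle i)).range := by
    rintro i y hy hC ⟨c, hc⟩
    apply hC
    have := congrArg Subtype.val hc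
    simp at this
    rw [← this]; exact c.2
  have ne1 : ∀ (i : Bool) (y : W) (hy : y ∈ G i), y ∉ C → (⟨y, hy⟩ : G i) ≠ 1 := by
    intro i y hy hC h
    apply hC
    have := congrArg Subtype.val h
    simp at this
    rw [this]; exact one_mem _
  induction h with
  | single i y hy hC =>
    have h0 : (CoprodI.Word.empty : CoprodI.Word (fun i => G i)).fstIdx ≠ some i := by
      simp [CoprodI.Word.fstIdx, CoprodI.Word.empty]
    refine ⟨CoprodI.Word.cons ⟨y, hy⟩ CoprodI.Word.empty h0 (ne1 _ _ hy hC), ?_, ?_, ?_⟩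
    · intro g hg
      simp [CoprodI.Word.cons, CoprodI.Word.empty] at hg
      subst hg
      exact key _ _ hy hC
    · rw [CoprodI.Word.prod_cons, hf i y hy]
      simp
    · simp
  | cons i k y w hy hC hw ih =>
    obtain ⟨v, hv1, hv2, hv3⟩ := ih
    refine ⟨CoprodI.Word.cons ⟨y, hy⟩ v (by rw [hv3]; simp) (ne1 _ _ hy hC), ?_, ?_, ?_⟩
    · intro g hg
      simp only [CoprodI.Word.cons, List.mem_cons] at hg
      rcases hg with hg | hg
      · subst hg
        exact key _ _ hy hC
      · exact hv1 g hg
    · rw [CoprodI.Word.prod_cons, map_mul, map_mul, hv2, hf i y hy]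
      simp
    · simp

open Monoid in
theorem Alt.not_mem (hle : ∀ i, C ≤ G i)
    (f : W →* PushoutI (fun i => Subgroup.inclusion (hle i)))
    (hf : ∀ i (y : W) (hy : y ∈ G i), f y = PushoutI.of i ⟨y, hy⟩)
    {i k : Bool} {w : W} (h : Alt G C i k w) : w ∉ C := by
  intro hw
  obtain ⟨v, hv1, hv2, hv3⟩ := h.exists_word hle f hf
  have := hv1.eq_empty_of_mem_range (fun i => Subgroup.inclusion_injective (hle i)) (by
    rw [hv2]
    refine ⟨⟨w, hw⟩, ?_⟩
    rw [hf i w (hle i hw)]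
    rw [← PushoutI.of_apply_eq_base _ i]
    rfl)
  subst this
  simp [CoprodI.Word.fstIdx, CoprodI.Word.empty] at hv3

end PM

namespace PM

/-- The relations of type `P(m)`, together with a map to the symmetric group on four letters. -/
structure Rels {W : Type*} [Group W] (m : ℕ) (a b c d : W) (σ : W →* Equiv.Perm (Fin 4)) :
    Prop where
  modd : Odd m
  aa : a * a = 1
  bb : b * b = 1
  cc : c * c = 1
  dd : d * d = 1
  ab : (a * b) ^ m = 1
  bc : b * c * b = c * b * c
  cd : d * c * d = c * d * c
  ad : a * d = d * a
  bd : b * d = d * b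
  sa : σ a = Equiv.swap 0 1
  sb : σ b = Equiv.swap 0 1
  sc : σ c = Equiv.swap 1 2
  sd : σ d = Equiv.swap 2 3

variable {W : Type*} [Group W] {m : ℕ} {a b c d : W} {σ : W →* Equiv.Perm (Fin 4)}

theorem inv_of_sq {x : W} (h : x * x = 1) : x⁻¹ = x := inv_eq_of_mul_eq_one_left h

theorem Rels.memC (h : Rels m a b c d σ) {x : W} (hx : x ∈ Subgroup.closure {b, d}) :
    x = 1 ∨ x = b ∨ x = d ∨ x = b * d := by
  have hb := h.bb
  have hd := h.dd
  have hbd := h.bd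
  have step : ∀ u, u = b ∨ u = d → ∀ y : W, (y = 1 ∨ y = b ∨ y = d ∨ y = b * d) →
      (u * y = 1 ∨ u * y = b ∨ u * y = d ∨ u * y = b * d) := by
    rintro u (rfl | rfl) y (rfl | rfl | rfl | rfl)
    · simp
    · simp [hb]
    · simp
    · simp [← mul_assoc, hb]
    · simp
    · simp [hbd]
    · simp [hd]
    · simp [hbd, ← mul_assoc, hd]
  induction hx using Subgroup.closure_induction_left with
  | one => simp
  | mul_left u hu y hy ih => exact step u (by simpa using hu) y ih
  | inv_mul_cancel u hu y hy ih =>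
    have hu' : u = b ∨ u = d := by simpa using hu
    have : u⁻¹ = u := by
      rcases hu' with rfl | rfl
      · exact inv_of_sq hb
      · exact inv_of_sq hd
    rw [this]
    exact step u hu' y ih

theorem Rels.sigmaC (h : Rels m a b c d σ) {x : W} (hx : x ∈ Subgroup.closure {b, d}) :
    σ x = 1 ∨ σ x = Equiv.swap 0 1 ∨ σ x = Equiv.swap 2 3 ∨
      σ x = Equiv.swap 0 1 * Equiv.swap 2 3 := by
  rcases h.memC hx with rfl | rfl | rfl | rfl
  · simp
  · simp [h.sb]
  · simp [h.sd]
  · simp [h.sb, h.sd]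

theorem Rels.injC (h : Rels m a b c d σ) {x : W} (hx : x ∈ Subgroup.closure {b, d})
    (hs : σ x = 1) : x = 1 := by
  rcases h.memC hx with rfl | rfl | rfl | rfl
  · rfl
  · rw [h.sb] at hs; exact absurd hs (by decide)
  · rw [h.sd] at hs; exact absurd hs (by decide)
  · rw [map_mul, h.sb, h.sd] at hs; exact absurd hs (by decide)

theorem Rels.commC (h : Rels m a b c d σ) {x : W} (hx : x ∈ Subgroup.closure {b, d}) :
    x * b = b * x ∧ x * d = d * x := by
  have hbd := h.bd
  rcases h.memC hx with rfl | rfl | rfl | rfl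
  · simp
  · simp [hbd]
  · simp [hbd]
  · refine ⟨?_, ?_⟩
    · rw [mul_assoc, ← hbd]
    · rw [hbd, mul_assoc, ← hbd]

theorem Rels.memB (h : Rels m a b c d σ) {x : W} (hx : x ∈ Subgroup.closure {b, c, d}) :
    x ∈ Subgroup.closure {b, d} ∨
    (∃ u ∈ Subgroup.closure {b, d}, ∃ v ∈ Subgroup.closure {b, d}, x = u * c * v) ∨
    (∃ v ∈ Subgroup.closure {b, d}, x = c * b * d * c * v) := by
  have hb := h.bb
  have hd := h.dd
  have hc := h.cc
  have hbd := h.bd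
  have hbc := h.bc
  have hcd := h.cd
  have bC : b ∈ Subgroup.closure {b, d} := Subgroup.subset_closure (by simp)
  have dC : d ∈ Subgroup.closure {b, d} := Subgroup.subset_closure (by simp)
  have step : ∀ u, u = b ∨ u = c ∨ u = d → ∀ x : W, (x ∈ Subgroup.closure {b, d} ∨
    (∃ u ∈ Subgroup.closure {b, d}, ∃ v ∈ Subgroup.closure {b, d}, x = u * c * v) ∨
    (∃ v ∈ Subgroup.closure {b, d}, x = c * b * d * c * v)) → (u * x ∈ Subgroup.closure {b, d} ∨
    (∃ u' ∈ Subgroup.closure {b, d}, ∃ v ∈ Subgroup.closure {b, d}, u * x = u' * c * v) ∨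
    (∃ v ∈ Subgroup.closure {b, d}, u * x = c * b * d * c * v)) := by
    rintro z (rfl | rfl | rfl) x (hx | ⟨u, hu, v, hv, rfl⟩ | ⟨v, hv, rfl⟩)
    · exact Or.inl (mul_mem bC hx)
    · exact Or.inr (Or.inl ⟨z * u, mul_mem bC hu, v, hv, by simp only [mul_assoc]⟩)
    · refine Or.inr (Or.inr ⟨d * v, mul_mem dC hv, ?_⟩)
      calc z * (c * z * d * c * v) = (z * c * z) * d * c * v := by group
        _ = c * z * (c * d * c) * v := by rw [hbc]; group
        _ = c * z * d * c * (d * v) := by rw [← hcd]; group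
    · exact Or.inr (Or.inl ⟨1, one_mem _, x, hx, by simp⟩)
    · rcases h.memC hu with rfl | rfl | rfl | rfl
      · left
        rw [one_mul, ← mul_assoc, hc, one_mul]; exact hv
      · refine Or.inr (Or.inl ⟨u, bC, u * v, mul_mem bC hv, ?_⟩)
        rw [← mul_assoc, ← mul_assoc, ← hbc]; group
      · refine Or.inr (Or.inl ⟨u, dC, u * v, mul_mem dC hv, ?_⟩)
        rw [← mul_assoc, ← mul_assoc, ← hcd]; group
      · exact Or.inr (Or.inr ⟨v, hv, by group⟩)
    · refine Or.inr (Or.inl ⟨b * d, mul_mem bC dC, v, hv, ?_⟩)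
      calc z * (z * b * d * z * v) = (z * z) * b * d * z * v := by group
        _ = _ := by rw [hc]; group
    · exact Or.inl (mul_mem dC hx)
    · exact Or.inr (Or.inl ⟨z * u, mul_mem dC hu, v, hv, by simp only [mul_assoc]⟩)
    · refine Or.inr (Or.inr ⟨b * v, mul_mem bC hv, ?_⟩)
      calc z * (c * b * z * c * v) = z * c * (b * z) * c * v := by group
        _ = (z * c * z) * b * c * v := by rw [hbd]; group
        _ = c * z * (c * b * c) * v := by rw [hcd]; group
        _ = c * (z * b) * c * (b * v) := by rw [← hbc]; group
        _ = c * b * z * c * (b * v) := by rw [← hbd]; group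
  induction hx using Subgroup.closure_induction_left with
  | one => exact Or.inl (one_mem _)
  | mul_left u hu y hy ih => exact step u (by simpa using hu) y ih
  | inv_mul_cancel u hu y hy ih =>
    have hu' : u = b ∨ u = c ∨ u = d := by simpa using hu
    have : u⁻¹ = u := by
      rcases hu' with rfl | rfl | rfl
      · exact inv_of_sq hb
      · exact inv_of_sq hc
      · exact inv_of_sq hd
    rw [this]
    exact step u hu' y ih

theorem Rels.factB (h : Rels m a b c d σ) {x : W} (hx : x ∈ Subgroup.closure {b, c, d})
    (hC : x ∉ Subgroup.closure {b, d}) :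
    x * d * x⁻¹ = b ∨ x * d * x⁻¹ ∉ Subgroup.closure {b, d} := by
  have hb := h.bb
  have hd := h.dd
  have hc := h.cc
  have hbd := h.bd
  have hbc := h.bc
  have hcd := h.cd
  rcases h.memB hx with hx | ⟨u, hu, v, hv, rfl⟩ | ⟨v, hv, rfl⟩
  · exact absurd hx hC
  · right
    intro hmem
    have h1 : u⁻¹ * (u * c * v * d * (u * c * v)⁻¹) * u ∈ Subgroup.closure {b, d} :=
      mul_mem (mul_mem (inv_mem hu) hmem) hu
    have h2 : u⁻¹ * (u * c * v * d * (u * c * v)⁻¹) * u = c * d * c := by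
      calc _ = c * (v * d) * v⁻¹ * c⁻¹ := by group
        _ = c * d * c⁻¹ := by rw [(h.commC hv).2]; group
        _ = _ := by rw [inv_of_sq hc]
    rw [h2] at h1
    have h3 := h.sigmaC h1
    simp only [map_mul, h.sc, h.sd] at h3
    revert h3
    decide
  · left
    calc _ = c * b * d * c * (v * d) * v⁻¹ * c⁻¹ * d⁻¹ * b⁻¹ * c⁻¹ := by group
      _ = c * b * (d * c * d) * c⁻¹ * d⁻¹ * b⁻¹ * c⁻¹ := by rw [(h.commC hv).2]; group
      _ = (c * b * c) * b⁻¹ * c⁻¹ := by rw [hcd]; group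
      _ = b := by rw [← hbc]; group

theorem Rels.memA (h : Rels m a b c d σ) {x : W} (hx : x ∈ Subgroup.closure {a, b, d}) :
    ∃ k : ℤ, ∃ v ∈ Subgroup.closure {b, d}, x = (a * b) ^ k * v := by
  have ha := h.aa
  have hb := h.bb
  have hd := h.dd
  have hbd := h.bd
  have had := h.ad
  have bC : b ∈ Subgroup.closure {b, d} := Subgroup.subset_closure (by simp)
  have dC : d ∈ Subgroup.closure {b, d} := Subgroup.subset_closure (by simp)
  have e1 : b * (a * b) * b⁻¹ = (a * b)⁻¹ := by
    rw [mul_inv_rev, inv_of_sq hb, inv_of_sq ha, mul_assoc, mul_assoc, hb, mul_one]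
  have e2 : ∀ k : ℤ, b * (a * b) ^ k = (a * b) ^ (-k) * b := by
    intro k
    rw [← mul_inv_eq_iff_eq_mul, ← conj_zpow, e1, inv_zpow, zpow_neg]
  have e3 : ∀ k : ℤ, d * (a * b) ^ k = (a * b) ^ k * d := by
    intro k
    have : Commute d (a * b) := Commute.mul_right had.symm hbd.symm
    exact this.zpow_right k
  have step : ∀ u, u = a ∨ u = b ∨ u = d → ∀ x : W,
    (∃ k : ℤ, ∃ v ∈ Subgroup.closure {b, d}, x = (a * b) ^ k * v) →
    (∃ k : ℤ, ∃ v ∈ Subgroup.closure {b, d}, u * x = (a * b) ^ k * v) := by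
    rintro z (hz | hz | hz) x ⟨k, v, hv, rfl⟩
    · refine ⟨1 + -k, b * v, mul_mem bC hv, ?_⟩
      calc z * ((a * b) ^ k * v) = a * (b * b) * (a * b) ^ k * v := by rw [hb, hz]; group
        _ = (a * b) * (b * (a * b) ^ k) * v := by simp only [mul_assoc]
        _ = _ := by rw [e2, zpow_add, zpow_one]; simp only [mul_assoc]
    · refine ⟨-k, b * v, mul_mem bC hv, ?_⟩
      rw [hz, ← mul_assoc, e2, mul_assoc]
    · refine ⟨k, d * v, mul_mem dC hv, ?_⟩
      rw [hz, ← mul_assoc, e3, mul_assoc]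
  induction hx using Subgroup.closure_induction_left with
  | one => exact ⟨0, 1, one_mem _, by simp⟩
  | mul_left u hu y hy ih => exact step u (by simpa using hu) y ih
  | inv_mul_cancel u hu y hy ih =>
    have hu' : u = a ∨ u = b ∨ u = d := by simpa using hu
    have : u⁻¹ = u := by
      rcases hu' with rfl | rfl | rfl
      · exact inv_of_sq ha
      · exact inv_of_sq hb
      · exact inv_of_sq hd
    rw [this]
    exact step u hu' y ih

theorem Rels.bconj (h : Rels m a b c d σ) (k : ℤ) :
    (a * b) ^ k * b = b * ((a * b) ^ k)⁻¹ := by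
  have e1 : b * (a * b)⁻¹ * b⁻¹ = (a * b) := by
    rw [mul_inv_rev, inv_of_sq h.bb, inv_of_sq h.aa, ← mul_assoc, h.bb, one_mul]
  have := conj_zpow (i := k) (a := b) (b := (a * b)⁻¹)
  rw [e1, inv_zpow] at this
  exact eq_mul_inv_iff_mul_eq.mp this

theorem Rels.rpow (h : Rels m a b c d σ) (k : ℤ)
    (h2 : (a * b) ^ k * (a * b) ^ k = 1) : (a * b) ^ k = 1 := by
  obtain ⟨j, hj⟩ := h.modd
  have h1 : ((a * b) ^ k) ^ m = 1 := by
    rw [← zpow_natCast, zpow_comm, zpow_natCast, h.ab, one_zpow]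
  rw [hj, pow_succ, pow_mul, sq, h2, one_pow, one_mul] at h1
  exact h1

theorem Rels.sr (h : Rels m a b c d σ) (k : ℤ) : σ ((a * b) ^ k) = 1 := by
  rw [map_zpow, map_mul, h.sa, h.sb, Equiv.swap_mul_self, one_zpow]

theorem Rels.factA (h : Rels m a b c d σ) {x : W} (hx : x ∈ Subgroup.closure {a, b, d})
    (hC : x ∉ Subgroup.closure {b, d}) : x * b * x⁻¹ ∉ Subgroup.closure {b, d} := by
  intro hmem
  obtain ⟨k, v, hv, rfl⟩ := h.memA hx
  have bC : b ∈ Subgroup.closure {b, d} := Subgroup.subset_closure (by simp)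
  have h1 : (a * b) ^ k * v * b * ((a * b) ^ k * v)⁻¹ * b ∈ Subgroup.closure {b, d} :=
    mul_mem hmem bC
  have h2 : (a * b) ^ k * v * b * ((a * b) ^ k * v)⁻¹ * b = (a * b) ^ k * (a * b) ^ k := by
    calc _ = (a * b) ^ k * (v * b) * v⁻¹ * ((a * b) ^ k)⁻¹ * b := by
          simp only [mul_assoc, mul_inv_rev]
      _ = (a * b) ^ k * (b * ((a * b) ^ k)⁻¹) * b := by
          rw [(h.commC hv).1]; simp only [mul_assoc, mul_inv_cancel_left]
      _ = _ := by rw [← h.bconj]; simp only [mul_assoc, h.bb, mul_one]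
  rw [h2] at h1
  have h3 := h.injC h1 (by rw [map_mul, h.sr, one_mul])
  have h4 := h.rpow k h3
  rw [h4, one_mul] at hC
  exact hC hv

theorem Rels.commA (h : Rels m a b c d σ) {x : W} (hx : x ∈ Subgroup.closure {a, b, d}) :
    x * d = d * x := by
  have : Subgroup.closure {a, b, d} ≤ Subgroup.centralizer {d} := by
    rw [Subgroup.closure_le]
    rintro y (rfl | rfl | rfl)
    · simp [Subgroup.mem_centralizer_iff, h.ad]
    · simp [Subgroup.mem_centralizer_iff, h.bd]
    · simp [Subgroup.mem_centralizer_iff]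
  have := this hx
  rw [Subgroup.mem_centralizer_iff] at this
  exact (this d (by simp)).symm

/-- The two factors of the amalgamated product. -/
def fac (a b c d : W) (i : Bool) : Subgroup W :=
  Subgroup.closure (if i then {b, c, d} else {a, b, d})

theorem fac_le (a b c d : W) (i : Bool) : Subgroup.closure {b, d} ≤ fac a b c d i := by
  apply Subgroup.closure_mono
  cases i
  · simp
  · rintro y (rfl | rfl) <;> simp

theorem Rels.trichotomy (h : Rels m a b c d σ) {i k : Bool} {w : W}
    (hw : Alt (fac a b c d) (Subgroup.closure {b, d}) i k w) :
    (i = false ∧ w ∈ Subgroup.closure {a, b, d}) ∨ (i = true ∧ w * d * w⁻¹ = b) ∨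
      Alt (fac a b c d) (Subgroup.closure {b, d}) i i (w * d * w⁻¹) := by
  have dG : ∀ i, d ∈ fac a b c d i :=
    fun i => fac_le _ _ _ _ _ (Subgroup.subset_closure (by simp))
  have bG : ∀ i, b ∈ fac a b c d i :=
    fun i => fac_le _ _ _ _ _ (Subgroup.subset_closure (by simp))
  have hcj : ∀ (y w : W), y * w * d * (y * w)⁻¹ = y * (w * d * w⁻¹) * y⁻¹ := by
    intro y w; group
  induction hw with
  | single i y hy hC =>
    cases i with
    | false => exact Or.inl ⟨rfl, by simpa [fac] using hy⟩
    | true =>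
      rcases h.factB (by simpa [fac] using hy) hC with h1 | h1
      · exact Or.inr (Or.inl ⟨rfl, h1⟩)
      · exact Or.inr (Or.inr (Alt.single _ _ (mul_mem (mul_mem hy (dG _)) (inv_mem hy)) h1))
  | cons i k y w hy hC hw ih =>
    rw [hcj]
    cases i with
    | false =>
      rcases ih with ⟨h1, _⟩ | ⟨_, h1⟩ | h1
      · simp at h1
      · right; right
        rw [h1]
        exact Alt.single _ _ (mul_mem (mul_mem hy (bG _)) (inv_mem hy))
          (h.factA (by simpa [fac] using hy) hC)
      · exact Or.inr (Or.inr (h1.conj hy hC))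
    | true =>
      rcases ih with ⟨_, h1⟩ | ⟨h1, _⟩ | h1
      · have : w * d * w⁻¹ = d := by rw [h.commA h1]; group
        rw [this]
        rcases h.factB (by simpa [fac] using hy) hC with h1 | h1
        · exact Or.inr (Or.inl ⟨rfl, h1⟩)
        · exact Or.inr (Or.inr (Alt.single _ _ (mul_mem (mul_mem hy (dG _)) (inv_mem hy)) h1))
      · simp at h1
      · exact Or.inr (Or.inr (h1.conj hy hC))

theorem Rels.centralizer (h : Rels m a b c d σ) (hgen : Subgroup.closure {a, b, c, d} = ⊤)
    (f : W →* Monoid.PushoutI (fun i => Subgroup.inclusion (fac_le a b c d i)))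
    (hf : ∀ i (y : W) (hy : y ∈ fac a b c d i), f y = Monoid.PushoutI.of i ⟨y, hy⟩)
    {w : W} (hw : w * d = d * w) : w ∈ Subgroup.closure {a, b, d} := by
  have hall : w ∈ Subgroup.closure {b, d} ∨
      ∃ i k, Alt (fac a b c d) (Subgroup.closure {b, d}) i k w := by
    have hw' : w ∈ Subgroup.closure {a, b, c, d} := by rw [hgen]; trivial
    have hg : ∀ u ∈ ({a, b, c, d} : Set W), ∃ j, u ∈ fac a b c d j := by
      rintro u (rfl | rfl | rfl | rfl)
      · exact ⟨false, Subgroup.subset_closure (by simp)⟩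
      · exact ⟨true, Subgroup.subset_closure (by simp)⟩
      · exact ⟨true, Subgroup.subset_closure (by simp)⟩
      · exact ⟨true, Subgroup.subset_closure (by simp)⟩
    clear hw
    induction hw' using Subgroup.closure_induction_left with
    | one => exact Or.inl (one_mem _)
    | mul_left u hu y hy ih =>
      obtain ⟨j, hj⟩ := hg u hu
      exact Alt.mul_left (fac_le a b c d) ih hj
    | inv_mul_cancel u hu y hy ih =>
      obtain ⟨j, hj⟩ := hg u hu
      exact Alt.mul_left (fac_le a b c d) ih (inv_mem hj)
  have hcj : w * d * w⁻¹ = d := by rw [hw]; group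
  rcases hall with h1 | ⟨i, k, h1⟩
  · simpa [fac] using fac_le a b c d false h1
  · rcases h.trichotomy h1 with ⟨_, h2⟩ | ⟨_, h2⟩ | h2
    · exact h2
    · rw [hcj] at h2
      have h3 := h.sd
      rw [h2, h.sb] at h3
      exact absurd h3 (by decide)
    · rw [hcj] at h2
      exact absurd (Subgroup.subset_closure (by simp)) (h2.not_mem (fac_le a b c d) f hf)

theorem Rels.refl_mem (h : Rels m a b c d σ) {t : W} (ht : t ∈ Subgroup.closure {a, b, d})
    (h2 : t * t = 1) (hs : Equiv.Perm.sign (σ t) = -1) (hne : t ≠ d) :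
    t ∈ Subgroup.closure {a, b} := by
  obtain ⟨k, v, hv, rfl⟩ := h.memA ht
  have aD : a ∈ Subgroup.closure {a, b} := Subgroup.subset_closure (by simp)
  have bD : b ∈ Subgroup.closure {a, b} := Subgroup.subset_closure (by simp)
  have rD : (a * b) ^ k ∈ Subgroup.closure {a, b} := zpow_mem (mul_mem aD bD) k
  rw [map_mul, h.sr, one_mul] at hs
  rcases h.memC hv with rfl | rfl | rfl | rfl
  · simpa using rD
  · exact mul_mem rD bD
  · exfalso
    apply hne
    have hc : Commute ((a * b) ^ k) v := (Commute.mul_left h.ad h.bd : Commute (a * b) v).zpow_left k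
    have : (a * b) ^ k * (a * b) ^ k = 1 := by
      calc (a * b) ^ k * (a * b) ^ k = (a * b) ^ k * (a * b) ^ k * (v * v) := by rw [h.dd, mul_one]
        _ = (a * b) ^ k * (((a * b) ^ k * v) * v) := by simp only [mul_assoc]
        _ = (a * b) ^ k * ((v * (a * b) ^ k) * v) := by rw [hc.eq]
        _ = (a * b) ^ k * v * ((a * b) ^ k * v) := by simp only [mul_assoc]
        _ = 1 := h2
    rw [h.rpow k this, one_mul]
  · rw [map_mul, h.sb, h.sd] at hs
    exact absurd hs (by decide)

end PM

namespace PM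

variable {W : Type*} [Group W] {m : ℕ} {a b c d : W} {σ : W →* Equiv.Perm (Fin 4)}

/-- The homomorphism from the dihedral group. -/
noncomputable def dihHom (h : Rels m a b c d σ) (hord : orderOf (a * b) = m) :
    DihedralGroup m →* W :=
  have key : ∀ x y : ℤ, (x : ZMod m) = (y : ZMod m) → (a * b) ^ x = (a * b) ^ y := by
    intro x y hxy
    rw [zpow_eq_zpow_iff_modEq, hord]
    exact (ZMod.intCast_eq_intCast_iff _ _ _).mp hxy
  have hbr : ∀ k : ℤ, (a * b) ^ k * b = b * (a * b) ^ (-k) := by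
    intro k; rw [h.bconj, zpow_neg]
  MonoidHom.mk'
    (fun x => match x with
      | .r i => (a * b) ^ (i.cast : ℤ)
      | .sr i => b * (a * b) ^ (i.cast : ℤ))
    (by
      rintro (i | i) (j | j)
      · simp only [DihedralGroup.r_mul_r]
        rw [← zpow_add]
        apply key; simp
      · simp only [DihedralGroup.r_mul_sr]
        rw [← mul_assoc, hbr, mul_assoc, ← zpow_add]
        congr 1
        apply key; simp; ring
      · simp only [DihedralGroup.sr_mul_r]
        rw [mul_assoc, ← zpow_add]
        congr 1
        apply key; simp
      · simp only [DihedralGroup.sr_mul_sr]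
        rw [mul_assoc, ← mul_assoc _ b, hbr, mul_assoc, ← zpow_add, ← mul_assoc, h.bb, one_mul]
        apply key; simp; ring)

theorem dihEquiv (h : Rels m a b c d σ) (hord : orderOf (a * b) = m) :
    Nonempty (Subgroup.closure {a, b} ≃* DihedralGroup m) := by
  have hr : ∀ i, dihHom h hord (.r i) = (a * b) ^ (i.cast : ℤ) := fun _ => rfl
  have hsr : ∀ i, dihHom h hord (.sr i) = b * (a * b) ^ (i.cast : ℤ) := fun _ => rfl
  have key : ∀ x y : ℤ, (x : ZMod m) = (y : ZMod m) ↔ (a * b) ^ x = (a * b) ^ y := by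
    intro x y
    rw [zpow_eq_zpow_iff_modEq, hord]
    exact (ZMod.intCast_eq_intCast_iff _ _ _)
  have hinj : Function.Injective (dihHom h hord) := by
    rw [injective_iff_map_eq_one]
    rintro (i | i) hi
    · rw [hr, ← zpow_zero (a * b), ← key] at hi
      simp at hi
      rw [hi]; rfl
    · rw [hsr] at hi
      have := congrArg σ hi
      rw [map_mul, h.sr, h.sb, map_one] at this
      exact absurd this (by decide)
  have hrange : (dihHom h hord).range = Subgroup.closure {a, b} := by
    apply le_antisymm
    · rintro _ ⟨x, rfl⟩
      have aD : a ∈ Subgroup.closure {a, b} := Subgroup.subset_closure (by simp)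
      have bD : b ∈ Subgroup.closure {a, b} := Subgroup.subset_closure (by simp)
      rcases x with i | i
      · rw [hr]; exact zpow_mem (mul_mem aD bD) _
      · rw [hsr]; exact mul_mem bD (zpow_mem (mul_mem aD bD) _)
    · rw [Subgroup.closure_le]
      rintro y (rfl | rfl)
      · refine ⟨.sr (-1), ?_⟩
        rw [hsr]
        have : (y * b) ^ ((-1 : ZMod m).cast : ℤ) = (y * b) ^ (-1 : ℤ) := by
          rw [← key]; simp
        rw [this, zpow_neg, zpow_one, mul_inv_rev, ← mul_assoc, mul_inv_cancel, one_mul,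
          inv_of_sq h.aa]
      · refine ⟨.sr 0, ?_⟩
        rw [hsr]; simp
  rw [← hrange]
  exact ⟨(MonoidHom.ofInjective hinj).symm⟩

theorem exists_hom {B W : Type*} [Group W] {M : CoxeterMatrix B} (cs : CoxeterSystem M W)
    (m : ℕ)
    (x₁ x₂ x₃ x₄ : B) (h12 : x₁ ≠ x₂) (h13 : x₁ ≠ x₃) (h14 : x₁ ≠ x₄)
    (h23 : x₂ ≠ x₃) (h24 : x₂ ≠ x₄) (h34 : x₃ ≠ x₄)
    (hall : ∀ b : B, b = x₁ ∨ b = x₂ ∨ b = x₃ ∨ b = x₄)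
    (hm12 : M x₁ x₂ = m) (hm23 : M x₂ x₃ = 3) (hm34 : M x₃ x₄ = 3)
    (hm13 : M x₁ x₃ = 0) (hm14 : M x₁ x₄ = 2) (hm24 : M x₂ x₄ = 2)
    {H : Type*} [Group H] (p q r s : H) (hp : p * p = 1) (hq : q * q = 1) (hr : r * r = 1)
    (hs : s * s = 1) (hpq : (p * q) ^ m = 1) (hqr : (q * r) ^ 3 = 1) (hrs : (r * s) ^ 3 = 1)
    (hps : (p * s) ^ 2 = 1) (hqs : (q * s) ^ 2 = 1) :
    ∃ F : W →* H, F (cs.simple x₁) = p ∧ F (cs.simple x₂) = q ∧ F (cs.simple x₃) = r ∧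
      F (cs.simple x₄) = s := by
  classical
  have hrev : ∀ (u v : H) (n : ℕ), u * u = 1 → v * v = 1 → (u * v) ^ n = 1 → (v * u) ^ n = 1 := by
    intro u v n hu hv h
    have : v * u = (u * v)⁻¹ := by
      rw [mul_inv_rev, inv_of_sq hu, inv_of_sq hv]
    rw [this, inv_pow, h, inv_one]
  let g : B → H := fun i => if i = x₁ then p else if i = x₂ then q else if i = x₃ then r else s
  have g1 : g x₁ = p := by simp [g]
  have g2 : g x₂ = q := by simp [g, h12.symm]
  have g3 : g x₃ = r := by simp [g, h13.symm, h23.symm]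
  have g4 : g x₄ = s := by simp [g, h14.symm, h24.symm, h34.symm]
  have hl : M.IsLiftable g := by
    intro i j
    rcases hall i with rfl | rfl | rfl | rfl <;> rcases hall j with rfl | rfl | rfl | rfl
    · rw [g1, M.diagonal, hp, one_pow]
    · rw [g1, g2, hm12, hpq]
    · rw [hm13, pow_zero]
    · rw [g1, g4, hm14, hps]
    · rw [g1, g2, M.symmetric, hm12]; exact hrev _ _ _ hp hq hpq
    · rw [g2, M.diagonal, hq, one_pow]
    · rw [g2, g3, hm23, hqr]
    · rw [g2, g4, hm24, hqs]
    · rw [M.symmetric, hm13, pow_zero]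
    · rw [g2, g3, M.symmetric, hm23]; exact hrev _ _ _ hq hr hqr
    · rw [g3, M.diagonal, hr, one_pow]
    · rw [g3, g4, hm34, hrs]
    · rw [g1, g4, M.symmetric, hm14]; exact hrev _ _ _ hp hs hps
    · rw [g2, g4, M.symmetric, hm24]; exact hrev _ _ _ hq hs hqs
    · rw [g3, g4, M.symmetric, hm34]; exact hrev _ _ _ hr hs hrs
    · rw [g4, M.diagonal, hs, one_pow]
  refine ⟨cs.lift ⟨g, hl⟩, ?_, ?_, ?_, ?_⟩ <;> rw [cs.lift_apply_simple]
  exacts [g1, g2, g3, g4]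

/-- Four involutions of `(ZMod m)^4`. -/
def rho1 (m : ℕ) : Equiv.Perm (ZMod m × ZMod m × ZMod m × ZMod m) where
  toFun x := (x.2.1 + 1, x.1 - 1, x.2.2.1, x.2.2.2)
  invFun x := (x.2.1 + 1, x.1 - 1, x.2.2.1, x.2.2.2)
  left_inv x := by simp
  right_inv x := by simp

/-- Swap the first two coordinates. -/
def rho2 (m : ℕ) : Equiv.Perm (ZMod m × ZMod m × ZMod m × ZMod m) where
  toFun x := (x.2.1, x.1, x.2.2.1, x.2.2.2)
  invFun x := (x.2.1, x.1, x.2.2.1, x.2.2.2)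
  left_inv x := by simp
  right_inv x := by simp

/-- Swap the middle coordinates. -/
def rho3 (m : ℕ) : Equiv.Perm (ZMod m × ZMod m × ZMod m × ZMod m) where
  toFun x := (x.1, x.2.2.1, x.2.1, x.2.2.2)
  invFun x := (x.1, x.2.2.1, x.2.1, x.2.2.2)
  left_inv x := by simp
  right_inv x := by simp

/-- Swap the last coordinates. -/
def rho4 (m : ℕ) : Equiv.Perm (ZMod m × ZMod m × ZMod m × ZMod m) where
  toFun x := (x.1, x.2.1, x.2.2.2, x.2.2.1)
  invFun x := (x.1, x.2.1, x.2.2.2, x.2.2.1)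
  left_inv x := by simp
  right_inv x := by simp

theorem rho_pow (m k : ℕ) (x : ZMod m × ZMod m × ZMod m × ZMod m) :
    ((rho1 m * rho2 m) ^ k) x = (x.1 + k, x.2.1 - k, x.2.2.1, x.2.2.2) := by
  induction k with
  | zero => simp
  | succ k ih =>
    rw [pow_succ', Equiv.Perm.mul_apply, ih]
    simp only [rho1, rho2, Equiv.Perm.mul_apply, Equiv.coe_fn_mk, Nat.cast_succ]
    ext <;> simp <;> ring

theorem closure_eq {W : Type*} [Group W] {P : Type*} [Group P] (S : Set W) (f : W →* P)
    (K : Subgroup W) (hK : K = Subgroup.closure S) (g : K →* P)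
    (hS : ∀ y (_ : y ∈ S) (hyK : y ∈ K), f y = g ⟨y, hyK⟩) :
    ∀ y (hy : y ∈ K), f y = g ⟨y, hy⟩ := by
  subst hK
  intro y hy
  induction hy using Subgroup.closure_induction with
  | mem x hx => exact hS x hx _
  | one => rw [map_one]; exact (map_one g).symm
  | mul x y hx hy ihx ihy => rw [map_mul, ihx, ihy, ← map_mul]; rfl
  | inv x hx ih => rw [map_inv, ih, ← map_inv]; rfl

theorem main4 {B W : Type*} [Group W] {M : CoxeterMatrix B} (cs : CoxeterSystem M W)
    (m : ℕ) (hmodd : Odd m) (hm3 : 3 ≤ m)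
    (x₁ x₂ x₃ x₄ : B) (h12 : x₁ ≠ x₂) (h13 : x₁ ≠ x₃) (h14 : x₁ ≠ x₄)
    (h23 : x₂ ≠ x₃) (h24 : x₂ ≠ x₄) (h34 : x₃ ≠ x₄)
    (hall : ∀ b : B, b = x₁ ∨ b = x₂ ∨ b = x₃ ∨ b = x₄)
    (hm12 : M x₁ x₂ = m) (hm23 : M x₂ x₃ = 3) (hm34 : M x₃ x₄ = 3)
    (hm13 : M x₁ x₃ = 0) (hm14 : M x₁ x₄ = 2) (hm24 : M x₂ x₄ = 2) :
    Nonempty ((Subgroup.closure {t : W | cs.IsReflection t ∧ t ≠ cs.simple x₄ ∧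
          t * cs.simple x₄ = cs.simple x₄ * t}) ≃* DihedralGroup m) ∧
    ∀ x, ∃ w : W, w * cs.simple x₄ * w⁻¹ = cs.simple x := by
  obtain ⟨σ, sa, sb, sc, sd⟩ := exists_hom cs m x₁ x₂ x₃ x₄ h12 h13 h14 h23 h24 h34 hall hm12
    hm23 hm34 hm13 hm14 hm24 (Equiv.swap 0 1 : Equiv.Perm (Fin 4)) (Equiv.swap 0 1)
    (Equiv.swap 1 2) (Equiv.swap 2 3) (by decide) (by decide) (by decide) (by decide)
    (by rw [Equiv.swap_mul_self, one_pow]) (by decide) (by decide) (by decide) (by decide)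
  obtain ⟨ρ, ra, rb, -, -⟩ := exists_hom cs m x₁ x₂ x₃ x₄ h12 h13 h14 h23 h24 h34 hall hm12
    hm23 hm34 hm13 hm14 hm24 (rho1 m) (rho2 m) (rho3 m) (rho4 m)
    (by ext x <;> simp [rho1]) (by ext x <;> simp [rho2]) (by ext x <;> simp [rho3])
    (by ext x <;> simp [rho4]) (by apply Equiv.ext; intro x; rw [rho_pow]; simp)
    (by apply Equiv.ext; intro x; simp [pow_succ, rho2, rho3])
    (by apply Equiv.ext; intro x; simp [pow_succ, rho3, rho4])
    (by apply Equiv.ext; intro x; simp [pow_succ, rho1, rho4])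
    (by apply Equiv.ext; intro x; simp [pow_succ, rho2, rho4])
  have hab := cs.simple_mul_simple_pow x₁ x₂
  have hbc := cs.simple_mul_simple_pow x₂ x₃
  have hcd := cs.simple_mul_simple_pow x₃ x₄
  have had := cs.simple_mul_simple_pow x₁ x₄
  have hbd := cs.simple_mul_simple_pow x₂ x₄
  have haa := cs.simple_mul_simple_self x₁
  have hbb := cs.simple_mul_simple_self x₂
  have hcc := cs.simple_mul_simple_self x₃
  have hdd := cs.simple_mul_simple_self x₄
  have hgen := cs.subgroup_closure_range_simple
  have hrg : Set.range cs.simple = {cs.simple x₁, cs.simple x₂, cs.simple x₃, cs.simple x₄} := by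
    ext y
    constructor
    · rintro ⟨i, rfl⟩
      rcases hall i with rfl | rfl | rfl | rfl <;> simp
    · rintro (rfl | rfl | rfl | rfl) <;> exact ⟨_, rfl⟩
  rw [hrg] at hgen
  rw [hm12] at hab
  rw [hm23] at hbc
  rw [hm34] at hcd
  rw [hm14] at had
  rw [hm24] at hbd
  have ra1 := cs.isReflection_simple x₁
  have ra2 := cs.isReflection_simple x₂
  have braid : ∀ u v : W, u * u = 1 → v * v = 1 → (u * v) ^ 3 = 1 → u * v * u = v * u * v := by
    intro u v hu hv h
    have h1 : u * v * u * (v * u * v) = 1 := by rw [← h]; simp only [pow_succ, pow_zero, one_mul, mul_assoc]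
    rw [eq_inv_of_mul_eq_one_left h1, mul_inv_rev, mul_inv_rev, inv_of_sq hu, inv_of_sq hv, mul_assoc]
  have comm : ∀ u v : W, u * u = 1 → v * v = 1 → (u * v) ^ 2 = 1 → u * v = v * u := by
    intro u v hu hv h
    rw [sq] at h
    rw [eq_inv_of_mul_eq_one_left h, mul_inv_rev, inv_of_sq hu, inv_of_sq hv]
  have ex : ∀ (p q r s : Monoid.PushoutI (fun i => Subgroup.inclusion
      (fac_le (cs.simple x₁) (cs.simple x₂) (cs.simple x₃) (cs.simple x₄) i))), _ :=
    fun p q r s => exists_hom cs m x₁ x₂ x₃ x₄ h12 h13 h14 h23 h24 h34 hall hm12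
      hm23 hm34 hm13 hm14 hm24 p q r s
  have hrefl : ∀ t, cs.IsReflection t → Equiv.Perm.sign (σ t) = -1 := by
    rintro t ⟨w, i, rfl⟩
    have : Equiv.Perm.sign (σ (cs.simple i)) = -1 := by
      rcases hall i with rfl | rfl | rfl | rfl
      · rw [sa]; decide
      · rw [sb]; decide
      · rw [sc]; decide
      · rw [sd]; decide
    simp [this]
  have hsq : ∀ t, cs.IsReflection t → t * t = 1 := fun t ht => ht.mul_self
  have hx : ∀ x, cs.simple x = cs.simple x₁ ∨ cs.simple x = cs.simple x₂ ∨
      cs.simple x = cs.simple x₃ ∨ cs.simple x = cs.simple x₄ := by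
    intro x
    rcases hall x with rfl | rfl | rfl | rfl <;> simp
  generalize cs.simple x₁ = a at *
  generalize cs.simple x₂ = b at *
  generalize cs.simple x₃ = c at *
  generalize cs.simple x₄ = d at *
  have h : Rels m a b c d σ :=
    { modd := hmodd, aa := haa, bb := hbb, cc := hcc, dd := hdd, ab := hab
      bc := braid _ _ hbb hcc hbc, cd := (braid _ _ hcc hdd hcd).symm
      ad := comm _ _ haa hdd had, bd := comm _ _ hbb hdd hbd
      sa := sa, sb := sb, sc := sc, sd := sd }
  have hord : orderOf (a * b) = m := by
    apply Nat.dvd_antisymm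
    · exact orderOf_dvd_of_pow_eq_one hab
    · have h1 := congrArg ρ (pow_orderOf_eq_one (a * b))
      rw [map_pow, map_mul, ra, rb, map_one] at h1
      have h2 := congrArg Prod.fst (Equiv.congr_fun h1 (0, 0, 0, 0))
      rw [rho_pow] at h2
      simpa [ZMod.natCast_eq_zero_iff] using h2
  constructor
  · have memF : ∀ y ∈ ({a, b, d} : Set W), y ∈ fac a b c d false :=
      fun y hy => Subgroup.subset_closure (by simpa using hy)
    have memT : ∀ y ∈ ({b, c, d} : Set W), y ∈ fac a b c d true :=
      fun y hy => Subgroup.subset_closure (by simpa using hy)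
    have hagree : ∀ y ∈ Subgroup.closure {b, d}, ∀ (h1 : y ∈ fac a b c d false)
        (h2 : y ∈ fac a b c d true),
        (Monoid.PushoutI.of false ⟨y, h1⟩ :
          Monoid.PushoutI (fun i => Subgroup.inclusion (fac_le a b c d i))) =
        Monoid.PushoutI.of true ⟨y, h2⟩ := by
      intro y hy h1 h2
      have e1 := Monoid.PushoutI.of_apply_eq_base
        (fun i => Subgroup.inclusion (fac_le a b c d i)) false ⟨y, hy⟩
      have e2 := Monoid.PushoutI.of_apply_eq_base
        (fun i => Subgroup.inclusion (fac_le a b c d i)) true ⟨y, hy⟩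
      exact e1.trans e2.symm
    have agb := hagree b (Subgroup.subset_closure (by simp)) (memF b (by simp)) (memT b (by simp))
    have agd := hagree d (Subgroup.subset_closure (by simp)) (memF d (by simp)) (memT d (by simp))
    obtain ⟨f, f1, f2, f3, f4⟩ := ex (Monoid.PushoutI.of false ⟨a, memF a (by simp)⟩)
      (Monoid.PushoutI.of false ⟨b, memF b (by simp)⟩)
      (Monoid.PushoutI.of true ⟨c, memT c (by simp)⟩)
      (Monoid.PushoutI.of false ⟨d, memF d (by simp)⟩)
      (by rw [← map_mul, MulMemClass.mk_mul_mk]; simp only [haa]; exact map_one _)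
      (by rw [← map_mul, MulMemClass.mk_mul_mk]; simp only [hbb]; exact map_one _)
      (by rw [← map_mul, MulMemClass.mk_mul_mk]; simp only [hcc]; exact map_one _)
      (by rw [← map_mul, MulMemClass.mk_mul_mk]; simp only [hdd]; exact map_one _)
      (by rw [← map_mul, ← map_pow, MulMemClass.mk_mul_mk, SubmonoidClass.mk_pow]
          simp only [hab]; exact map_one _)
      (by rw [agb, ← map_mul, ← map_pow, MulMemClass.mk_mul_mk, SubmonoidClass.mk_pow]
          simp only [hbc]; exact map_one _)
      (by rw [agd, ← map_mul, ← map_pow, MulMemClass.mk_mul_mk, SubmonoidClass.mk_pow]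
          simp only [hcd]; exact map_one _)
      (by rw [← map_mul, ← map_pow, MulMemClass.mk_mul_mk, SubmonoidClass.mk_pow]
          simp only [had]; exact map_one _)
      (by rw [← map_mul, ← map_pow, MulMemClass.mk_mul_mk, SubmonoidClass.mk_pow]
          simp only [hbd]; exact map_one _)
    have hf : ∀ i (y : W) (hy : y ∈ fac a b c d i), f y = Monoid.PushoutI.of i ⟨y, hy⟩ := by
      intro i
      cases i with
      | false =>
        refine closure_eq {a, b, d} f _ (by simp [fac]) _ ?_
        rintro y (rfl | rfl | rfl) hy
        · exact f1
        · exact f2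
        · exact f4
      | true =>
        refine closure_eq {b, c, d} f _ (by simp [fac]) _ ?_
        rintro y (rfl | rfl | rfl) hy
        · exact f2.trans agb
        · exact f3
        · exact f4.trans agd
    have hcl : Subgroup.closure {t : W | cs.IsReflection t ∧ t ≠ d ∧ t * d = d * t} =
        Subgroup.closure {a, b} := by
      apply le_antisymm
      · rw [Subgroup.closure_le]
        rintro t ⟨ht, hne, hc⟩
        exact h.refl_mem (h.centralizer hgen f hf hc) (hsq t ht) (hrefl t ht) hne
      · rw [Subgroup.closure_le]
        rintro t (rfl | rfl)
        · refine Subgroup.subset_closure ⟨ra1, ?_, h.ad⟩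
          rintro rfl
          rw [sa] at sd
          exact absurd sd (by decide)
        · refine Subgroup.subset_closure ⟨ra2, ?_, h.bd⟩
          rintro rfl
          rw [sb] at sd
          exact absurd sd (by decide)
    rw [hcl]
    exact dihEquiv h hord
  · have conjd : ∀ u v : W, u * u = 1 → v * v = 1 → u * v * u = v * u * v →
        (v * u) * v * (v * u)⁻¹ = u := by
      intro u v hu hv huv
      rw [← huv]; group
    have wc : (d * c) * d * (d * c)⁻¹ = c := conjd c d hcc hdd h.cd.symm
    have wb : (c * b) * c * (c * b)⁻¹ = b := conjd b c hbb hcc h.bc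
    obtain ⟨j, hj⟩ := hmodd
    have wa : (a * b) ^ (((j : ℤ) + 1)) * b * ((a * b) ^ ((j : ℤ) + 1))⁻¹ = a := by
      have e1 : ((a * b) ^ ((j : ℤ) + 1)) = (a * b) ^ (-(j : ℤ)) := by
        rw [← mul_inv_eq_one, ← zpow_neg, ← zpow_add, neg_neg, ← hab, hj, ← zpow_natCast]
        congr 1; push_cast; ring
      nth_rewrite 2 [e1]
      have e2 := h.bconj (-(j : ℤ))
      rw [zpow_neg, inv_inv] at e2
      rw [zpow_neg, inv_inv, mul_assoc, ← e2, ← mul_assoc, ← zpow_neg, ← zpow_add]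
      simp [mul_assoc, hbb]
    intro x
    rcases hx x with e | e | e | e <;> rw [e]
    · refine ⟨(a * b) ^ (((j : ℤ) + 1)) * ((c * b) * (d * c)), ?_⟩
      calc _ = (a * b) ^ (((j : ℤ) + 1)) * ((c * b) * ((d * c) * d * (d * c)⁻¹) * (c * b)⁻¹) *
            ((a * b) ^ ((j : ℤ) + 1))⁻¹ := by simp only [mul_assoc, mul_inv_rev]
        _ = a := by rw [wc, wb, wa]
    · refine ⟨(c * b) * (d * c), ?_⟩
      calc _ = (c * b) * ((d * c) * d * (d * c)⁻¹) * (c * b)⁻¹ := by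
            simp only [mul_assoc, mul_inv_rev]
        _ = b := by rw [wc, wb]
    · exact ⟨_, wc⟩
    · exact ⟨1, by simp⟩

end PM

/-- Let `m ≥ 3` be odd and let `(W,S)` be a Coxeter system of type `P(m)`:
`S = {x₁, x₂, x₃, x₄}` with `m(x₁,x₂) = m`, `m(x₂,x₃) = m(x₃,x₄) = 3`, `m(x₁,x₃) = ∞`
(encoded as `0`), and `m(x₁,x₄) = m(x₂,x₄) = 2`.  Then for each generator `x`, the subgroup
`W^{⊥x}` generated by all reflections `t ≠ x` commuting with `x` is finite, isomorphic to the
dihedral group of order `2m` (the Coxeter group of type `I₂(m)`). -/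
theorem stmt_17 {B W : Type*} [Group W] {M : CoxeterMatrix B} (cs : CoxeterSystem M W)
    (m : ℕ) (hmodd : Odd m) (hm3 : 3 ≤ m)
    (x₁ x₂ x₃ x₄ : B) (h12 : x₁ ≠ x₂) (h13 : x₁ ≠ x₃) (h14 : x₁ ≠ x₄)
    (h23 : x₂ ≠ x₃) (h24 : x₂ ≠ x₄) (h34 : x₃ ≠ x₄)
    (hall : ∀ b : B, b = x₁ ∨ b = x₂ ∨ b = x₃ ∨ b = x₄)
    (hm12 : M x₁ x₂ = m) (hm23 : M x₂ x₃ = 3) (hm34 : M x₃ x₄ = 3)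
    (hm13 : M x₁ x₃ = 0) (hm14 : M x₁ x₄ = 2) (hm24 : M x₂ x₄ = 2) :
    ∀ x : B,
      Nonempty ((Subgroup.closure {t : W | cs.IsReflection t ∧ t ≠ cs.simple x ∧
          t * cs.simple x = cs.simple x * t}) ≃* DihedralGroup m) := by
  obtain ⟨⟨e⟩, hconj⟩ := PM.main4 cs m hmodd hm3 x₁ x₂ x₃ x₄ h12 h13 h14 h23 h24 h34 hall hm12
    hm23 hm34 hm13 hm14 hm24
  intro x
  obtain ⟨w, hw⟩ := hconj x
  have hmap : Subgroup.closure {t : W | cs.IsReflection t ∧ t ≠ cs.simple x ∧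
          t * cs.simple x = cs.simple x * t} =
      (Subgroup.closure {t : W | cs.IsReflection t ∧ t ≠ cs.simple x₄ ∧
          t * cs.simple x₄ = cs.simple x₄ * t}).map (MulAut.conj w).toMonoidHom := by
    rw [MonoidHom.map_closure]
    congr 1
    rw [← hw]
    generalize cs.simple x₄ = d
    ext t
    constructor
    · rintro ⟨h1, h2, h3⟩
      refine ⟨w⁻¹ * t * w, ⟨?_, ?_, ?_⟩, ?_⟩
      · have := h1.conj w⁻¹
        simpa using this
      · rintro rfl
        apply h2; group
      · calc w⁻¹ * t * w * d = w⁻¹ * (t * (w * d * w⁻¹)) * w := by group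
          _ = _ := by rw [h3]; group
      · simp [mul_assoc]
    · rintro ⟨t, ⟨h1, h2, h3⟩, rfl⟩
      refine ⟨?_, ?_, ?_⟩
      · simpa using h1.conj w
      · intro h; apply h2; simpa using h
      · simp only [MulEquiv.toMonoidHom_eq_coe, MonoidHom.coe_coe, MulAut.conj_apply, mul_assoc,
          inv_mul_cancel_left]
        rw [← mul_assoc t, h3, mul_assoc]
  rw [hmap]
  exact ⟨((Subgroup.equivMapOfInjective _ _ (MulAut.conj w).injective).symm).trans e⟩
end

section
/- Let (W,S) be a Coxeter system of type B_∞: S = {x₀, x₁, x₂, …} indexed by the natural numbers, with m(x₀,x₁) = 4, m(x_i, x_{i+1}) = 3 for all i ≥ 1, and m(x_i, x_j) = 2 whenever |i − j| ≥ 2. Then for every i ≥ 1, the subgroup W^{⊥x_i} of W generated by all reflections t with t ≠ x_i and t x_i = x_i t is isomorphic to W(A₁) × W(B_∞), i.e., to the direct product of a cyclic group of order 2 with a Coxeter group of the same type B_∞. -/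
/-- The function underlying the signed transposition of the points `p` and `q`. -/
def sgnRefFun (p q z : ℤ) : ℤ :=
  if z = p then q else if z = q then p else if z = -1 - p then -1 - q
  else if z = -1 - q then -1 - p else z

theorem sgnRefFun_invol (p q : ℤ) : Function.Involutive (sgnRefFun p q) := by
  intro z; unfold sgnRefFun; grind

/-- The signed transposition of `p` and `q`, where negation is `z ↦ -1 - z`. -/
def sgnRef (p q : ℤ) : Equiv.Perm ℤ := (sgnRefFun_invol p q).toPerm

theorem sgnRef_apply (p q z : ℤ) : sgnRef p q z = if z = p then q else if z = q then p else
   if z = -1 - p then -1 - q else if z = -1 - q then -1 - p else z := rfl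

theorem sgnRef_mul_self (p q : ℤ) : sgnRef p q * sgnRef p q = 1 := by
  ext z; exact sgnRefFun_invol p q z

theorem sgnRef_neg (p q : ℤ) : sgnRef (-1 - p) (-1 - q) = sgnRef p q := by
  ext z; simp only [sgnRef_apply]; grind

theorem sgnRef_symm (p q : ℤ) : sgnRef p q = sgnRef q p := by
  ext z; simp only [sgnRef_apply]; grind

theorem sgnRef_signed (p q z : ℤ) : sgnRef p q (-1 - z) = -1 - sgnRef p q z := by
  simp only [sgnRef_apply]; grind

theorem sgnRef_conj (g : Equiv.Perm ℤ) (hg : ∀ z, g (-1 - z) = -1 - g z) (p q : ℤ) :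
    g * sgnRef p q = sgnRef (g p) (g q) * g := by
  ext z
  simp only [Equiv.Perm.mul_apply, sgnRef_apply, ← hg, g.injective.eq_iff]
  split_ifs <;> rfl

theorem sgnRef_conj' (a b p q : ℤ) :
    sgnRef a b * sgnRef p q = sgnRef (sgnRef a b p) (sgnRef a b q) * sgnRef a b :=
  sgnRef_conj _ (sgnRef_signed a b) p q

theorem sgnRef_natAbs (k : ℤ) : sgnRef ((k.natAbs : ℤ) - 1) (k.natAbs : ℤ) = sgnRef (k - 1) k := by
  rcases Int.natAbs_eq k with h | h
  · rw [← h]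
  · ext z; simp only [sgnRef_apply]; grind

theorem sgnRef_comm {a b p q : ℤ} (h1 : sgnRef a b p = p) (h2 : sgnRef a b q = q) :
    sgnRef a b * sgnRef p q = sgnRef p q * sgnRef a b := by
  rw [sgnRef_conj', h1, h2]

section
variable {W : Type*} [Group W] (s : ℕ → W)

/-- coset representatives -/
def cosRep (n : ℕ) : ℕ → W
  | 0 => 1
  | m + 1 => s ((n : ℤ) - m).natAbs * cosRep n m

/-- parabolic subgroup -/
def parab (n : ℕ) : Subgroup W := Subgroup.closure (s '' {j | j < n})

theorem cosRep_pass
    (hc : ∀ i j, i + 2 ≤ j → s i * s j = s j * s i)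
    (hb : ∀ i, 1 ≤ i → s i * s (i + 1) * s i = s (i + 1) * s i * s (i + 1))
    (h4 : s 0 * s 1 * s 0 * s 1 = s 1 * s 0 * s 1 * s 0) (n m : ℕ) :
    ∀ j : ℕ, m ≤ 2 * n + 1 → j ≤ n → j ≠ ((n : ℤ) - m).natAbs → j ≠ ((n : ℤ) - m + 1).natAbs →
      ∃ u ∈ parab s n, s j * cosRep s n m = cosRep s n m * u := by
  induction m using Nat.strong_induction_on with
  | _ m ih =>
  intro j hm hj h1 h2
  rcases m with _ | m
  · exact ⟨s j, Subgroup.subset_closure ⟨j, by simp only [Set.mem_ofPred_eq]; omega, rfl⟩,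
      by simp [cosRep]⟩
  · by_cases hcom : j + 2 ≤ ((n : ℤ) - m).natAbs ∨ ((n : ℤ) - m).natAbs + 2 ≤ j
    · obtain ⟨u, hu, e⟩ := ih m (by omega) j (by omega) hj (by omega) (by omega)
      refine ⟨u, hu, ?_⟩
      have hsw : s j * s ((n : ℤ) - m).natAbs = s ((n : ℤ) - m).natAbs * s j := by
        rcases hcom with h | h
        · exact hc _ _ h
        · exact (hc _ _ h).symm
      simp only [cosRep]
      rw [← mul_assoc, hsw, mul_assoc, e, mul_assoc]
    · rcases m with _ | m
      · exfalso; omega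
      have hjj : j = ((n : ℤ) - m).natAbs := by omega
      by_cases hk : (n : ℤ) - m = 0
      · rcases m with _ | m
        · exfalso; omega
        have e0 : j = 0 := by omega
        have e1 : ((n : ℤ) - ((m + 1 + 1 : ℕ) : ℤ)).natAbs = 1 := by omega
        have e2 : ((n : ℤ) - ((m + 1 : ℕ) : ℤ)).natAbs = 0 := by omega
        have e3 : ((n : ℤ) - (m : ℤ)).natAbs = 1 := by omega
        obtain ⟨u, hu, e⟩ := ih m (by omega) 0 (by omega) (by omega) (by omega) (by omega)
        refine ⟨u, hu, ?_⟩
        simp only [cosRep, e0, e1, e2, e3]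
        calc s 0 * (s 1 * (s 0 * (s 1 * cosRep s n m)))
            = (s 0 * s 1 * s 0 * s 1) * cosRep s n m := by group
          _ = s 1 * (s 0 * (s 1 * (s 0 * cosRep s n m))) := by rw [h4]; group
          _ = _ := by rw [e]; group
      · obtain ⟨u, hu, e⟩ := ih m (by omega) ((n : ℤ) - ((m + 1 : ℕ) : ℤ)).natAbs
          (by omega) (by omega) (by omega) (by omega)
        refine ⟨u, hu, ?_⟩
        simp only [cosRep, hjj] at e ⊢
        set a := ((n : ℤ) - (m : ℤ)).natAbs with ha
        set b := ((n : ℤ) - ((m + 1 : ℕ) : ℤ)).natAbs with hb'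
        have hbr : s a * s b * s a = s b * s a * s b := by
          rcases (by omega : b = a + 1 ∨ a = b + 1) with h | h
          · rw [h]; exact hb a (by omega)
          · rw [h]; exact (hb b (by omega)).symm
        calc s a * (s b * (s a * cosRep s n m)) = (s a * s b * s a) * cosRep s n m := by group
          _ = s b * (s a * (s b * cosRep s n m)) := by rw [hbr]; group
          _ = _ := by rw [e]; group

theorem parab_succ (h0 : ∀ i, s i * s i = 1)
    (hc : ∀ i j, i + 2 ≤ j → s i * s j = s j * s i)
    (hb : ∀ i, 1 ≤ i → s i * s (i + 1) * s i = s (i + 1) * s i * s (i + 1))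
    (h4 : s 0 * s 1 * s 0 * s 1 = s 1 * s 0 * s 1 * s 0) (n : ℕ) (w : W)
    (hw : w ∈ parab s (n + 1)) :
    ∃ m, m ≤ 2 * n + 1 ∧ ∃ u ∈ parab s n, w = cosRep s n m * u := by
  have step : ∀ j, j < n + 1 → ∀ y : W,
      (∃ m, m ≤ 2 * n + 1 ∧ ∃ u ∈ parab s n, y = cosRep s n m * u) →
      (∃ m, m ≤ 2 * n + 1 ∧ ∃ u ∈ parab s n, s j * y = cosRep s n m * u) := by
    rintro j hj y ⟨m, hm, u, hu, rfl⟩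
    by_cases h1 : j = ((n : ℤ) - m).natAbs
    · refine ⟨m + 1, by omega, u, hu, ?_⟩
      simp only [cosRep, h1, mul_assoc]
    by_cases h2 : j = ((n : ℤ) - m + 1).natAbs
    · rcases m with _ | m
      · exfalso; omega
      have : j = ((n : ℤ) - m).natAbs := by omega
      refine ⟨m, by omega, u, hu, ?_⟩
      simp only [cosRep, ← this]
      rw [← mul_assoc, ← mul_assoc, h0, one_mul]
    · obtain ⟨v, hv, e⟩ := cosRep_pass s hc hb h4 n m j hm (by omega) h1 h2
      exact ⟨m, hm, v * u, mul_mem hv hu, by rw [← mul_assoc, e, mul_assoc]⟩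
  unfold parab at hw
  induction hw using Subgroup.closure_induction_left with
  | one => exact ⟨0, by omega, 1, one_mem _, by simp [cosRep]⟩
  | mul_left x hx y _ ih =>
    obtain ⟨j, hj, rfl⟩ := hx
    exact step j hj y ih
  | inv_mul_cancel x hx y _ ih =>
    obtain ⟨j, hj, rfl⟩ := hx
    rw [inv_eq_of_mul_eq_one_left (h0 j)]
    exact step j hj y ih

variable (φ : W →* Equiv.Perm ℤ)

theorem signed_inj (h0 : ∀ i, s i * s i = 1)
    (hc : ∀ i j, i + 2 ≤ j → s i * s j = s j * s i)
    (hb : ∀ i, 1 ≤ i → s i * s (i + 1) * s i = s (i + 1) * s i * s (i + 1))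
    (h4 : s 0 * s 1 * s 0 * s 1 = s 1 * s 0 * s 1 * s 0)
    (hgen : Subgroup.closure (Set.range s) = ⊤)
    (hφ : ∀ j : ℕ, φ (s j) = sgnRef ((j : ℤ) - 1) j) : Function.Injective φ := by
  have hcos : ∀ n m : ℕ, φ (cosRep s n m) (n : ℤ) = (n : ℤ) - m := by
    intro n m
    induction m with
    | zero => simp [cosRep]
    | succ m ih =>
      simp only [cosRep, map_mul, Equiv.Perm.mul_apply, ih, hφ, sgnRef_natAbs]
      simp only [sgnRef_apply]; grind
  have hfix : ∀ (n : ℕ), ∀ u ∈ parab s n, φ u (n : ℤ) = n := by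
    intro n u hu
    have : parab s n ≤ (MulAction.stabilizer (Equiv.Perm ℤ) (n : ℤ)).comap φ := by
      unfold parab
      rw [Subgroup.closure_le]
      rintro _ ⟨j, hj, rfl⟩
      simp only [Set.mem_ofPred_eq] at hj
      simp only [Subgroup.coe_comap, Set.mem_preimage, SetLike.mem_coe,
        MulAction.mem_stabilizer_iff, Equiv.Perm.smul_def, hφ, sgnRef_apply]
      grind
    exact this hu
  have hdesc : ∀ n : ℕ, ∀ w ∈ parab s n, φ w = 1 → w = 1 := by
    intro n
    induction n with
    | zero => intro w hw _; simpa [parab] using hw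
    | succ n ih =>
      intro w hw h
      obtain ⟨m, hm, u, hu, rfl⟩ := parab_succ s h0 hc hb h4 n w hw
      have h' := congrArg (fun g : Equiv.Perm ℤ => g (n : ℤ)) h
      simp only [map_mul, Equiv.Perm.mul_apply, hfix n u hu, hcos, Equiv.Perm.one_apply] at h'
      have : m = 0 := by omega
      subst this
      simp only [cosRep, one_mul] at h ⊢
      exact ih u hu h
  have hmono : ∀ a b : ℕ, a ≤ b → parab s a ≤ parab s b := fun a b hab =>
    Subgroup.closure_mono (Set.image_mono fun j hj => lt_of_lt_of_le hj hab)
  have hex : ∀ w : W, ∃ n, w ∈ parab s n := by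
    intro w
    have hw : w ∈ Subgroup.closure (Set.range s) := by rw [hgen]; trivial
    induction hw using Subgroup.closure_induction with
    | mem x hx =>
      obtain ⟨j, rfl⟩ := hx
      exact ⟨j + 1, Subgroup.subset_closure ⟨j, Nat.lt_succ_self j, rfl⟩⟩
    | one => exact ⟨0, one_mem _⟩
    | mul x y _ _ hx hy =>
      obtain ⟨a, ha⟩ := hx
      obtain ⟨b, hb⟩ := hy
      exact ⟨max a b, mul_mem (hmono _ _ (le_max_left _ _) ha) (hmono _ _ (le_max_right _ _) hb)⟩
    | inv x _ hx =>
      obtain ⟨a, ha⟩ := hx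
      exact ⟨a, inv_mem ha⟩
  rw [injective_iff_map_eq_one]
  intro w hw
  obtain ⟨n, hn⟩ := hex w
  exact hdesc n w hn hw

/-- every signed transposition is a conjugate of a generator -/
theorem sgnRef_conj_gen (hφ : ∀ j : ℕ, φ (s j) = sgnRef ((j : ℤ) - 1) j) (d : ℕ) :
    ∀ p q : ℤ, p < q → (q - p).toNat = d → ∃ (w : W) (j : ℕ), φ (w * s j * w⁻¹) = sgnRef p q := by
  have hS : ∀ k : ℤ, φ (s k.natAbs) = sgnRef (k - 1) k := fun k => by rw [hφ, sgnRef_natAbs]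
  have key : ∀ k p q p' q' : ℤ, (∃ (w : W) (j : ℕ), φ (w * s j * w⁻¹) = sgnRef p q) →
      sgnRef (k - 1) k p = p' → sgnRef (k - 1) k q = q' →
      ∃ (w : W) (j : ℕ), φ (w * s j * w⁻¹) = sgnRef p' q' := by
    rintro k p q p' q' ⟨w, j, h⟩ rfl rfl
    refine ⟨s k.natAbs * w, j, ?_⟩
    have : s k.natAbs * w * s j * (s k.natAbs * w)⁻¹
      = s k.natAbs * (w * s j * w⁻¹) * (s k.natAbs)⁻¹ := by group
    rw [this, map_mul, map_mul, h, map_inv, hS, sgnRef_conj', mul_inv_cancel_right]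
  induction d using Nat.strong_induction_on with
  | _ d ih =>
  intro p q hpq hd
  by_cases h1 : q = p + 1
  · refine ⟨1, q.natAbs, ?_⟩
    rw [one_mul, inv_one, mul_one, hS, h1]; congr 1; ring
  by_cases h2 : p = -1 - q
  · refine key q (p + 1) (q - 1) p q (ih _ ?_ (p + 1) (q - 1) (by omega) rfl) ?_ ?_
    · omega
    · rw [sgnRef_apply]; grind
    · rw [sgnRef_apply]; grind
  by_cases h3 : p = -q
  · refine key (p + 1) (p + 1) q p q (ih _ ?_ (p + 1) q (by omega) rfl) ?_ ?_
    · omega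
    · rw [sgnRef_apply]; grind
    · rw [sgnRef_apply]; grind
  · refine key q p (q - 1) p q (ih _ ?_ p (q - 1) (by omega) rfl) ?_ ?_
    · omega
    · rw [sgnRef_apply]; grind
    · rw [sgnRef_apply]; grind

theorem sgnRef_conj_gen' (hφ : ∀ j : ℕ, φ (s j) = sgnRef ((j : ℤ) - 1) j) (p q : ℤ) (h : p ≠ q) :
    ∃ (w : W) (j : ℕ), φ (w * s j * w⁻¹) = sgnRef p q := by
  rcases lt_or_gt_of_ne h with h | h
  · exact sgnRef_conj_gen s φ hφ _ p q h rfl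
  · rw [sgnRef_symm]; exact sgnRef_conj_gen s φ hφ _ q p h rfl

theorem phi_signed (hgen : Subgroup.closure (Set.range s) = ⊤)
    (hφ : ∀ j : ℕ, φ (s j) = sgnRef ((j : ℤ) - 1) j) (w : W) :
    ∀ z, φ w (-1 - z) = -1 - φ w z := by
  have hw : w ∈ Subgroup.closure (Set.range s) := by rw [hgen]; trivial
  induction hw using Subgroup.closure_induction with
  | mem x hx =>
    obtain ⟨j, rfl⟩ := hx
    intro z; rw [hφ, sgnRef_signed]
  | one => intro z; simp
  | mul x y _ _ hx hy => intro z; simp [hx, hy]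
  | inv x _ hx =>
    intro z
    apply (φ x).injective
    rw [hx, map_inv]; simp

end

/-- The order-preserving embedding of signed points avoiding `±i, ±(i-1)`. -/
def skipEquiv (i : ℤ) (hi : 1 ≤ i) :
    ℤ ≃ {z : ℤ // ¬ (z = i - 1 ∨ z = i ∨ z = -i ∨ z = -1 - i)} where
  toFun z := ⟨if i - 1 ≤ z then z + 2 else if z ≤ -i then z - 2 else z, by grind⟩
  invFun z := if i - 1 ≤ z.1 then z.1 - 2 else if z.1 ≤ -i then z.1 + 2 else z.1
  left_inv z := by grind
  right_inv z := by
    obtain ⟨z, hz⟩ := z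
    simp only [Subtype.mk.injEq]; grind

theorem skipEquiv_neg (i : ℤ) (hi : 1 ≤ i) (z : ℤ) :
    (skipEquiv i hi (-1 - z) : ℤ) = -1 - skipEquiv i hi z := by
  simp only [skipEquiv, Equiv.coe_fn_mk]; grind

theorem ext_sgnRef (i : ℤ) (hi : 1 ≤ i) (p q : ℤ) :
    (sgnRef p q).extendDomain (skipEquiv i hi) = sgnRef (skipEquiv i hi p) (skipEquiv i hi q) := by
  ext z
  by_cases hz : ¬ (z = i - 1 ∨ z = i ∨ z = -i ∨ z = -1 - i)
  · obtain ⟨y, hy⟩ := (skipEquiv i hi).surjective ⟨z, hz⟩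
    have hy' : z = skipEquiv i hi y := by rw [hy]
    rw [hy', Equiv.Perm.extendDomain_apply_image]
    simp only [sgnRef_apply, ← skipEquiv_neg, Subtype.val_injective.eq_iff,
      (skipEquiv i hi).injective.eq_iff]
    split_ifs <;> rfl
  · rw [Equiv.Perm.extendDomain_apply_not_subtype _ (skipEquiv i hi) hz, sgnRef_apply]
    have h1 := (skipEquiv i hi p).2
    have h2 := (skipEquiv i hi q).2
    grind

theorem sgnRef_class_aux (i : ℤ) (hi : 1 ≤ i) (p q : ℤ) (hpq : p ≠ q)
    (hp : p = i - 1 ∨ p = i ∨ p = -i ∨ p = -1 - i)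
    (a1 : sgnRef p q (sgnRef (i - 1) i p) = sgnRef (i - 1) i q) :
    sgnRef p q = sgnRef (i - 1) i ∨ sgnRef p q = sgnRef (i - 1) (-1 - i) := by
  have main : (p = i - 1 ∧ q = i) ∨ (p = i ∧ q = i - 1) ∨ (p = -i ∧ q = -1 - i) ∨
      (p = -1 - i ∧ q = -i) ∨ (p = i - 1 ∧ q = -1 - i) ∨ (p = -1 - i ∧ q = i - 1) ∨
      (p = -i ∧ q = i) ∨ (p = i ∧ q = -i) := by
    simp only [sgnRef_apply] at a1
    rcases hp with rfl | rfl | rfl | rfl <;> grind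
  rcases main with ⟨rfl, rfl⟩ | ⟨rfl, rfl⟩ | ⟨rfl, rfl⟩ | ⟨rfl, rfl⟩ | ⟨rfl, rfl⟩ | ⟨rfl, rfl⟩ |
    ⟨rfl, rfl⟩ | ⟨rfl, rfl⟩
  · exact Or.inl rfl
  · exact Or.inl (sgnRef_symm _ _)
  · left; rw [sgnRef_symm, ← sgnRef_neg, sgnRef_symm]; congr 1 <;> ring
  · left; rw [sgnRef_symm, ← sgnRef_neg]; congr 1 <;> ring
  · exact Or.inr rfl
  · exact Or.inr (sgnRef_symm _ _)
  · right; rw [← sgnRef_neg]; congr 1; ring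
  · right; rw [sgnRef_symm, ← sgnRef_neg]; congr 1; ring

theorem sgnRef_class (i : ℤ) (hi : 1 ≤ i) (p q : ℤ) (hpq : p ≠ q)
    (hne : sgnRef p q ≠ sgnRef (i - 1) i)
    (hcom : sgnRef p q * sgnRef (i - 1) i = sgnRef (i - 1) i * sgnRef p q) :
    sgnRef p q = sgnRef (i - 1) (-1 - i) ∨
    (¬ (p = i - 1 ∨ p = i ∨ p = -i ∨ p = -1 - i) ∧
      ¬ (q = i - 1 ∨ q = i ∨ q = -i ∨ q = -1 - i)) := by
  have hc : ∀ z, sgnRef p q (sgnRef (i - 1) i z) = sgnRef (i - 1) i (sgnRef p q z) := fun z =>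
    congrArg (fun g : Equiv.Perm ℤ => g z) hcom
  have b1 : sgnRef p q p = q := by simp [sgnRef_apply]
  have b2 : sgnRef q p q = p := by simp [sgnRef_apply]
  by_cases hp : p = i - 1 ∨ p = i ∨ p = -i ∨ p = -1 - i
  · have := hc p
    rw [b1] at this
    exact Or.inl ((sgnRef_class_aux i hi p q hpq hp this).resolve_left hne)
  by_cases hq : q = i - 1 ∨ q = i ∨ q = -i ∨ q = -1 - i
  · rw [sgnRef_symm p q] at hc hne ⊢
    have := hc q
    rw [b2] at this
    exact Or.inl ((sgnRef_class_aux i hi q p hpq.symm hq this).resolve_left hne)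
  exact Or.inr ⟨hp, hq⟩

theorem inv_rel {G : Type*} [Group G] {a b : G} (ha : a * a = 1) (hb : b * b = 1) (n : ℕ)
    (h : (a * b) ^ n = 1) : (b * a) ^ n = 1 := by
  have : b * a = (a * b)⁻¹ := by
    rw [mul_inv_rev, inv_eq_of_mul_eq_one_left ha, inv_eq_of_mul_eq_one_left hb]
  rw [this, inv_pow, h, inv_one]

theorem sgn_rel (a b : ℕ) (n : ℕ) (hab : a ≤ b) (h1 : a = b → n = 1)
    (h2 : a + 2 ≤ b → n = 2) (h3 : 1 ≤ a → b = a + 1 → n = 3) (h4 : a = 0 → b = 1 → n = 4) :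
    (sgnRef ((a : ℤ) - 1) a * sgnRef ((b : ℤ) - 1) b) ^ n = 1 := by
  rcases (by omega : a = b ∨ a + 2 ≤ b ∨ (1 ≤ a ∧ b = a + 1) ∨ (a = 0 ∧ b = 1)) with h | h | h | h
  · rw [h1 h, h, pow_one, sgnRef_mul_self]
  · rw [h2 h]
    ext z
    simp only [pow_succ, pow_zero, one_mul, Equiv.Perm.mul_apply, Equiv.Perm.one_apply]
    have e : ∀ y, sgnRef ((a : ℤ) - 1) a (sgnRef ((b : ℤ) - 1) b y) =
        sgnRef ((b : ℤ) - 1) b (sgnRef ((a : ℤ) - 1) a y) := by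
      intro y
      have : sgnRef ((a : ℤ) - 1) a * sgnRef ((b : ℤ) - 1) b =
        sgnRef ((b : ℤ) - 1) b * sgnRef ((a : ℤ) - 1) a := by
        apply sgnRef_comm <;> (rw [sgnRef_apply]; grind)
      exact congrArg (fun g : Equiv.Perm ℤ => g y) this
    have i1 := fun y => congrArg (fun g : Equiv.Perm ℤ => g y) (sgnRef_mul_self ((a : ℤ) - 1) a)
    have i2 := fun y => congrArg (fun g : Equiv.Perm ℤ => g y) (sgnRef_mul_self ((b : ℤ) - 1) b)
    simp only [Equiv.Perm.mul_apply, Equiv.Perm.one_apply] at i1 i2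
    rw [e z, i2, i1]
  · obtain ⟨h, rfl⟩ := h
    rw [h3 h rfl]
    set u := sgnRef ((a : ℤ) - 1) a with hu
    set v := sgnRef (((a + 1 : ℕ) : ℤ) - 1) (a + 1 : ℕ) with hv
    have uu : u * u = 1 := sgnRef_mul_self _ _
    have vv : v * v = 1 := sgnRef_mul_self _ _
    have r1 : u * v = sgnRef ((a : ℤ) - 1) (a + 1) * u := by
      rw [hu, hv, sgnRef_conj']; congr 2 <;> (rw [sgnRef_apply]; grind)
    have r2 : v * u = sgnRef ((a : ℤ) - 1) (a + 1) * v := by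
      rw [hu, hv, sgnRef_conj']; congr 2 <;> (rw [sgnRef_apply]; grind)
    have r3 : u * v * u = v * u * v := by
      rw [r1, r2, mul_assoc, mul_assoc, uu, vv]
    calc (u * v) ^ 3 = (u * v * u) * (v * u * v) := by simp only [pow_succ, pow_zero]; group
      _ = u * v * (u * u) * v * u := by rw [← r3]; group
      _ = u * (v * v) * u := by rw [uu]; group
      _ = 1 := by rw [vv, mul_one, uu]
  · obtain ⟨rfl, rfl⟩ := h
    rw [h4 rfl rfl]
    ext z
    simp only [pow_succ, pow_zero, one_mul, Equiv.Perm.mul_apply, Equiv.Perm.one_apply]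
    by_cases c0 : z = 0
    · subst c0; simp [sgnRef_apply]
    by_cases c1 : z = 1
    · subst c1; simp [sgnRef_apply]
    by_cases c2 : z = -1
    · subst c2; simp [sgnRef_apply]
    by_cases c3 : z = -2
    · subst c3; simp [sgnRef_apply]
    have e0 : sgnRef (((0 : ℕ) : ℤ) - 1) (0 : ℕ) z = z := by rw [sgnRef_apply]; grind
    have e1 : sgnRef (((1 : ℕ) : ℤ) - 1) (1 : ℕ) z = z := by rw [sgnRef_apply]; grind
    simp only [e0, e1]

theorem rel2 {G : Type*} [Group G] {a b : G} (ha : a * a = 1) (hb : b * b = 1)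
    (h : (a * b) ^ 2 = 1) : a * b = b * a := by
  have ha' := inv_eq_of_mul_eq_one_left ha
  have hb' := inv_eq_of_mul_eq_one_left hb
  have := eq_inv_of_mul_eq_one_left (show (a * b) * (a * b) = 1 by rw [← h, pow_two])
  rwa [mul_inv_rev, ha', hb'] at this

theorem rel3 {G : Type*} [Group G] {a b : G} (ha : a * a = 1) (hb : b * b = 1)
    (h : (a * b) ^ 3 = 1) : a * b * a = b * a * b := by
  have ha' := inv_eq_of_mul_eq_one_left ha
  have hb' := inv_eq_of_mul_eq_one_left hb
  have := eq_inv_of_mul_eq_one_left (show (a * b * a) * (b * a * b) = 1 by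
    rw [← h]; simp only [pow_succ, pow_zero]; group)
  rwa [mul_inv_rev, mul_inv_rev, ha', hb', ← mul_assoc] at this

theorem rel4 {G : Type*} [Group G] {a b : G} (ha : a * a = 1) (hb : b * b = 1)
    (h : (a * b) ^ 4 = 1) : a * b * a * b = b * a * b * a := by
  have ha' := inv_eq_of_mul_eq_one_left ha
  have hb' := inv_eq_of_mul_eq_one_left hb
  have := eq_inv_of_mul_eq_one_left (show (a * b * a * b) * (a * b * a * b) = 1 by
    rw [← h]; simp only [pow_succ, pow_zero]; group)
  rwa [mul_inv_rev, mul_inv_rev, mul_inv_rev, ha', hb', ← mul_assoc, ← mul_assoc] at this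

/-- The homomorphism from the cyclic group of order two given by an involution. -/
def invHom {G : Type*} [Group G] (a : G) (ha : a * a = 1) : Multiplicative (ZMod 2) →* G where
  toFun z := if z = 1 then 1 else a
  map_one' := by simp
  map_mul' y z := by
    have h : ∀ y : Multiplicative (ZMod 2), y = 1 ∨ y = Multiplicative.ofAdd 1 := by decide
    have h1 : Multiplicative.ofAdd (1 : ZMod 2) ≠ 1 := by decide
    have h2 : Multiplicative.ofAdd (1 : ZMod 2) * Multiplicative.ofAdd (1 : ZMod 2) = 1 := by decide
    rcases h y with rfl | rfl <;> rcases h z with rfl | rfl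
    · simp
    · simp
    · simp
    · rw [h2, if_pos rfl, if_neg h1, ha]

/-- Let `(W,S)` be a Coxeter system of type `B_∞`: the generators are `x 0, x 1, x 2, …`
(a bijective enumeration of `S` by `ℕ`) with `m(x 0, x 1) = 4`, `m(x i, x (i+1)) = 3` for
`i ≥ 1`, and `m(x i, x j) = 2` for `j ≥ i + 2`.  Then for every `i ≥ 1`, the subgroup
`W^{⊥ x i}` generated by all reflections `t ≠ x i` commuting with `x i` is isomorphic to
`W(A₁) × W(B_∞)`, i.e. to the direct product of a cyclic group of order 2 with a Coxeter group
of the same type `B_∞` — and `W` itself is such a group. -/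
theorem stmt_19 {B W : Type*} [Group W] {M : CoxeterMatrix B} (cs : CoxeterSystem M W)
    (x : ℕ → B) (hx : Function.Bijective x)
    (hm01 : M (x 0) (x 1) = 4)
    (hm1 : ∀ i : ℕ, 1 ≤ i → M (x i) (x (i + 1)) = 3)
    (hm2 : ∀ i j : ℕ, i + 2 ≤ j → M (x i) (x j) = 2) :
    ∀ i : ℕ, 1 ≤ i →
      Nonempty ((Subgroup.closure {t : W | cs.IsReflection t ∧ t ≠ cs.simple (x i) ∧
          t * cs.simple (x i) = cs.simple (x i) * t}) ≃*
        Multiplicative (ZMod 2) × W) := by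
  intro i hi
  obtain ⟨s, hs⟩ : ∃ s : ℕ → W, ∀ j, cs.simple (x j) = s j := ⟨_, fun _ => rfl⟩
  have h0 : ∀ j, s j * s j = 1 := fun j => by rw [← hs, cs.simple_mul_simple_self]
  have hc : ∀ a b, a + 2 ≤ b → s a * s b = s b * s a := fun a b h =>
    rel2 (h0 a) (h0 b) (by rw [← hs, ← hs, ← hm2 a b h, cs.simple_mul_simple_pow])
  have hb : ∀ a, 1 ≤ a → s a * s (a + 1) * s a = s (a + 1) * s a * s (a + 1) := fun a h =>
    rel3 (h0 a) (h0 _) (by rw [← hs, ← hs, ← hm1 a h, cs.simple_mul_simple_pow])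
  have h4 : s 0 * s 1 * s 0 * s 1 = s 1 * s 0 * s 1 * s 0 :=
    rel4 (h0 0) (h0 1) (by rw [← hs, ← hs, ← hm01, cs.simple_mul_simple_pow])
  have hgen : Subgroup.closure (Set.range s) = ⊤ := by
    rw [← cs.subgroup_closure_range_simple]
    congr 1
    ext w
    constructor
    · rintro ⟨j, rfl⟩; exact ⟨x j, hs j⟩
    · rintro ⟨b, rfl⟩
      obtain ⟨j, rfl⟩ := hx.2 b
      exact ⟨j, (hs j).symm⟩
  obtain ⟨φ, hφ⟩ : ∃ φ : W →* Equiv.Perm ℤ, ∀ j : ℕ, φ (s j) = sgnRef ((j : ℤ) - 1) j := by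
    let y := (Equiv.ofBijective x hx).symm
    have hy : ∀ j, y (x j) = j := fun j => (Equiv.ofBijective x hx).symm_apply_apply j
    have hle : ∀ a b : ℕ, a ≤ b →
        (sgnRef ((a : ℤ) - 1) a * sgnRef ((b : ℤ) - 1) b) ^ M (x a) (x b) = 1 := by
      intro a b hab
      apply sgn_rel a b _ hab
      · rintro rfl; exact M.diagonal _
      · exact hm2 a b
      · rintro h rfl; exact hm1 a h
      · rintro rfl rfl; exact hm01
    have hf : M.IsLiftable (fun b => sgnRef ((y b : ℤ) - 1) (y b)) := by
      intro p q
      obtain ⟨a, rfl⟩ := hx.2 p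
      obtain ⟨b, rfl⟩ := hx.2 q
      simp only [hy]
      rcases le_total a b with h | h
      · exact hle a b h
      · rw [M.symmetric]
        exact inv_rel (sgnRef_mul_self _ _) (sgnRef_mul_self _ _) _ (hle b a h)
    refine ⟨cs.lift ⟨_, hf⟩, fun j => ?_⟩
    rw [← hs, cs.lift_apply_simple hf, hy]
  have hinj : Function.Injective φ := signed_inj s φ h0 hc hb h4 hgen hφ
  have hsig := phi_signed s φ hgen hφ
  have hrefl : ∀ t, cs.IsReflection t → ∃ p q, p ≠ q ∧ φ t = sgnRef p q := by
    rintro _ ⟨w, b, rfl⟩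
    obtain ⟨j, rfl⟩ := hx.2 b
    refine ⟨φ w ((j : ℤ) - 1), φ w j, fun h => ?_, ?_⟩
    · have := (φ w).injective h
      omega
    · rw [hs, map_mul, map_mul, hφ, sgnRef_conj _ (hsig w), map_inv, mul_inv_cancel_right]
  have hrefl' : ∀ p q, p ≠ q → ∃ t, cs.IsReflection t ∧ φ t = sgnRef p q := by
    intro p q h
    obtain ⟨w, j, e⟩ := sgnRef_conj_gen' s φ hφ p q h
    exact ⟨_, ⟨w, x j, by rw [hs]⟩, e⟩
  have hi' : (1 : ℤ) ≤ i := by exact_mod_cast hi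
  set e := skipEquiv (i : ℤ) hi' with he
  set E := Equiv.Perm.extendDomainHom e with hE
  have hEr : ∀ p q, E (sgnRef p q) = sgnRef (e p) (e q) := fun p q => ext_sgnRef i hi' p q
  have hEi : Function.Injective E := Equiv.Perm.extendDomainHom_injective e
  have heinj : ∀ p q : ℤ, p ≠ q → (e p : ℤ) ≠ e q := fun p q h h' =>
    h (e.injective (Subtype.ext h'))
  have hrange : ∀ w, ∃ v, φ v = E (φ w) := by
    intro w
    have hle : Subgroup.closure (Set.range s) ≤ φ.range.comap (E.comp φ) := by
      rw [Subgroup.closure_le]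
      rintro _ ⟨j, rfl⟩
      obtain ⟨t, -, ht⟩ := hrefl' (e ((j : ℤ) - 1)) (e j) (heinj _ _ (by omega))
      exact ⟨t, by rw [ht, MonoidHom.comp_apply, hφ, hEr]⟩
    have := hle (show w ∈ _ by rw [hgen]; trivial)
    exact this
  choose ψ' hψ' using hrange
  let ψ : W →* W := MonoidHom.mk' ψ' (fun a b => hinj (by simp [hψ']))
  have hψ : ∀ w, φ (ψ w) = E (φ w) := hψ'
  obtain ⟨a, haR, ha⟩ := hrefl' ((i : ℤ) - 1) (-1 - i) (by omega)
  have haa : a * a = 1 := hinj (by rw [map_mul, ha, sgnRef_mul_self, map_one])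
  have hφi : φ (cs.simple (x i)) = sgnRef ((i : ℤ) - 1) i := by rw [hs, hφ]
  set T := {t : W | cs.IsReflection t ∧ t ≠ cs.simple (x i) ∧
          t * cs.simple (x i) = cs.simple (x i) * t} with hT
  have haT : a ∈ T := by
    refine ⟨haR, fun h => ?_, hinj ?_⟩
    · have h' := congrArg (fun g => φ g (i : ℤ)) h
      simp only [ha, hφi, sgnRef_apply] at h'
      grind
    · rw [map_mul, map_mul, ha, hφi]
      ext z
      simp only [Equiv.Perm.mul_apply, sgnRef_apply]
      grind
  have hskip : ∀ z, ¬ ((e z : ℤ) = i - 1 ∨ (e z : ℤ) = i ∨ (e z : ℤ) = -i ∨ (e z : ℤ) = -1 - i) :=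
    fun z => (e z).2
  have hψT : ∀ j, ψ (s j) ∈ T := by
    intro j
    have e1 : φ (ψ (s j)) = sgnRef (e ((j : ℤ) - 1)) (e j) := by rw [hψ, hφ, hEr]
    obtain ⟨t, htR, ht⟩ := hrefl' (e ((j : ℤ) - 1)) (e j) (heinj _ _ (by omega))
    have e2 : ψ (s j) = t := hinj (by rw [e1, ht])
    have k1 := hskip ((j : ℤ) - 1)
    have k2 := hskip j
    rw [e2]
    refine ⟨htR, fun h => ?_, hinj ?_⟩
    · have h' := congrArg (fun g => φ g (i : ℤ)) h
      simp only [ht, hφi, sgnRef_apply] at h'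
      grind
    · rw [map_mul, map_mul, ht, hφi]
      symm
      apply sgnRef_comm <;> (rw [sgnRef_apply]; grind)
  have hcomm : ∀ w, Commute a (ψ w) := by
    have hle : Subgroup.closure (Set.range s) ≤ (Subgroup.centralizer {a}).comap ψ := by
      rw [Subgroup.closure_le]
      rintro _ ⟨j, rfl⟩
      simp only [Subgroup.coe_comap, Set.mem_preimage, SetLike.mem_coe,
        Subgroup.mem_centralizer_singleton_iff]
      apply hinj
      rw [map_mul, map_mul, hψ, hφ, hEr, ha]
      have k1 := hskip ((j : ℤ) - 1)
      have k2 := hskip j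
      have := sgnRef_comm (a := (i : ℤ) - 1) (b := -1 - i) (p := e ((j : ℤ) - 1)) (q := e j)
        (by rw [sgnRef_apply]; grind) (by rw [sgnRef_apply]; grind)
      first | exact this | exact this.symm
    intro w
    have := hle (show w ∈ _ by rw [hgen]; trivial)
    simp only [Subgroup.mem_comap, Subgroup.mem_centralizer_singleton_iff] at this
    first | exact this | exact this.symm
  let Φ : Multiplicative (ZMod 2) × W →* W := MonoidHom.noncommCoprod (invHom a haa) ψ (by
    intro z w
    change Commute (if z = 1 then 1 else a) (ψ w)
    split_ifs
    · exact Commute.one_left _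
    · exact hcomm w)
  have hΦ : ∀ z w, Φ (z, w) = (if z = 1 then 1 else a) * ψ w := fun z w => rfl
  have hΦinj : Function.Injective Φ := by
    rw [injective_iff_map_eq_one]
    rintro ⟨z, w⟩ h
    rw [hΦ] at h
    have hz : z = 1 := by
      by_contra hz
      rw [if_neg hz] at h
      have h' := congrArg (fun g => φ g (i : ℤ)) h
      have hfix : E (φ w) (i : ℤ) = i :=
        Equiv.Perm.extendDomain_apply_not_subtype _ e (by simp)
      simp only [map_mul, Equiv.Perm.mul_apply, hψ, hfix, ha, map_one, Equiv.Perm.one_apply,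
        sgnRef_apply] at h'
      grind
    rw [if_pos hz, one_mul] at h
    have hw : w = 1 := hinj (hEi (by simp only [← hψ, h, map_one]))
    rw [hz, hw]; rfl
  have hΦrange : Φ.range = Subgroup.closure T := by
    apply le_antisymm
    · have hψle : ∀ w, ψ w ∈ Subgroup.closure T := by
        have hle : Subgroup.closure (Set.range s) ≤ (Subgroup.closure T).comap ψ := by
          rw [Subgroup.closure_le]
          rintro _ ⟨j, rfl⟩
          exact Subgroup.subset_closure (hψT j)
        intro w
        exact hle (show w ∈ _ by rw [hgen]; trivial)
      rintro _ ⟨⟨z, w⟩, rfl⟩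
      rw [hΦ]
      refine mul_mem ?_ (hψle w)
      split_ifs
      · exact one_mem _
      · exact Subgroup.subset_closure haT
    · rw [Subgroup.closure_le]
      rintro t ⟨htR, hne, hcom⟩
      obtain ⟨p, q, hpq, ht⟩ := hrefl t htR
      have c := sgnRef_class i hi' p q hpq
        (fun h => hne (hinj (by rw [ht, h, hφi])))
        (by rw [← ht, ← hφi, ← map_mul, hcom, map_mul])
      rcases c with c | ⟨hp, hq⟩
      · refine ⟨(Multiplicative.ofAdd 1, 1), ?_⟩
        rw [hΦ, if_neg (by decide), map_one, mul_one]
        exact hinj (by rw [ha, ht, c])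
      · obtain ⟨p', hp'⟩ := e.surjective ⟨p, hp⟩
        obtain ⟨q', hq'⟩ := e.surjective ⟨q, hq⟩
        obtain ⟨r, -, hr⟩ := hrefl' p' q' (by
          rintro rfl
          rw [hp'] at hq'
          exact hpq (congrArg Subtype.val hq'))
        refine ⟨(1, r), ?_⟩
        rw [hΦ, if_pos rfl, one_mul]
        exact hinj (by rw [hψ, hr, hEr, hp', hq', ht])
  exact ⟨((MonoidHom.ofInjective hΦinj).trans (MulEquiv.subgroupCongr hΦrange)).symm⟩
end
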